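/- Under the same setting and hypotheses (i)–(iv) on the random LSV system and its quenched measures, assume additionally α ∈ (0,1) and γ_max < 1/3. Then for m-a.e. x0 ∈ [0,1], with φ(x) := |x − x0|^{−1/α}, b := lim_{ε→0⁺} ε^{−1} ν({x : |x−x0| < ε}), b_n := (bn)^{1/α} and ν := ∫_Ω ν^ω d𝐏, the following holds for 𝐏-a.e. ω: there exists a (unique) Borel probability measure μ_α on ℝ whose characteristic function is t ↦ exp( i t α/(1−α) + ∫_0^∞ ( e^{itx} − 1 − itx·1_{[0,1]}(x) ) α x^{−α−1} dx ), and the laws under ν^ω of the normalized Birkhoff sums x ↦ (1/b_n) Σ_{j=0}^{n−1} φ(T_ω^j(x)) converge weakly to μ_α as n → ∞. -/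

import Mathlib

open MeasureTheory Filter Set Topology ENNReal

noncomputable section

/-- The two-sided shift space on `m` symbols. -/
abbrev Om (m : ℕ) := ℤ → Fin m

/-- The left shift on the two-sided shift space. -/
def shift {m : ℕ} (ω : Om m) : Om m := fun i => ω (i + 1)

/-- The inverse of the left shift. -/
def shiftInv {m : ℕ} (ω : Om m) : Om m := fun i => ω (i - 1)

/-- Lebesgue measure on `[0,1]`. -/
def mLeb : Measure ℝ := volume.restrict (Set.Icc 0 1)

/-- The Liverani–Saussol–Vaienti intermittent map with parameter `γ`. -/
def lsv (γ : ℝ) (x : ℝ) : ℝ :=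
  if x ≤ 1 / 2 then x * (1 + 2 ^ γ * x ^ γ) else 2 * x - 1

/-- The random composition `T_ω^n = T_{ω_{n−1}} ∘ ⋯ ∘ T_{ω_0}`. -/
def randComp {m : ℕ} (T : Fin m → ℝ → ℝ) (ω : Om m) : ℕ → ℝ → ℝ
  | 0 => fun x => x
  | n + 1 => fun x => T (ω (n : ℤ)) (randComp T ω n x)

/-- The total variation distance `‖μ − ν‖` of two (finite) measures, via the
Hahn–Jordan description `‖μ − ν‖ = sup_A (μ(A) − ν(A)) + sup_A (ν(A) − μ(A))`. -/
def tvDist (μ ν : Measure ℝ) : ℝ :=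
  (⨆ A : {A : Set ℝ // MeasurableSet A}, ((μ A).toReal - (ν A).toReal)) +
  (⨆ A : {A : Set ℝ // MeasurableSet A}, ((ν A).toReal - (μ A).toReal))

/-- The `C¹` norm of `g` on `[0,1]`. -/
def C1norm (g : ℝ → ℝ) : ℝ :=
  (⨆ x : Set.Icc (0 : ℝ) 1, |g x|) + (⨆ x : Set.Icc (0 : ℝ) 1, |deriv g x|)

/-- The observable `φ(x) = |x − x0|^{−1/α}`. -/
def phiObs (α x0 x : ℝ) : ℝ := |x - x0| ^ (-α⁻¹)

/-- Membership in `J = ⋃_i (u_i, v_i]` (with `v_i = ∞` allowed). -/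
def memJ {q : ℕ} (u : Fin q → ℝ) (v : Fin q → ℝ≥0∞) (y : ℝ) : Prop :=
  ∃ i, u i < y ∧ ENNReal.ofReal y ≤ v i

/-- `Π_α(J) = Σ_i (u_i^{−α} − v_i^{−α})`. -/
def PiAlpha (α : ℝ) {q : ℕ} (u : Fin q → ℝ) (v : Fin q → ℝ≥0∞) : ℝ :=
  ∑ i, ((u i) ^ (-α) - ((v i).toReal) ^ (-α))

/-- The set `A_n = φ^{−1}(b_n J) = {x : φ(x)/b_n ∈ J}`. -/
def Aset (α x0 bn : ℝ) {q : ℕ} (u : Fin q → ℝ) (v : Fin q → ℝ≥0∞) : Set ℝ :=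
  {x | memJ u v (phiObs α x0 x / bn)}

/-- The survival event `{x : R_A(ω)(x) > N}`. -/
def survSet {m : ℕ} (T : Fin m → ℝ → ℝ) (ω : Om m) (A : Set ℝ) (N : ℕ) : Set ℝ :=
  {x | ∀ k : ℕ, 1 ≤ k → k ≤ N → randComp T ω k x ∉ A}


/-- `μ` has the characteristic function of the totally skewed `α`-stable law
`t ↦ exp( i t α/(1−α) + ∫_0^∞ (e^{itx} − 1 − itx·1_{[0,1]}(x)) α x^{−α−1} dx )`. -/
def IsStableChar (α : ℝ) (μ : Measure ℝ) : Prop :=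
  ∀ t : ℝ, (∫ x, Complex.exp (Complex.I * t * x) ∂μ) =
    Complex.exp (Complex.I * t * (α / (1 - α)) +
      ∫ x in Set.Ioi (0 : ℝ),
        (Complex.exp (Complex.I * t * x) - 1 -
          Complex.I * t * x * (Set.indicator (Set.Icc (0 : ℝ) 1) (fun _ => (1 : ℂ)) x)) *
        ((α * x ^ (-α - 1) : ℝ) : ℂ))

section
lemma lsv_measurable (γ : ℝ) : Measurable (lsv γ) := by
  unfold lsv
  refine Measurable.ite measurableSet_Iic ?_ ?_ <;> fun_prop

lemma randComp_measurable {m : ℕ} (γ : Fin m → ℝ) (ω : Om m) (n : ℕ) :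
    Measurable (randComp (fun i => lsv (γ i)) ω n) := by
  induction n with
  | zero => exact measurable_id
  | succ n ih => exact (lsv_measurable _).comp ih

lemma randComp_succ' {m : ℕ} (T : Fin m → ℝ → ℝ) (ω : Om m) (n : ℕ) (x : ℝ) :
    randComp T ω (n + 1) x = randComp T (shift ω) n (T (ω 0) x) := by
  induction n with
  | zero => rfl
  | succ n ih =>
    have e1 : randComp T ω (n + 1 + 1) x = T (ω ((n + 1 : ℕ) : ℤ)) (randComp T ω (n + 1) x) := rfl
    have e2 : randComp T (shift ω) (n + 1) (T (ω 0) x)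
      = T (shift ω (n : ℤ)) (randComp T (shift ω) n (T (ω 0) x)) := rfl
    rw [e1, e2, ih]
    simp [shift]

/-- left branch -/
def lsvL (γ x : ℝ) : ℝ := x * (1 + 2 ^ γ * x ^ γ)

lemma lsvL_eq {γ x : ℝ} (hγ : 0 < γ) (hx : 0 ≤ x) : lsvL γ x = x + 2 ^ γ * x ^ (1 + γ) := by
  unfold lsvL
  rw [Real.rpow_add_of_nonneg hx (by norm_num) hγ.le, Real.rpow_one]; ring

lemma lsvL_half {γ : ℝ} : lsvL γ (1 / 2) = 1 := by
  unfold lsvL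
  rw [← Real.mul_rpow (by norm_num) (by norm_num)]
  norm_num

lemma lsvL_expand {γ x y : ℝ} (hγ : 0 < γ) (hx : 0 ≤ x) (hxy : x < y) :
    y - x < lsvL γ y - lsvL γ x := by
  rw [lsvL_eq hγ hx, lsvL_eq hγ (hx.trans hxy.le)]
  have h1 : x ^ (1 + γ) < y ^ (1 + γ) := Real.rpow_lt_rpow hx hxy (by linarith)
  have h2 : (0 : ℝ) < 2 ^ γ := Real.rpow_pos_of_pos (by norm_num) _
  nlinarith

lemma lsvL_convex {γ : ℝ} (hγ : 0 < γ) : ConvexOn ℝ (Ici 0) (lsvL γ) := by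
  have h1 : ConvexOn ℝ (Ici (0 : ℝ)) (fun x => x ^ (1 + γ)) := convexOn_rpow (by linarith)
  have h2 := (convexOn_id (𝕜 := ℝ) (convex_Ici (0 : ℝ))).add
    (h1.smul (c := (2 : ℝ) ^ γ) (Real.rpow_pos_of_pos (by norm_num) _).le)
  refine h2.congr ?_
  intro x hx
  simp [lsvL_eq hγ hx]

lemma lsvL_cont {γ : ℝ} (hγ : 0 < γ) : Continuous (lsvL γ) := by
  unfold lsvL
  have : Continuous (fun x : ℝ => x ^ γ) := Real.continuous_rpow_const hγ.le
  fun_prop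

lemma lsvL_surj {γ : ℝ} (hγ : 0 < γ) (y : ℝ) : ∃ x : ℝ, y ∈ Icc (0 : ℝ) 1 →
    (x ∈ Icc (0 : ℝ) (1 / 2) ∧ lsvL γ x = y) := by
  by_cases hy : y ∈ Icc (0 : ℝ) 1
  · have := intermediate_value_Icc (a := (0 : ℝ)) (b := 1 / 2) (by norm_num)
      (lsvL_cont hγ).continuousOn
    rw [lsvL_half] at this
    have h0 : lsvL γ 0 = 0 := by simp [lsvL]
    rw [h0] at this
    obtain ⟨x, hx, hxy⟩ := this hy
    exact ⟨x, fun _ => ⟨hx, hxy⟩⟩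
  · exact ⟨0, fun h => absurd h hy⟩

/-- inverse branches -/
def brI1 (γ : ℝ) (c : Bool) (y : ℝ) : ℝ :=
  if c then (if h : 0 < γ then Classical.choose (lsvL_surj h y) else 0) else (y + 1) / 2

lemma brI1_left {γ : ℝ} (hγ : 0 < γ) {y : ℝ} (hy : y ∈ Icc (0 : ℝ) 1) :
    brI1 γ true y ∈ Icc (0 : ℝ) (1 / 2) ∧ lsvL γ (brI1 γ true y) = y := by
  have := Classical.choose_spec (lsvL_surj hγ y) hy
  simpa [brI1, hγ] using this

lemma brI1_contract {γ : ℝ} (hγ : 0 < γ) (c : Bool) {y z : ℝ} (hy : y ∈ Icc (0 : ℝ) 1)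
    (hz : z ∈ Icc (0 : ℝ) 1) (hyz : y < z) :
    brI1 γ c y < brI1 γ c z ∧ brI1 γ c z - brI1 γ c y < z - y := by
  cases c with
  | false => constructor <;> simp [brI1] <;> linarith
  | true =>
    obtain ⟨⟨a1, a2⟩, a3⟩ := brI1_left hγ hy
    obtain ⟨⟨b1, b2⟩, b3⟩ := brI1_left hγ hz
    have h1 : brI1 γ true y < brI1 γ true z := by
      by_contra hcon
      push Not at hcon
      rcases hcon.eq_or_lt with h | h
      · rw [h] at b3; linarith
      · have := lsvL_expand hγ b1 h
        linarith
    refine ⟨h1, ?_⟩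
    have := lsvL_expand hγ a1 h1
    linarith

lemma brI1_mem {γ : ℝ} (hγ : 0 < γ) (c : Bool) {y : ℝ} (hy : y ∈ Icc (0 : ℝ) 1) :
    brI1 γ c y ∈ Icc (0 : ℝ) 1 := by
  cases c with
  | false => constructor <;> simp [brI1] <;> linarith [hy.1, hy.2]
  | true => 
    obtain ⟨⟨a1, a2⟩, a3⟩ := brI1_left hγ hy
    exact ⟨a1, by linarith⟩

lemma brI1_mem' {γ : ℝ} (hγ : 0 < γ) (c : Bool) {y : ℝ} (hy : y ∈ Ioc (0 : ℝ) 1) :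
    brI1 γ c y ∈ Ioc (0 : ℝ) 1 := by
  have h1 := brI1_mem hγ c (y := y) ⟨hy.1.le, hy.2⟩
  have h0 := brI1_mem hγ c (y := 0) (by simp)
  have := (brI1_contract hγ c (y := 0) (z := y) (by simp) ⟨hy.1.le, hy.2⟩ hy.1).1
  exact ⟨by linarith [h0.1], h1.2⟩

lemma brI1_concave {γ : ℝ} (hγ : 0 < γ) (c : Bool) : ConcaveOn ℝ (Icc 0 1) (brI1 γ c) := by
  cases c with
  | false =>
    refine ⟨convex_Icc _ _, ?_⟩
    intro x _ y _ a b _ _ hab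
    simp only [brI1, smul_eq_mul]
    have : a = 1 - b := by linarith
    subst this
    simp
    linarith
  | true =>
    refine ⟨convex_Icc _ _, ?_⟩
    intro x hx y hy a b ha hb hab
    obtain ⟨⟨a1, a2⟩, a3⟩ := brI1_left hγ hx
    obtain ⟨⟨b1, b2⟩, b3⟩ := brI1_left hγ hy
    have hmem := (convex_Icc (0 : ℝ) 1) hx hy ha hb hab
    obtain ⟨⟨c1, c2⟩, c3⟩ := brI1_left hγ hmem
    have hconv := (lsvL_convex hγ).2 (mem_Ici.2 a1) (mem_Ici.2 b1) ha hb hab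
    rw [a3, b3] at hconv
    by_contra hcon
    push Not at hcon
    have := lsvL_expand hγ c1 hcon
    linarith

lemma lsv_brI1 {γ : ℝ} (hγ : 0 < γ) (c : Bool) {y : ℝ} (hy : y ∈ Ioc (0 : ℝ) 1) :
    lsv γ (brI1 γ c y) = y := by
  cases c with
  | false =>
    have : ¬ ((y + 1) / 2 ≤ 1 / 2) := by linarith [hy.1]
    simp only [lsv, brI1, Bool.false_eq_true, if_false, this]
    ring
  | true =>
    obtain ⟨⟨a1, a2⟩, a3⟩ := brI1_left hγ (y := y) ⟨hy.1.le, hy.2⟩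
    simp only [lsv, a2, if_true]
    exact a3

lemma lsv_mem {γ : ℝ} (hγ : 0 < γ) {x : ℝ} (hx : x ∈ Ioc (0 : ℝ) 1) :
    lsv γ x ∈ Ioc (0 : ℝ) 1 ∧ ∃ c, brI1 γ c (lsv γ x) = x := by
  by_cases h : x ≤ 1 / 2
  · have e : lsv γ x = lsvL γ x := by simp only [lsv, h, if_true]; rfl
    have h0 : lsvL γ 0 = 0 := by simp [lsvL]
    have h1 := lsvL_expand hγ le_rfl hx.1
    have h2 : lsvL γ x ≤ 1 := by
      rcases h.eq_or_lt with h | h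
      · rw [h, lsvL_half]
      · have := lsvL_expand hγ hx.1.le h
        rw [lsvL_half] at this; linarith
    rw [e]
    have hm : lsvL γ x ∈ Ioc (0 : ℝ) 1 := ⟨by linarith [hx.1], h2⟩
    refine ⟨hm, true, ?_⟩
    obtain ⟨⟨a1, a2⟩, a3⟩ := brI1_left hγ (y := lsvL γ x) ⟨hm.1.le, hm.2⟩
    rcases lt_trichotomy (brI1 γ true (lsvL γ x)) x with h | h | h
    · have := lsvL_expand hγ a1 h
      linarith
    · exact h
    · have := lsvL_expand hγ hx.1.le h
      linarith
  · have e : lsv γ x = 2 * x - 1 := by simp only [lsv, h, if_false]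
    rw [e]
    push Not at h
    refine ⟨⟨by linarith, by linarith [hx.2]⟩, false, ?_⟩
    simp [brI1]

/-- inverse branches of the random composition -/
def brI {m : ℕ} (γ : Fin m → ℝ) : (j : ℕ) → Om m → (Fin j → Bool) → ℝ → ℝ
  | 0, _, _ => fun y => y
  | j + 1, ω, w => fun y => brI1 (γ (ω 0)) (w 0) (brI γ j (shift ω) (Fin.tail w) y)


lemma randComp_mem {m : ℕ} {γ : Fin m → ℝ} (hγ : ∀ i, 0 < γ i) (ω : Om m) (j : ℕ) {x : ℝ} (hx : x ∈ Ioc (0 : ℝ) 1) :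
    randComp (fun i => lsv (γ i)) ω j x ∈ Ioc (0 : ℝ) 1 := by
  induction j with
  | zero => exact hx
  | succ j ih => exact (lsv_mem (hγ _) ih).1

lemma brI_mem {m : ℕ} {γ : Fin m → ℝ} (hγ : ∀ i, 0 < γ i) (j : ℕ) (ω : Om m) (w : Fin j → Bool) {y : ℝ} (hy : y ∈ Icc (0 : ℝ) 1) :
    brI γ j ω w y ∈ Icc (0 : ℝ) 1 := by
  induction j generalizing ω with
  | zero => exact hy
  | succ j ih => exact brI1_mem (hγ _) _ (ih _ _)

lemma brI_mem' {m : ℕ} {γ : Fin m → ℝ} (hγ : ∀ i, 0 < γ i) (j : ℕ) (ω : Om m) (w : Fin j → Bool) {y : ℝ} (hy : y ∈ Ioc (0 : ℝ) 1) :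
    brI γ j ω w y ∈ Ioc (0 : ℝ) 1 := by
  induction j generalizing ω with
  | zero => exact hy
  | succ j ih => exact brI1_mem' (hγ _) _ (ih _ _)

lemma brI_contract {m : ℕ} {γ : Fin m → ℝ} (hγ : ∀ i, 0 < γ i) (j : ℕ) (ω : Om m) (w : Fin j → Bool) {y z : ℝ} (hy : y ∈ Icc (0 : ℝ) 1)
    (hz : z ∈ Icc (0 : ℝ) 1) (hyz : y < z) :
    brI γ j ω w y < brI γ j ω w z ∧ brI γ j ω w z - brI γ j ω w y ≤ z - y := by
  induction j generalizing ω with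
  | zero => exact ⟨hyz, le_rfl⟩
  | succ j ih =>
    obtain ⟨h1, h2⟩ := ih (shift ω) (Fin.tail w)
    obtain ⟨h3, h4⟩ := brI1_contract (hγ (ω 0)) (w 0) (brI_mem hγ j (shift ω) (Fin.tail w) hy)
      (brI_mem hγ j (shift ω) (Fin.tail w) hz) h1
    exact ⟨h3, h4.le.trans h2⟩

lemma brI_contract' {m : ℕ} {γ : Fin m → ℝ} (hγ : ∀ i, 0 < γ i) (j : ℕ) (hj : 1 ≤ j) (ω : Om m) (w : Fin j → Bool) {y z : ℝ}
    (hy : y ∈ Icc (0 : ℝ) 1) (hz : z ∈ Icc (0 : ℝ) 1) (hyz : y < z) :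
    brI γ j ω w z - brI γ j ω w y < z - y := by
  obtain ⟨j, rfl⟩ : ∃ k, j = k + 1 := ⟨j - 1, by omega⟩
  obtain ⟨h1, h2⟩ := brI_contract hγ j (shift ω) (Fin.tail w) hy hz hyz
  obtain ⟨h3, h4⟩ := brI1_contract (hγ (ω 0)) (w 0) (brI_mem hγ j (shift ω) (Fin.tail w) hy)
      (brI_mem hγ j (shift ω) (Fin.tail w) hz) h1
  exact h4.trans_le h2

lemma brI_mono {m : ℕ} {γ : Fin m → ℝ} (hγ : ∀ i, 0 < γ i) (j : ℕ) (ω : Om m) (w : Fin j → Bool) : MonotoneOn (brI γ j ω w) (Icc 0 1) := by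
  intro y hy z hz hyz
  rcases hyz.eq_or_lt with h | h
  · rw [h]
  · exact (brI_contract hγ j ω w hy hz h).1.le

lemma brI_concave {m : ℕ} {γ : Fin m → ℝ} (hγ : ∀ i, 0 < γ i) (j : ℕ) (ω : Om m) (w : Fin j → Bool) :
    ConcaveOn ℝ (Icc 0 1) (brI γ j ω w) := by
  induction j generalizing ω with
  | zero => exact concaveOn_id (convex_Icc _ _)
  | succ j ih =>
    refine ⟨convex_Icc _ _, ?_⟩
    intro x hx y hy a b ha hb hab
    have h1 := (ih (shift ω) (Fin.tail w)).2 hx hy ha hb hab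
    have mx := brI_mem hγ j (shift ω) (Fin.tail w) hx
    have my := brI_mem hγ j (shift ω) (Fin.tail w) hy
    have h2 := (brI1_concave (hγ (ω 0)) (w 0)).2 mx my ha hb hab
    refine h2.trans ?_
    have mm : MonotoneOn (brI1 (γ (ω 0)) (w 0)) (Icc 0 1) := by
      intro y hy z hz hyz
      rcases hyz.eq_or_lt with h | h
      · rw [h]
      · exact (brI1_contract (hγ _) _ hy hz h).1.le
    exact mm ((convex_Icc (0 : ℝ) 1) mx my ha hb hab)
      (brI_mem hγ j (shift ω) (Fin.tail w) ((convex_Icc (0 : ℝ) 1) hx hy ha hb hab)) h1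

lemma randComp_brI {m : ℕ} {γ : Fin m → ℝ} (hγ : ∀ i, 0 < γ i) (j : ℕ) (ω : Om m) (w : Fin j → Bool) {y : ℝ} (hy : y ∈ Ioc (0 : ℝ) 1) :
    randComp (fun i => lsv (γ i)) ω j (brI γ j ω w y) = y := by
  induction j generalizing ω with
  | zero => rfl
  | succ j ih =>
    rw [randComp_succ']
    simp only [brI]
    rw [lsv_brI1 (hγ _) _ (brI_mem' hγ j _ _ hy)]
    exact ih _ _

lemma brI_randComp {m : ℕ} {γ : Fin m → ℝ} (hγ : ∀ i, 0 < γ i) (j : ℕ) (ω : Om m) {x : ℝ} (hx : x ∈ Ioc (0 : ℝ) 1) :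
    ∃ w, brI γ j ω w (randComp (fun i => lsv (γ i)) ω j x) = x := by
  induction j generalizing ω x with
  | zero => exact ⟨fun _ => true, rfl⟩
  | succ j ih =>
    obtain ⟨h1, c, hc⟩ := lsv_mem (hγ (ω 0)) hx
    obtain ⟨w, hw⟩ := ih (shift ω) h1
    refine ⟨Fin.cons c w, ?_⟩
    rw [randComp_succ']
    simp only [brI, Fin.cons_zero, Fin.tail_cons, hw, hc]

lemma brI_inj {m : ℕ} {γ : Fin m → ℝ} (hγ : ∀ i, 0 < γ i) (j : ℕ) (ω : Om m) (w w' : Fin j → Bool) {y z : ℝ} (hy : y ∈ Ioc (0 : ℝ) 1)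
    (hz : z ∈ Ioc (0 : ℝ) 1) (h : brI γ j ω w y = brI γ j ω w' z) : w = w' := by
  induction j generalizing ω with
  | zero => exact Subsingleton.elim _ _
  | succ j ih =>
    simp only [brI] at h
    have m1 := brI_mem' hγ j (shift ω) (Fin.tail w) hy
    have m2 := brI_mem' hγ j (shift ω) (Fin.tail w') hz
    have e := congrArg (lsv (γ (ω 0))) h
    rw [lsv_brI1 (hγ _) _ m1, lsv_brI1 (hγ _) _ m2] at e
    have e2 := ih _ _ _ e
    have e3 : w 0 = w' 0 := by
      have t : ∀ y ∈ Ioc (0 : ℝ) 1, brI1 (γ (ω 0)) true y ≤ 1 / 2 := fun y hy =>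
        (brI1_left (hγ _) ⟨hy.1.le, hy.2⟩).1.2
      have f : ∀ y ∈ Ioc (0 : ℝ) 1, 1 / 2 < brI1 (γ (ω 0)) false y := fun y hy => by
        simp [brI1]; linarith [hy.1]
      cases h0 : w 0 <;> cases h1 : w' 0 <;> rw [h0, h1] at h
      · linarith [f _ m1, t _ m2]
      · linarith [t _ m1, f _ m2]
    rw [← Fin.cons_self_tail w, ← Fin.cons_self_tail w', e2, e3]

lemma brI_cont {m : ℕ} {γ : Fin m → ℝ} (hγ : ∀ i, 0 < γ i) (j : ℕ) (ω : Om m) (w : Fin j → Bool) : ContinuousOn (brI γ j ω w) (Icc 0 1) := by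
  have : LipschitzOnWith 1 (brI γ j ω w) (Icc 0 1) := by
    apply LipschitzOnWith.of_le_add
    intro y hy z hz
    rcases lt_trichotomy y z with h | h | h
    · have := (brI_contract hγ j ω w hy hz h).1
      have := dist_nonneg (x := y) (y := z)
      linarith
    · rw [h]; simp
    · have := (brI_contract hγ j ω w hz hy h).2
      rw [Real.dist_eq, abs_of_pos (by linarith)]
      linarith
  exact this.continuousOn

lemma brI_image {m : ℕ} {γ : Fin m → ℝ} (hγ : ∀ i, 0 < γ i) (j : ℕ) (ω : Om m) (w : Fin j → Bool) {x : ℝ}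
    (hx : x ∈ Ioc (brI γ j ω w 0) (brI γ j ω w 1)) : ∃ y ∈ Ioc (0 : ℝ) 1, brI γ j ω w y = x := by
  obtain ⟨y, hy, h⟩ := intermediate_value_Icc (zero_le_one) (brI_cont hγ j ω w) ⟨hx.1.le, hx.2⟩
  refine ⟨y, ⟨?_, hy.2⟩, h⟩
  rcases hy.1.eq_or_lt with h0 | h0
  · rw [← h0] at h; linarith [hx.1]
  · exact h0

lemma brI_disj {m : ℕ} {γ : Fin m → ℝ} (hγ : ∀ i, 0 < γ i) (j : ℕ) (ω : Om m) :
    Pairwise (fun w w' => Disjoint (Ioc (brI γ j ω w 0) (brI γ j ω w 1))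
      (Ioc (brI γ j ω w' 0) (brI γ j ω w' 1))) := by
  intro w w' hne
  rw [Set.disjoint_left]
  intro x hx hx'
  obtain ⟨y, hy, e⟩ := brI_image hγ j ω w hx
  obtain ⟨z, hz, e'⟩ := brI_image hγ j ω w' hx'
  exact hne (brI_inj hγ j ω w w' hy hz (e.trans e'.symm))

lemma brI_slope {m : ℕ} {γ : Fin m → ℝ} (hγ : ∀ i, 0 < γ i) (j : ℕ) (ω : Om m) (w : Fin j → Bool) {c p q : ℝ} (hc : 0 < c) (hp : c ≤ p)
    (hpq : p ≤ q) (hq : q ≤ 1) :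
    brI γ j ω w q - brI γ j ω w p ≤ (q - p) / c * (brI γ j ω w 1 - brI γ j ω w 0) := by
  have hs := brI_concave hγ j ω w
  set s := brI γ j ω w with hsdef
  have m0 : (0 : ℝ) ∈ Icc (0 : ℝ) 1 := by simp
  have m1 : (1 : ℝ) ∈ Icc (0 : ℝ) 1 := by simp
  have mp : p ∈ Icc (0 : ℝ) 1 := ⟨by linarith, by linarith⟩
  have mq : q ∈ Icc (0 : ℝ) 1 := ⟨by linarith, hq⟩
  have mono := brI_mono hγ j ω w
  rcases hpq.eq_or_lt with h | h
  · subst h; simp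
  · have hp0 : 0 < p := by linarith
    have h1 := hs.slope_anti_adjacent m0 mq hp0 h
    have h2 : s p - s 0 ≤ s 1 - s 0 := by
      have := mono mp m1 mp.2; linarith
    have h4 : s 0 ≤ s p := mono m0 mp mp.1
    rw [div_le_iff₀ (by linarith)] at h1
    calc s q - s p ≤ (s p - s 0) / (p - 0) * (q - p) := h1
      _ ≤ (s 1 - s 0) / c * (q - p) := by
        have h3 : (s p - s 0) / (p - 0) ≤ (s 1 - s 0) / c := by
          apply div_le_div₀ (by linarith) h2 hc (by linarith)
        exact mul_le_mul_of_nonneg_right h3 (by linarith)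
      _ = _ := by ring

/-- the key short return estimate -/
lemma short_measure {m : ℕ} {γ : Fin m → ℝ} (hγ : ∀ i, 0 < γ i) (j : ℕ) (ω : Om m) {c p q β₁ β₂ d : ℝ} (hc : 0 < c) (hβ : c ≤ β₁)
    (hββ : β₁ ≤ β₂) (hβ2 : β₂ ≤ 1) (hpq : p ≤ q)
    (hd : ∀ w, brI γ j ω w 1 - brI γ j ω w 0 ≤ d) :
    volume (Icc p q ∩ Ioc 0 1 ∩ (randComp (fun i => lsv (γ i)) ω j) ⁻¹' (Icc β₁ β₂)) ≤
      ENNReal.ofReal ((β₂ - β₁) / c * (q - p + 2 * d)) := by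
  classical
  set I : (Fin j → Bool) → Set ℝ := fun w => Ioc (brI γ j ω w 0) (brI γ j ω w 1) with hI
  set W : Finset (Fin j → Bool) := Finset.univ.filter (fun w => (I w ∩ Icc p q).Nonempty) with hW
  have m0 : (0 : ℝ) ∈ Icc (0 : ℝ) 1 := by simp
  have m1 : (1 : ℝ) ∈ Icc (0 : ℝ) 1 := by simp
  have mono := fun w => brI_mono hγ j ω w
  have hsub : Icc p q ∩ Ioc 0 1 ∩ (randComp (fun i => lsv (γ i)) ω j) ⁻¹' (Icc β₁ β₂) ⊆
      ⋃ w ∈ W, Icc (brI γ j ω w β₁) (brI γ j ω w β₂) := by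
    rintro x ⟨⟨hx1, hx2⟩, hx3⟩
    obtain ⟨w, hw⟩ := brI_randComp hγ j ω hx2
    have hm := randComp_mem hγ ω j hx2
    set y := randComp (fun i => lsv (γ i)) ω j x with hy
    have hx3 : y ∈ Icc β₁ β₂ := hx3
    simp only [mem_iUnion]
    refine ⟨w, ?_, ?_⟩
    · simp only [hW, Finset.mem_filter, Finset.mem_univ, true_and]
      refine ⟨x, ⟨?_, ?_⟩, hx1⟩
      · rw [← hw]; exact (brI_contract hγ j ω w m0 ⟨hm.1.le, hm.2⟩ hm.1).1
      · rw [← hw]; exact mono w ⟨hm.1.le, hm.2⟩ m1 hm.2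
    · rw [← hw]
      exact ⟨mono w ⟨by linarith, by linarith⟩ ⟨hm.1.le, hm.2⟩ hx3.1,
        mono w ⟨hm.1.le, hm.2⟩ ⟨by linarith, by linarith⟩ hx3.2⟩
  have hsum : ∑ w ∈ W, (brI γ j ω w 1 - brI γ j ω w 0) ≤ q - p + 2 * d := by
    have hlen : ∀ w, 0 ≤ brI γ j ω w 1 - brI γ j ω w 0 := fun w => by
      have := mono w m0 m1 zero_le_one; linarith
    have e : ENNReal.ofReal (∑ w ∈ W, (brI γ j ω w 1 - brI γ j ω w 0)) =
        volume (⋃ w ∈ W, I w) := by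
      rw [measure_biUnion_finset (fun w _ w' _ hne => brI_disj hγ j ω hne)
        (fun w _ => measurableSet_Ioc), ENNReal.ofReal_sum_of_nonneg (fun w _ => hlen w)]
      simp
    have hd0 : 0 ≤ d := (hlen (fun _ => true)).trans (hd _)
    have hle : volume (⋃ w ∈ W, I w) ≤ volume (Icc (p - d) (q + d)) := by
      apply measure_mono
      intro x hx
      simp only [mem_iUnion] at hx
      obtain ⟨w, hw, hx⟩ := hx
      simp only [hW, Finset.mem_filter, Finset.mem_univ, true_and] at hw
      obtain ⟨z, hz1, hz2⟩ := hw
      have := hd w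
      exact ⟨by linarith [hx.1, hz1.2, hz2.1], by linarith [hx.2, hz1.1, hz2.2]⟩
    rw [← e, Real.volume_Icc, ENNReal.ofReal_le_ofReal_iff (by linarith)] at hle
    linarith
  calc volume _ ≤ volume (⋃ w ∈ W, Icc (brI γ j ω w β₁) (brI γ j ω w β₂)) := measure_mono hsub
    _ ≤ ∑ w ∈ W, volume (Icc (brI γ j ω w β₁) (brI γ j ω w β₂)) :=
      measure_biUnion_finset_le _ _
    _ = ENNReal.ofReal (∑ w ∈ W, (brI γ j ω w β₂ - brI γ j ω w β₁)) := by
      rw [ENNReal.ofReal_sum_of_nonneg]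
      · simp
      · intro w _
        have := mono w (⟨by linarith, by linarith⟩ : β₁ ∈ Icc (0 : ℝ) 1)
          (⟨by linarith, by linarith⟩ : β₂ ∈ Icc (0 : ℝ) 1) hββ
        linarith
    _ ≤ _ := by
      apply ENNReal.ofReal_le_ofReal
      calc _ ≤ ∑ w ∈ W, (β₂ - β₁) / c * (brI γ j ω w 1 - brI γ j ω w 0) :=
            Finset.sum_le_sum (fun w _ => brI_slope hγ j ω w hc hβ hββ hβ2)
        _ = (β₂ - β₁) / c * ∑ w ∈ W, (brI γ j ω w 1 - brI γ j ω w 0) := by rw [Finset.mul_sum]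
        _ ≤ _ := mul_le_mul_of_nonneg_left hsum (div_nonneg (by linarith) hc.le)

end

section
/-- the decay rate -/
def rho (gmax : ℝ) (n : ℕ) : ℝ := (n : ℝ) ^ (1 - 1 / gmax) * (Real.log n) ^ (1 / gmax)

/-- bundled hypotheses on the system -/
structure SysHyp {m : ℕ} (γ : Fin m → ℝ) (gmax : ℝ) (ν : Om m → Measure ℝ) (h : Om m → ℝ → ℝ)
    (acone C : ℝ) : Prop where
  hγ : ∀ i, 0 < γ i
  g0 : 0 < gmax
  g1 : gmax < 1 / 3
  prob : ∀ ω, IsProbabilityMeasure (ν ω)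
  meas : ∀ ω, Measurable (h ω)
  dens : ∀ ω, ν ω = mLeb.withDensity (fun x => ENNReal.ofReal (h ω x))
  equiv : ∀ ω : Om m, (ν ω).map (lsv (γ (ω 0))) = ν (shift ω)
  a0 : 0 < acone
  cone : ∀ ω, ContinuousOn (h ω) (Set.Ioc 0 1) ∧ (∀ x, 0 ≤ h ω x) ∧
      AntitoneOn (h ω) (Set.Ioc 0 1) ∧
      MonotoneOn (fun x => x ^ (gmax + 1) * h ω x) (Set.Ioc 0 1) ∧
      ∀ x ∈ Set.Ioc (0 : ℝ) 1, h ω x ≤ acone * x ^ (-gmax)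
  C0 : 0 < C
  dec : ∀ g : ℝ → ℝ, ContDiff ℝ 1 g → ∀ (ω : Om m) (N : ℕ), 2 ≤ N →
      (SignedMeasure.totalVariation
        (((ν ω).withDensityᵥ (fun x => g x - ∫ y, g y ∂(ν ω))).map
          (randComp (fun i => lsv (γ i)) ω N)) Set.univ).toReal ≤
        C * C1norm g * (N : ℝ) ^ (1 - 1 / gmax) * (Real.log N) ^ (1 / gmax)

namespace SysHyp
variable {m : ℕ} {γ : Fin m → ℝ} {gmax : ℝ} {ν : Om m → Measure ℝ} {h : Om m → ℝ → ℝ}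
    {acone C : ℝ}

lemma apply_eq (H : SysHyp γ gmax ν h acone C) (ω : Om m) {S : Set ℝ} (hS : MeasurableSet S)
    (hS1 : S ⊆ Ioc 0 1) : ν ω S = ∫⁻ x in S, ENNReal.ofReal (h ω x) := by
  rw [H.dens, withDensity_apply _ hS, mLeb, Measure.restrict_restrict hS]
  congr 2
  exact inter_eq_left.2 (hS1.trans Ioc_subset_Icc_self)

lemma compl_zero (H : SysHyp γ gmax ν h acone C) (ω : Om m) : ν ω (Ioc 0 1)ᶜ = 0 := by
  rw [H.dens]
  apply withDensity_absolutelyContinuous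
  rw [mLeb, ← Measure.restrict_congr_set Ioc_ae_eq_Icc]
  rw [Measure.restrict_apply measurableSet_Ioc.compl]
  simp

lemma ae_mem (H : SysHyp γ gmax ν h acone C) (ω : Om m) : ∀ᵐ x ∂(ν ω), x ∈ Ioc (0 : ℝ) 1 :=
  H.compl_zero ω

lemma le_vol (H : SysHyp γ gmax ν h acone C) {c : ℝ} (hc : 0 < c) (ω : Om m) :
    (ν ω).restrict (Ici c) ≤ ENNReal.ofReal (acone * c ^ (-gmax)) • volume := by
  refine Measure.le_iff.2 fun S hS => ?_
  rw [Measure.restrict_apply hS]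
  have e : ν ω (S ∩ Ici c) = ν ω (S ∩ Icc c 1) := by
    apply measure_congr
    filter_upwards [H.ae_mem ω] with x hx
    apply propext
    change (x ∈ S ∧ c ≤ x) ↔ (x ∈ S ∧ (c ≤ x ∧ x ≤ 1))
    have := hx.2
    tauto
  rw [e, H.apply_eq ω (hS.inter measurableSet_Icc)
    (fun x hx => ⟨by linarith [hx.2.1], hx.2.2⟩)]
  calc ∫⁻ x in S ∩ Icc c 1, ENNReal.ofReal (h ω x)
      ≤ ∫⁻ x in S ∩ Icc c 1, ENNReal.ofReal (acone * c ^ (-gmax)) := by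
        apply setLIntegral_mono' (hS.inter measurableSet_Icc)
        intro x hx
        apply ENNReal.ofReal_le_ofReal
        refine ((H.cone ω).2.2.2.2 x ⟨by linarith [hx.2.1], hx.2.2⟩).trans ?_
        apply mul_le_mul_of_nonneg_left _ H.a0.le
        exact Real.rpow_le_rpow_of_nonpos hc hx.2.1 (by linarith [H.g0])
    _ = ENNReal.ofReal (acone * c ^ (-gmax)) * volume (S ∩ Icc c 1) := by simp
    _ ≤ ENNReal.ofReal (acone * c ^ (-gmax)) * volume S := by
      gcongr; exact inter_subset_left
    _ = _ := by simp

lemma exists_min (H : SysHyp γ gmax ν h acone C) :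
    ∃ κ : ℝ, 0 < κ ∧ ∀ ω, ∀ x ∈ Ioc (0 : ℝ) 1, κ ≤ h ω x := by
  set μ0 : Measure ℝ := (volume.restrict (Ioc (0 : ℝ) 1)).withDensity
    (fun x => ENNReal.ofReal (acone * x ^ (-gmax))) with hμ0
  have hint : IntegrableOn (fun x : ℝ => acone * x ^ (-gmax)) (Ioc 0 1) := by
    have := (intervalIntegral.intervalIntegrable_rpow' (a := 0) (b := 1) (r := -gmax)
      (by linarith [H.g1])).const_mul acone
    rwa [intervalIntegrable_iff_integrableOn_Ioc_of_le zero_le_one] at this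
  have hfin : IsFiniteMeasure μ0 := by
    rw [hμ0]
    exact isFiniteMeasure_withDensity_ofReal hint.2
  have hlim : Tendsto (fun k : ℕ => μ0 (Ioc 0 (1 / ((k : ℝ) + 1)))) atTop (𝓝 0) := by
    have hanti : Antitone (fun k : ℕ => Ioc (0 : ℝ) (1 / ((k : ℝ) + 1))) := by
      intro a b hab
      apply Ioc_subset_Ioc_right
      apply one_div_le_one_div_of_le (by positivity)
      have : (a : ℝ) ≤ b := by exact_mod_cast hab
      linarith
    have := tendsto_measure_iInter_atTop (μ := μ0)
      (s := fun k : ℕ => Ioc (0 : ℝ) (1 / ((k : ℝ) + 1)))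
      (fun k => measurableSet_Ioc.nullMeasurableSet) hanti ⟨0, measure_ne_top _ _⟩
    have e : (⋂ k : ℕ, Ioc (0 : ℝ) (1 / ((k : ℝ) + 1))) = ∅ := by
      ext x
      simp only [mem_iInter, mem_empty_iff_false, iff_false, not_forall]
      by_cases hx : 0 < x
      · obtain ⟨k, hk⟩ := exists_nat_one_div_lt hx
        exact ⟨k, fun h => by linarith [h.2]⟩
      · exact ⟨0, fun h => hx h.1⟩
    rw [e, measure_empty] at this
    exact this
  obtain ⟨k, hk⟩ := ((ENNReal.tendsto_nhds_zero.1 hlim) (1 / 2) (by simp)).exists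
  set δ : ℝ := 1 / ((k : ℝ) + 1) with hδ
  have hδ0 : 0 < δ := by positivity
  have hδ1 : δ ≤ 1 := by
    rw [hδ, div_le_one (by positivity)]
    have : (0 : ℝ) ≤ k := by positivity
    linarith
  refine ⟨δ ^ (gmax + 1) / 2, by positivity, ?_⟩
  intro ω x hx
  have := H.prob ω
  obtain ⟨-, hnn, hanti, hmono, hle⟩ := H.cone ω
  have m1 : (1 : ℝ) ∈ Ioc (0 : ℝ) 1 := by simp
  have h1 : h ω 1 ≤ h ω x := hanti hx m1 hx.2
  refine le_trans ?_ h1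
  have b1 : ν ω (Ioc 0 δ) ≤ 1 / 2 := by
    refine le_trans ?_ hk
    rw [H.apply_eq ω measurableSet_Ioc (Ioc_subset_Ioc_right hδ1), hμ0,
      withDensity_apply _ measurableSet_Ioc, Measure.restrict_restrict measurableSet_Ioc,
      inter_eq_left.2 (Ioc_subset_Ioc_right hδ1)]
    apply setLIntegral_mono' measurableSet_Ioc
    intro y hy
    exact ENNReal.ofReal_le_ofReal (hle y ⟨hy.1, hy.2.trans hδ1⟩)
  have b2 : ν ω (Ioc δ 1) ≤ ENNReal.ofReal (h ω 1 / δ ^ (gmax + 1)) := by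
    rw [H.apply_eq ω measurableSet_Ioc (Ioc_subset_Ioc_left hδ0.le)]
    calc ∫⁻ y in Ioc δ 1, ENNReal.ofReal (h ω y)
        ≤ ∫⁻ y in Ioc δ 1, ENNReal.ofReal (h ω 1 / δ ^ (gmax + 1)) := by
          apply setLIntegral_mono' measurableSet_Ioc
          intro y hy
          apply ENNReal.ofReal_le_ofReal
          have my : y ∈ Ioc (0 : ℝ) 1 := ⟨hδ0.trans hy.1, hy.2⟩
          have := hmono my m1 hy.2
          simp only [Real.one_rpow, one_mul] at this
          rw [le_div_iff₀ (by positivity), mul_comm]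
          refine le_trans ?_ this
          apply mul_le_mul_of_nonneg_right _ (hnn y)
          exact Real.rpow_le_rpow hδ0.le hy.1.le (by linarith [H.g0])
      _ = ENNReal.ofReal (h ω 1 / δ ^ (gmax + 1)) * ENNReal.ofReal (1 - δ) := by simp
      _ ≤ ENNReal.ofReal (h ω 1 / δ ^ (gmax + 1)) * 1 := by
        gcongr
        rw [ENNReal.ofReal_le_one]; linarith
      _ = _ := mul_one _
  have b3 : (1 : ℝ≥0∞) ≤ 1 / 2 + ENNReal.ofReal (h ω 1 / δ ^ (gmax + 1)) := by
    calc (1 : ℝ≥0∞) = ν ω (Ioc 0 1) := by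
          rw [prob_compl_eq_zero_iff measurableSet_Ioc |>.1 (H.compl_zero ω)]
      _ = ν ω (Ioc 0 δ ∪ Ioc δ 1) := by rw [Ioc_union_Ioc_eq_Ioc hδ0.le hδ1]
      _ ≤ _ := (measure_union_le _ _).trans (add_le_add b1 b2)
  have hq : 0 ≤ h ω 1 / δ ^ (gmax + 1) := div_nonneg (hnn 1) (by positivity)
  have b4 : (1 : ℝ) ≤ 1 / 2 + h ω 1 / δ ^ (gmax + 1) := by
    have e : (1 / 2 : ℝ≥0∞) = ENNReal.ofReal (1 / 2) := by
      rw [ENNReal.ofReal_div_of_pos (by norm_num)]; simp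
    rw [e, ← ENNReal.ofReal_add (by norm_num) hq, ENNReal.one_le_ofReal] at b3
    exact b3
  have b5 : 1 / 2 ≤ h ω 1 / δ ^ (gmax + 1) := by linarith
  rw [le_div_iff₀ (by positivity)] at b5
  linarith

lemma ge_vol (H : SysHyp γ gmax ν h acone C) {κ : ℝ}
    (hκ : ∀ ω, ∀ x ∈ Ioc (0 : ℝ) 1, κ ≤ h ω x) (ω : Om m) :
    ENNReal.ofReal κ • volume.restrict (Ioc 0 1) ≤ ν ω := by
  refine Measure.le_iff.2 fun S hS => ?_
  calc _ = ∫⁻ x in S ∩ Ioc 0 1, ENNReal.ofReal κ := by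
        simp [Measure.restrict_apply hS]
    _ ≤ ∫⁻ x in S ∩ Ioc 0 1, ENNReal.ofReal (h ω x) :=
        setLIntegral_mono' (hS.inter measurableSet_Ioc)
          (fun x hx => ENNReal.ofReal_le_ofReal (hκ ω x hx.2))
    _ = ν ω (S ∩ Ioc 0 1) := (H.apply_eq ω (hS.inter measurableSet_Ioc) inter_subset_right).symm
    _ ≤ _ := measure_mono inter_subset_left

lemma equicont (H : SysHyp γ gmax ν h acone C) {x0 : ℝ} (hx0 : x0 ∈ Ioo (0 : ℝ) 1)
    {η : ℝ} (hη : 0 < η) : ∃ δ > 0, ∀ ω x, |x - x0| < δ → x ∈ Ioc (0 : ℝ) 1 ∧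
      |h ω x - h ω x0| ≤ η := by
  set K := acone * x0 ^ (-gmax) with hK
  have hK0 : 0 < K := mul_pos H.a0 (Real.rpow_pos_of_pos hx0.1 _)
  have hcont : ContinuousAt (fun x : ℝ => K * |(x0 / x) ^ (gmax + 1) - 1|) x0 := by
    have : x0 ≠ 0 := hx0.1.ne'
    have h1 : ContinuousAt (fun x : ℝ => x0 / x) x0 := continuousAt_const.div continuousAt_id this
    have h2 : ContinuousAt (fun x : ℝ => (x0 / x) ^ (gmax + 1)) x0 :=
      h1.rpow_const (Or.inr (by linarith [H.g0]))
    exact ((h2.sub continuousAt_const).abs).const_mul K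
  have h0 : K * |(x0 / x0) ^ (gmax + 1) - 1| < η := by
    rw [div_self hx0.1.ne']; simpa using hη
  have hev := (hcont.eventually (gt_mem_nhds h0)).and (Ioo_mem_nhds hx0.1 hx0.2)
  obtain ⟨δ, hδ, hball⟩ := Metric.eventually_nhds_iff.1 hev
  refine ⟨δ, hδ, fun ω x hx => ?_⟩
  obtain ⟨hx1, hx2⟩ := hball (by rwa [Real.dist_eq])
  have mx : x ∈ Ioc (0 : ℝ) 1 := ⟨hx2.1, hx2.2.le⟩
  have mx0 : x0 ∈ Ioc (0 : ℝ) 1 := ⟨hx0.1, hx0.2.le⟩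
  refine ⟨mx, le_trans ?_ hx1.le⟩
  obtain ⟨-, hnn, hanti, hmono, hle⟩ := H.cone ω
  have hKx : h ω x0 ≤ K := hle x0 mx0
  have e1 : (x0 / x) ^ (gmax + 1) = x0 ^ (gmax + 1) / x ^ (gmax + 1) :=
    Real.div_rpow hx0.1.le hx2.1.le _
  have px : 0 < x ^ (gmax + 1) := Real.rpow_pos_of_pos hx2.1 _
  have key : |h ω x - h ω x0| ≤ |(x0 / x) ^ (gmax + 1) - 1| * h ω x0 := by
    rcases le_total x x0 with hc | hc
    · have a1 := hanti mx mx0 hc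
      have a2 := hmono mx mx0 hc
      simp only at a2
      have a3 : h ω x ≤ (x0 / x) ^ (gmax + 1) * h ω x0 := by
        rw [e1, div_mul_eq_mul_div, le_div_iff₀ px]; linarith
      rw [abs_of_nonneg (by linarith)]
      have := mul_le_mul_of_nonneg_right (le_abs_self ((x0 / x) ^ (gmax + 1) - 1)) (hnn x0)
      linarith
    · have a1 := hanti mx0 mx hc
      have a2 := hmono mx0 mx hc
      simp only at a2
      have a3 : (x0 / x) ^ (gmax + 1) * h ω x0 ≤ h ω x := by
        rw [e1, div_mul_eq_mul_div, div_le_iff₀ px]; linarith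
      rw [abs_of_nonpos (by linarith)]
      have := mul_le_mul_of_nonneg_right (neg_abs_le ((x0 / x) ^ (gmax + 1) - 1)) (hnn x0)
      linarith
  refine key.trans ?_
  rw [mul_comm]
  exact mul_le_mul_of_nonneg_right hKx (abs_nonneg _)

lemma map_randComp (H : SysHyp γ gmax ν h acone C) (ω : Om m) (N : ℕ) :
    (ν ω).map (randComp (fun i => lsv (γ i)) ω N) = ν (shift^[N] ω) := by
  induction N generalizing ω with
  | zero => exact Measure.map_id
  | succ N ih =>
    have e : randComp (fun i => lsv (γ i)) ω (N + 1)
        = (randComp (fun i => lsv (γ i)) (shift ω) N) ∘ (lsv (γ (ω 0))) := by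
      ext x; exact randComp_succ' _ ω N x
    rw [e, ← Measure.map_map (randComp_measurable _ _ _) (lsv_measurable _), H.equiv, ih]
    rfl

lemma integral_comp (H : SysHyp γ gmax ν h acone C) (ω : Om m) (N : ℕ) {E : Type*}
    [NormedAddCommGroup E] [NormedSpace ℝ E] {F : ℝ → E} (hF : StronglyMeasurable F) :
    ∫ x, F (randComp (fun i => lsv (γ i)) ω N x) ∂(ν ω) = ∫ x, F x ∂(ν (shift^[N] ω)) := by
  rw [← H.map_randComp ω N, integral_map (randComp_measurable _ _ _).aemeasurable
    hF.aestronglyMeasurable]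

end SysHyp

end

section
lemma pair_tv {s : SignedMeasure ℝ} {μ1 μ2 : Measure ℝ} [IsFiniteMeasure μ1] [IsFiniteMeasure μ2]
    (hs : ∀ A, MeasurableSet A → s A = μ1.real A - μ2.real A) {U : ℝ → ℂ} (hU : Measurable U)
    (hU1 : ∀ x, ‖U x‖ ≤ 1) :
    ‖∫ x, U x ∂μ1 - ∫ x, U x ∂μ2‖ ≤ (s.totalVariation univ).toReal := by
  set P := s.toJordanDecomposition.posPart with hP
  set Q := s.toJordanDecomposition.negPart with hQ
  have hsum : μ1 + Q = μ2 + P := by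
    ext A hA
    have h1 := hs A hA
    have h2 : s A = P.real A - Q.real A := by
      conv_lhs => rw [← SignedMeasure.toSignedMeasure_toJordanDecomposition s]
      simp [JordanDecomposition.toSignedMeasure, hP, hQ, Measure.toSignedMeasure_apply, hA]
    rw [Measure.add_apply, Measure.add_apply,
      ← ENNReal.toReal_eq_toReal_iff' (by finiteness) (by finiteness),
      ENNReal.toReal_add (by finiteness) (by finiteness),
      ENNReal.toReal_add (by finiteness) (by finiteness)]
    simp only [Measure.real] at h1 h2
    linarith
  have hint : ∀ (μ : Measure ℝ) [IsFiniteMeasure μ], Integrable U μ := fun μ _ =>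
    Integrable.of_bound hU.aestronglyMeasurable 1 (Eventually.of_forall hU1)
  have e : ∫ x, U x ∂μ1 + ∫ x, U x ∂Q = ∫ x, U x ∂μ2 + ∫ x, U x ∂P := by
    rw [← integral_add_measure (hint _) (hint _), hsum, integral_add_measure (hint _) (hint _)]
  have e2 : ∫ x, U x ∂μ1 - ∫ x, U x ∂μ2 = ∫ x, U x ∂P - ∫ x, U x ∂Q := by
    linear_combination e
  have hb : ∀ (μ : Measure ℝ) [IsFiniteMeasure μ], ‖∫ x, U x ∂μ‖ ≤ μ.real univ := fun μ _ => by
    have := norm_integral_le_of_norm_le_const (μ := μ) (Eventually.of_forall hU1)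
    simpa using this
  rw [e2]
  refine (norm_sub_le _ _).trans ?_
  have : (s.totalVariation univ).toReal = P.real univ + Q.real univ := by
    rw [SignedMeasure.totalVariation, Measure.add_apply, ENNReal.toReal_add (by finiteness)
      (by finiteness)]
    rfl
  rw [this]
  exact add_le_add (hb P) (hb Q)

namespace SysHyp
variable {m : ℕ} {γ : Fin m → ℝ} {gmax : ℝ} {ν : Om m → Measure ℝ} {h : Om m → ℝ → ℝ}
    {acone C : ℝ}

lemma integrable_of_cont (H : SysHyp γ gmax ν h acone C) (ω : Om m) {g : ℝ → ℝ}
    (hg : Continuous g) : Integrable g (ν ω) := by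
  have := H.prob ω
  obtain ⟨K, hK⟩ := isCompact_Icc.exists_bound_of_continuousOn (s := Icc (0 : ℝ) 1) hg.continuousOn
  refine Integrable.of_bound hg.aestronglyMeasurable K ?_
  filter_upwards [H.ae_mem ω] with x hx
  exact hK x ⟨hx.1.le, hx.2⟩

lemma dec_pair (H : SysHyp γ gmax ν h acone C) {g : ℝ → ℝ} (hg : ContDiff ℝ 1 g) (ω : Om m)
    {N : ℕ} (hN : 2 ≤ N) {U : ℝ → ℂ} (hU : Measurable U) (hU1 : ∀ x, ‖U x‖ ≤ 1) :
    ‖∫ x, ((g x - ∫ y, g y ∂(ν ω) : ℝ) : ℂ) * U (randComp (fun i => lsv (γ i)) ω N x) ∂(ν ω)‖ ≤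
      C * C1norm g * rho gmax N := by
  have hprob := H.prob ω
  set f : ℝ → ℝ := fun x => g x - ∫ y, g y ∂(ν ω) with hf
  set R := randComp (fun i => lsv (γ i)) ω N with hR
  have mR : Measurable R := randComp_measurable _ _ _
  have mf : Measurable f := (hg.continuous.sub continuous_const).measurable
  have hfi : Integrable f (ν ω) := H.integrable_of_cont ω (hg.continuous.sub continuous_const)
  have hdec := H.dec g hg ω N hN
  set s : SignedMeasure ℝ := ((ν ω).withDensityᵥ f).map R with hs
  set μ1 : Measure ℝ := ((ν ω).withDensity (fun x => ENNReal.ofReal (f x))).map R with hμ1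
  set μ2 : Measure ℝ := ((ν ω).withDensity (fun x => ENNReal.ofReal (-f x))).map R with hμ2
  have i1 : IsFiniteMeasure ((ν ω).withDensity (fun x => ENNReal.ofReal (f x))) :=
    isFiniteMeasure_withDensity_ofReal hfi.2
  have i2 : IsFiniteMeasure ((ν ω).withDensity (fun x => ENNReal.ofReal (-f x))) :=
    isFiniteMeasure_withDensity_ofReal hfi.neg.2
  have hsA : ∀ A, MeasurableSet A → s A = μ1.real A - μ2.real A := by
    intro A hA
    rw [hs, VectorMeasure.map_apply _ mR hA,
      withDensityᵥ_eq_withDensity_pos_part_sub_withDensity_neg_part hfi,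
      VectorMeasure.sub_apply, Measure.toSignedMeasure_apply_measurable (mR hA),
      Measure.toSignedMeasure_apply_measurable (mR hA), hμ1, hμ2, Measure.real, Measure.real,
      Measure.real, Measure.real, Measure.map_apply mR hA, Measure.map_apply mR hA]
  have key := pair_tv hsA hU hU1
  have c1 : ∀ F : ℝ → ℝ, Measurable F → 
      ∫ x, U x ∂(((ν ω).withDensity (fun x => ENNReal.ofReal (F x))).map R) =
      ∫ x, ((max (F x) 0 : ℝ) : ℂ) * U (R x) ∂(ν ω) := by
    intro F hF
    rw [integral_map mR.aemeasurable hU.aestronglyMeasurable,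
      integral_withDensity_eq_integral_toReal_smul hF.ennreal_ofReal
        (Eventually.of_forall fun x => ENNReal.ofReal_lt_top)]
    apply integral_congr_ae
    filter_upwards with x
    rw [ENNReal.toReal_ofReal']
    simp
  rw [hμ1, hμ2, c1 f mf, c1 (fun x => -f x) mf.neg, ← integral_sub] at key
  · have e : ∀ x, ((max (f x) 0 : ℝ) : ℂ) * U (R x) - ((max (-f x) 0 : ℝ) : ℂ) * U (R x)
        = (f x : ℂ) * U (R x) := by
      intro x
      rw [← sub_mul, ← Complex.ofReal_sub]
      congr 2
      rcases le_total 0 (f x) with h | h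
      · rw [max_eq_left h, max_eq_right (by linarith)]; ring
      · rw [max_eq_right h, max_eq_left (by linarith)]; ring
    simp_rw [e] at key
    refine key.trans (hdec.trans (le_of_eq ?_))
    rw [rho]; ring
  · have : Integrable (fun x => ((max (f x) 0 : ℝ) : ℂ)) (ν ω) := hfi.pos_part.ofReal
    exact this.mul_bdd (c := 1) (hU.comp mR).aestronglyMeasurable
      (Eventually.of_forall fun x => hU1 _)
  · have : Integrable (fun x => ((max (-f x) 0 : ℝ) : ℂ)) (ν ω) := hfi.neg.pos_part.ofReal
    exact this.mul_bdd (c := 1) (hU.comp mR).aestronglyMeasurable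
      (Eventually.of_forall fun x => hU1 _)

end SysHyp

lemma C1norm_le {g : ℝ → ℝ} {A B : ℝ} (hA : ∀ x, |g x| ≤ A) (hB : ∀ x, |deriv g x| ≤ B) :
    C1norm g ≤ A + B := by
  have : Nonempty (Icc (0 : ℝ) 1) := ⟨⟨0, by simp⟩⟩
  exact add_le_add (ciSup_le fun x => hA x) (ciSup_le fun x => hB x)

lemma rho_nonneg (gmax : ℝ) (n : ℕ) : 0 ≤ rho gmax n :=
  mul_nonneg (Real.rpow_nonneg (by positivity) _)
    (Real.rpow_nonneg (Real.log_natCast_nonneg n) _)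

/-- a fixed bump -/
lemma exists_bump : ∃ (f : ℝ → ℝ) (B : ℝ), ContDiff ℝ 1 f ∧ (∀ x, 0 ≤ f x ∧ f x ≤ 1) ∧
    (∀ x, |deriv f x| ≤ B) ∧ 0 < B ∧ (∀ x, x ∉ Icc (-1 : ℝ) 1 → f x = 0) ∧
    (∀ x, x ∈ Icc (-(1 / 2) : ℝ) (1 / 2) → f x = 1) := by
  let b : ContDiffBump (0 : ℝ) := ⟨1 / 2, 1, by norm_num, by norm_num⟩
  have hcd : ContDiff ℝ 1 (b : ℝ → ℝ) := b.contDiff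
  have hcs : HasCompactSupport (deriv (b : ℝ → ℝ)) := b.hasCompactSupport.deriv
  obtain ⟨B, hB⟩ := hcs.exists_bound_of_continuous (hcd.continuous_deriv le_rfl)
  refine ⟨b, max B 1, hcd, fun x => ⟨b.nonneg, b.le_one⟩, fun x => (hB x).trans (le_max_left _ _),
    by positivity, ?_, ?_⟩
  · intro x hx
    apply b.zero_of_le_dist
    rw [Real.dist_eq, sub_zero]
    by_contra hcon
    push Not at hcon
    exact hx (abs_le.1 (le_of_lt hcon))
  · intro x hx
    apply b.one_of_mem_closedBall
    rw [Metric.mem_closedBall, Real.dist_eq, sub_zero]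
    exact abs_le.2 hx

namespace SysHyp
variable {m : ℕ} {γ : Fin m → ℝ} {gmax : ℝ} {ν : Om m → Measure ℝ} {h : Om m → ℝ → ℝ}
    {acone C : ℝ}

/-- cylinders are short -/
lemma cyl_len (H : SysHyp γ gmax ν h acone C) : ∃ K : ℝ, 0 < K ∧ ∀ (ω : Om m) (j : ℕ), 2 ≤ j →
    ∀ w : Fin j → Bool, (brI γ j ω w 1 - brI γ j ω w 0) ^ 2 ≤ K * rho gmax j := by
  obtain ⟨κ, hκ0, hκ⟩ := H.exists_min
  obtain ⟨f, B, hfc, hf01, hfB, hB0, hf0, hf1⟩ := exists_bump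
  refine ⟨C * (1 + 4 * B) * (8 / (κ * κ)), by have := H.C0; positivity, ?_⟩
  intro ω j hj w
  have hprob := H.prob ω
  set s := brI γ j ω w with hs
  have m0 : (0 : ℝ) ∈ Icc (0 : ℝ) 1 := by simp
  have m1 : (1 : ℝ) ∈ Icc (0 : ℝ) 1 := by simp
  have mh : (1 / 2 : ℝ) ∈ Ioc (0 : ℝ) 1 := by norm_num
  have ms0 : s 0 ∈ Icc (0 : ℝ) 1 := brI_mem H.hγ j ω w m0
  have ms1 : s 1 ∈ Icc (0 : ℝ) 1 := brI_mem H.hγ j ω w m1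
  set l := s 1 - s 0 with hl
  have hl0 : 0 < l := by
    have := (brI_contract H.hγ j ω w m0 m1 zero_lt_one).1; rw [hl]; linarith
  have hl1 : l ≤ 1 := by linarith [ms0.1, ms1.2]
  set g : ℝ → ℝ := fun x => f ((x - (s 0 + l / 4)) / (l / 4)) with hg
  have hgc : ContDiff ℝ 1 g := hfc.comp (by fun_prop)
  have hgd : ∀ x, |deriv g x| ≤ B * (4 / l) := by
    intro x
    have hd : HasDerivAt g (deriv f ((x - (s 0 + l / 4)) / (l / 4)) * (1 / (l / 4))) x := by
      have h1 : HasDerivAt (fun x : ℝ => (x - (s 0 + l / 4)) / (l / 4)) (1 / (l / 4)) x :=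
        ((hasDerivAt_id x).sub_const _).div_const _
      exact ((hfc.differentiable (by norm_num)) _).hasDerivAt.comp x h1
    rw [hd.deriv, abs_mul]
    have : |1 / (l / 4)| = 4 / l := by
      rw [abs_of_pos (by positivity)]; field_simp
    rw [this]
    exact mul_le_mul_of_nonneg_right (hfB _) (by positivity)
  have hg01 : ∀ x, 0 ≤ g x ∧ g x ≤ 1 := fun x => hf01 _
  have hC1 : C1norm g ≤ 1 + B * (4 / l) :=
    C1norm_le (fun x => by rw [abs_of_nonneg (hg01 x).1]; exact (hg01 x).2) hgd
  -- U is the indicator of Ioi (1/2)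
  set U : ℝ → ℂ := (Ioi (1 / 2 : ℝ)).indicator (fun _ => (1 : ℂ)) with hU
  have mU : Measurable U := measurable_const.indicator measurableSet_Ioi
  have hU1 : ∀ x, ‖U x‖ ≤ 1 := fun x => by
    rw [hU]; exact (norm_indicator_le_norm_self _ _).trans (by simp)
  have hp := H.dec_pair hgc ω hj mU hU1
  set R := randComp (fun i => lsv (γ i)) ω j with hR
  have mR : Measurable R := randComp_measurable _ _ _
  -- g vanishes where U ∘ R ≠ 0
  have hsupp : ∀ x ∈ Ioc (0 : ℝ) 1, g x ≠ 0 → R x ≤ 1 / 2 := by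
    intro x hx hgx
    have hx2 : (x - (s 0 + l / 4)) / (l / 4) ∈ Icc (-1 : ℝ) 1 := by
      by_contra hcon
      exact hgx (hf0 _ hcon)
    have hx3 : s 0 ≤ x ∧ x ≤ s 0 + l / 2 := by
      obtain ⟨h1, h2⟩ := hx2
      rw [le_div_iff₀ (by positivity)] at h1
      rw [div_le_iff₀ (by positivity)] at h2
      constructor <;> linarith
    have hmid : s 0 + l / 2 ≤ s (1 / 2) := by
      have := (brI_concave H.hγ j ω w).2 m0 m1 (by norm_num : (0 : ℝ) ≤ 1 / 2)
        (by norm_num : (0 : ℝ) ≤ 1 / 2) (by norm_num)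
      simp only [smul_eq_mul, mul_zero, mul_one, zero_add] at this
      rw [← hs] at this
      linarith
    rcases hx3.1.eq_or_lt with he | hlt
    · exfalso
      have h1 : g x = 0 := by
        have hcont : Continuous f := hfc.continuous
        have e : (x - (s 0 + l / 4)) / (l / 4) = -1 := by
          rw [← he]; field_simp; ring
        have : f (-1) = 0 := by
          have hcl : IsClosed {y : ℝ | f y = 0} := isClosed_eq hcont continuous_const
          have hmem : (-1 : ℝ) ∈ closure (Iio (-1 : ℝ)) := by
            rw [closure_Iio]; simp
          refine hcl.closure_subset_iff.2 ?_ hmem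
          intro y hy
          exact hf0 y (fun h => by linarith [h.1, mem_Iio.1 hy])
        simp only [hg, e, this]
      exact hgx h1
    · obtain ⟨y, hy, hyx⟩ := brI_image H.hγ j ω w (x := x) ⟨hlt, by linarith⟩
      have hRy : R x = y := by
        rw [← hyx]; exact randComp_brI H.hγ j ω w hy
      rw [hRy]
      by_contra hcon
      push Not at hcon
      have := (brI_contract H.hγ j ω w ⟨mh.1.le, mh.2⟩ ⟨hy.1.le, hy.2⟩ hcon).1
      rw [hyx] at this
      linarith
  have hgi : Integrable g (ν ω) := H.integrable_of_cont ω hgc.continuous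
  set Eg := ∫ y, g y ∂(ν ω) with hEg
  have e1 : ∫ x, ((g x - Eg : ℝ) : ℂ) * U (R x) ∂(ν ω) =
      ((-(Eg * (ν (shift^[j] ω)).real (Ioi (1 / 2))) : ℝ) : ℂ) := by
    have : ∀ᵐ x ∂(ν ω), ((g x - Eg : ℝ) : ℂ) * U (R x) = (-(Eg : ℂ)) * U (R x) := by
      filter_upwards [H.ae_mem ω] with x hx
      by_cases hRx : R x ∈ Ioi (1 / 2 : ℝ)
      · have : g x = 0 := by
          by_contra hcon
          exact absurd (hsupp x hx hcon) (not_le.2 hRx)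
        simp [this]
      · have h0 : U (R x) = 0 := indicator_of_notMem hRx _
        rw [h0]; simp
    rw [integral_congr_ae this, integral_const_mul, H.integral_comp ω j mU.stronglyMeasurable,
      hU, integral_indicator measurableSet_Ioi]
    simp
  have hEg0 : κ * (l / 4) ≤ Eg := by
    have hset : Icc (s 0 + l / 8) (s 0 + 3 * l / 8) ⊆ Ioc 0 1 := by
      intro x hx
      exact ⟨by linarith [hx.1, ms0.1], by linarith [hx.2, ms1.2]⟩
    have h1 : (ν ω).real (Icc (s 0 + l / 8) (s 0 + 3 * l / 8)) ≤ Eg := by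
      rw [← integral_indicator_one measurableSet_Icc]
      apply integral_mono ((integrable_const 1).indicator measurableSet_Icc) hgi
      intro x
      by_cases hx : x ∈ Icc (s 0 + l / 8) (s 0 + 3 * l / 8)
      · have : g x = 1 := by
          apply hf1
          constructor
          · rw [le_div_iff₀ (by positivity)]; linarith [hx.1]
          · rw [div_le_iff₀ (by positivity)]; linarith [hx.2]
        simp [hx, this]
      · simp [hx, (hg01 x).1]
    refine le_trans ?_ h1
    have h2 := (Measure.le_iff.1 (H.ge_vol hκ ω)) _
      (measurableSet_Icc : MeasurableSet (Icc (s 0 + l / 8) (s 0 + 3 * l / 8)))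
    rw [Measure.smul_apply, Measure.restrict_apply measurableSet_Icc, inter_eq_left.2 hset,
      Real.volume_Icc, smul_eq_mul, ← ENNReal.ofReal_mul hκ0.le] at h2
    rw [Measure.real]
    rw [← ENNReal.ofReal_le_iff_le_toReal (measure_ne_top _ _)]
    refine le_trans (le_of_eq ?_) h2
    congr 1; ring
  have hhalf : κ / 2 ≤ (ν (shift^[j] ω)).real (Ioi (1 / 2)) := by
    have := H.prob (shift^[j] ω)
    have h2 := (Measure.le_iff.1 (H.ge_vol hκ (shift^[j] ω))) _
      (measurableSet_Ioi : MeasurableSet (Ioi (1 / 2 : ℝ)))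
    have e : Ioi (1 / 2 : ℝ) ∩ Ioc 0 1 = Ioc (1 / 2) 1 := by
      ext x; simp only [mem_inter_iff, mem_Ioi, mem_Ioc]
      constructor
      · rintro ⟨a, b, c⟩; exact ⟨a, c⟩
      · rintro ⟨a, c⟩; exact ⟨a, by linarith, c⟩
    rw [Measure.smul_apply, Measure.restrict_apply measurableSet_Ioi, e,
      Real.volume_Ioc, smul_eq_mul, ← ENNReal.ofReal_mul hκ0.le] at h2
    rw [Measure.real, ← ENNReal.ofReal_le_iff_le_toReal (measure_ne_top _ _)]
    refine le_trans (le_of_eq ?_) h2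
    congr 1; ring
  rw [e1, Complex.norm_real, Real.norm_eq_abs, abs_neg] at hp
  have hp2 : Eg * (ν (shift^[j] ω)).real (Ioi (1 / 2)) ≤ C * C1norm g * rho gmax j :=
    (le_abs_self _).trans hp
  have hp3 : κ * (l / 4) * (κ / 2) ≤ C * (1 + B * (4 / l)) * rho gmax j := by
    calc κ * (l / 4) * (κ / 2) ≤ Eg * (ν (shift^[j] ω)).real (Ioi (1 / 2)) :=
          mul_le_mul hEg0 hhalf (by positivity) (le_trans (by positivity) hEg0)
      _ ≤ C * C1norm g * rho gmax j := hp2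
      _ ≤ _ := by
        apply mul_le_mul_of_nonneg_right _ (rho_nonneg _ _)
        exact mul_le_mul_of_nonneg_left hC1 H.C0.le
  have hp4 : C * (1 + B * (4 / l)) ≤ C * (1 + 4 * B) / l := by
    rw [le_div_iff₀ hl0, mul_assoc]
    apply mul_le_mul_of_nonneg_left _ H.C0.le
    have : B * (4 / l) * l = 4 * B := by field_simp
    nlinarith
  have hp5 : κ * (l / 4) * (κ / 2) ≤ C * (1 + 4 * B) / l * rho gmax j :=
    hp3.trans (mul_le_mul_of_nonneg_right hp4 (rho_nonneg _ _))
  rw [div_mul_eq_mul_div, le_div_iff₀ hl0] at hp5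
  have e3 : κ * (l / 4) * (κ / 2) * l = l ^ 2 * (κ * κ / 8) := by ring
  rw [e3, ← le_div_iff₀ (by positivity)] at hp5
  refine hp5.trans (le_of_eq ?_)
  field_simp

end SysHyp

end

section
lemma prod_sub_norm_le {ι : Type*} [DecidableEq ι] (s t : Finset ι) (hts : t ⊆ s) (F : ι → ℂ)
    (hF : ∀ i, ‖F i‖ ≤ 1) :
    ‖∏ i ∈ s, F i - ∏ i ∈ t, F i‖ ≤ ∑ i ∈ s \ t, ‖F i - 1‖ := by
  have h1 : ∀ u : Finset ι, ‖∏ i ∈ u, F i‖ ≤ 1 := fun u => by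
    rw [norm_prod]; exact Finset.prod_le_one (fun _ _ => norm_nonneg _) (fun i _ => hF i)
  have h2 : ∀ u : Finset ι, ‖∏ i ∈ u, F i - 1‖ ≤ ∑ i ∈ u, ‖F i - 1‖ := fun u => by
    induction u using Finset.induction_on with
    | empty => simp
    | insert a u ha ih =>
      rw [Finset.prod_insert ha, Finset.sum_insert ha]
      have : F a * ∏ i ∈ u, F i - 1 = (F a - 1) * ∏ i ∈ u, F i + (∏ i ∈ u, F i - 1) := by ring
      rw [this]
      refine (norm_add_le _ _).trans (add_le_add ?_ ih)
      rw [norm_mul]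
      exact mul_le_of_le_one_right (norm_nonneg _) (h1 u)
  rw [← Finset.prod_sdiff hts]
  have : (∏ i ∈ s \ t, F i) * ∏ i ∈ t, F i - ∏ i ∈ t, F i =
    (∏ i ∈ s \ t, F i - 1) * ∏ i ∈ t, F i := by ring
  rw [this, norm_mul]
  exact (mul_le_of_le_one_right (norm_nonneg _) (h1 t)).trans (h2 _)

lemma randComp_add {m : ℕ} (T : Fin m → ℝ → ℝ) (ω : Om m) (M j : ℕ) (x : ℝ) :
    randComp T ω (M + j) x = randComp T (shift^[M] ω) j (randComp T ω M x) := by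
  induction M generalizing ω x with
  | zero => simp [randComp]
  | succ M ih =>
    rw [show M + 1 + j = (M + j) + 1 by ring, randComp_succ', ih, Function.iterate_succ_apply,
      ← randComp_succ']

namespace SysHyp
variable {m : ℕ} {γ : Fin m → ℝ} {gmax : ℝ} {ν : Om m → Measure ℝ} {h : Om m → ℝ → ℝ}
    {acone C : ℝ}

lemma dec_pair_complex (H : SysHyp γ gmax ν h acone C) {g : ℝ → ℂ}
    (hre : ContDiff ℝ 1 (fun x => (g x).re)) (him : ContDiff ℝ 1 (fun x => (g x).im))
    {D : ℝ} (hDr : C1norm (fun x => (g x).re) ≤ D) (hDi : C1norm (fun x => (g x).im) ≤ D)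
    (hgi : ∀ ω, Integrable g (ν ω)) (ω : Om m)
    {N : ℕ} (hN : 2 ≤ N) {U : ℝ → ℂ} (hU : Measurable U) (hU1 : ∀ x, ‖U x‖ ≤ 1) :
    ‖∫ x, (g x - ∫ y, g y ∂(ν ω)) * U (randComp (fun i => lsv (γ i)) ω N x) ∂(ν ω)‖ ≤
      2 * C * D * rho gmax N := by
  have hprob := H.prob ω
  have h1 := H.dec_pair hre ω hN hU hU1
  have h2 := H.dec_pair him ω hN hU hU1
  set R := randComp (fun i => lsv (γ i)) ω N with hR
  have mR : Measurable R := randComp_measurable _ _ _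
  have hUR : AEStronglyMeasurable (fun x => U (R x)) (ν ω) := (hU.comp mR).aestronglyMeasurable
  have ei : (∫ y, g y ∂(ν ω)) = ((∫ y, (g y).re ∂(ν ω) : ℝ) : ℂ) +
      ((∫ y, (g y).im ∂(ν ω) : ℝ) : ℂ) * Complex.I := by
    have := integral_re_add_im (𝕜 := ℂ) (hgi ω)
    simp only [RCLike.re_to_complex, RCLike.im_to_complex, RCLike.I_to_complex] at this
    exact this.symm
  have e : ∀ x, (g x - ∫ y, g y ∂(ν ω)) * U (R x) =
      (((g x).re - ∫ y, (g y).re ∂(ν ω) : ℝ) : ℂ) * U (R x) +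
      Complex.I * ((((g x).im - ∫ y, (g y).im ∂(ν ω) : ℝ) : ℂ) * U (R x)) := by
    intro x
    rw [ei]
    conv_lhs => rw [← Complex.re_add_im (g x)]
    push_cast
    ring
  have ir : Integrable (fun x => (g x).re) (ν ω) := H.integrable_of_cont ω hre.continuous
  have ii : Integrable (fun x => (g x).im) (ν ω) := H.integrable_of_cont ω him.continuous
  have I1 : Integrable (fun x => (((g x).re - ∫ y, (g y).re ∂(ν ω) : ℝ) : ℂ) * U (R x)) (ν ω) :=
    ((ir.sub (integrable_const _)).ofReal).mul_bdd (c := 1) hUR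
      (Eventually.of_forall fun x => hU1 _)
  have I2 : Integrable (fun x => (((g x).im - ∫ y, (g y).im ∂(ν ω) : ℝ) : ℂ) * U (R x)) (ν ω) :=
    ((ii.sub (integrable_const _)).ofReal).mul_bdd (c := 1) hUR
      (Eventually.of_forall fun x => hU1 _)
  simp_rw [e]
  rw [integral_add I1 (I2.const_mul _), integral_const_mul]
  refine (norm_add_le _ _).trans ?_
  rw [norm_mul, Complex.norm_I, one_mul]
  have h0 : 0 ≤ C * rho gmax N := mul_nonneg H.C0.le (rho_nonneg _ _)
  have h3 := mul_le_mul_of_nonneg_right hDr h0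
  have h4 := mul_le_mul_of_nonneg_right hDi h0
  linarith

lemma decouple (H : SysHyp γ gmax ν h acone C) {g : ℝ → ℂ}
    (hre : ContDiff ℝ 1 (fun x => (g x).re)) (him : ContDiff ℝ 1 (fun x => (g x).im))
    {D : ℝ} (hDr : C1norm (fun x => (g x).re) ≤ D) (hDi : C1norm (fun x => (g x).im) ≤ D)
    (hgc : Continuous g) (hb : ∀ x, ‖1 + g x‖ ≤ 1) {κ S : ℝ} {M : ℕ} (hM : 2 ≤ M)
    (hκ : ∀ ω, ∫ x, ‖g x‖ ∂(ν ω) ≤ κ)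
    (hS : ∀ ω, ∑ j ∈ Finset.Ico 1 M,
      ∫ x, ‖g x‖ * ‖g (randComp (fun i => lsv (γ i)) ω j x)‖ ∂(ν ω) ≤ S) (n : ℕ) (ω : Om m) :
    ‖∫ x, ∏ j ∈ Finset.range n, (1 + g (randComp (fun i => lsv (γ i)) ω j x)) ∂(ν ω) -
      ∏ k ∈ Finset.range n, (1 + ∫ x, g x ∂(ν (shift^[k] ω)))‖ ≤
      n * (S + 2 * C * D * rho gmax M + κ ^ 2 * M) := by
  set T : Fin m → ℝ → ℝ := fun i => lsv (γ i) with hT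
  have mg : Measurable g := hgc.measurable
  have mR : ∀ ω j, Measurable (randComp T ω j) := fun ω j => randComp_measurable _ _ _
  have hg2 : ∀ x, ‖g x‖ ≤ 2 := fun x => by
    have : g x = (1 + g x) - 1 := by ring
    rw [this]; refine (norm_sub_le _ _).trans ?_
    have := hb x
    simp only [norm_one]; linarith
  have hgi : ∀ ω, Integrable g (ν ω) := fun ω => by
    have := H.prob ω
    exact Integrable.of_bound mg.aestronglyMeasurable 2 (Eventually.of_forall hg2)
  have hκ0 : 0 ≤ κ := (integral_nonneg fun x => norm_nonneg _).trans (hκ ω)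
  induction n generalizing ω with
  | zero => have := H.prob ω; simp
  | succ N ih =>
    have hprob := H.prob ω
    set F : ℕ → ℝ → ℂ := fun j x => 1 + g (randComp T ω j x) with hF
    have mF : ∀ j, Measurable (F j) := fun j => measurable_const.add (mg.comp (mR ω j))
    have hF1 : ∀ j x, ‖F j x‖ ≤ 1 := fun j x => hb _
    have hprod1 : ∀ (s : Finset ℕ) x, ‖∏ i ∈ s, F i x‖ ≤ 1 := fun s x => by
      rw [norm_prod]; exact Finset.prod_le_one (fun _ _ => norm_nonneg _) (fun i _ => hF1 i x)
    have mprod : ∀ (s : Finset ℕ), Measurable (fun x => ∏ i ∈ s, F i x) := fun s =>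
      Finset.measurable_prod s fun i _ => mF i
    have iprod : ∀ (s : Finset ℕ), Integrable (fun x => ∏ i ∈ s, F i x) (ν ω) := fun s =>
      Integrable.of_bound (mprod s).aestronglyMeasurable 1 (Eventually.of_forall (hprod1 s))
    set Q : ℝ → ℂ := fun x => ∏ i ∈ Finset.Ico 1 (N + 1), F i x with hQ
    set V : ℝ → ℂ := fun x => ∏ i ∈ Finset.Ico M (N + 1), F i x with hV
    have iQ : Integrable Q (ν ω) := iprod _
    have iV : Integrable V (ν ω) := iprod _
    set Eg := ∫ x, g x ∂(ν ω) with hEg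
    have igQ : Integrable (fun x => g x * Q x) (ν ω) :=
      (hgi ω).mul_bdd (c := 1) (mprod _).aestronglyMeasurable (Eventually.of_forall (hprod1 _))
    have igV : Integrable (fun x => g x * V x) (ν ω) :=
      (hgi ω).mul_bdd (c := 1) (mprod _).aestronglyMeasurable (Eventually.of_forall (hprod1 _))
    -- the integral of Q
    have eQ : ∫ x, Q x ∂(ν ω) =
        ∫ x, ∏ j ∈ Finset.range N, (1 + g (randComp T (shift ω) j x)) ∂(ν (shift ω)) := by
      have := H.integral_comp ω 1 (F := fun x => ∏ j ∈ Finset.range N,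
        (1 + g (randComp T (shift ω) j x)))
        (Finset.measurable_prod _ fun i _ =>
          measurable_const.add (mg.comp (mR _ i))).stronglyMeasurable
      rw [Function.iterate_one] at this
      rw [← this]
      congr 1
      ext x
      simp only [hQ, hF]
      rw [Finset.prod_Ico_eq_prod_range]
      simp only [Nat.add_sub_cancel]
      refine Finset.prod_congr rfl fun j _ => ?_
      rw [randComp_add]
      rfl
    have eP : ∀ x, ∏ j ∈ Finset.range (N + 1), F j x = Q x + g x * Q x := by
      intro x
      rw [Finset.range_eq_Ico, Finset.prod_eq_prod_Ico_succ_bot (by omega)]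
      simp only [hQ, zero_add, hF, randComp]
      ring
    -- difference between Q and V
    have hQV : ∀ x, ‖Q x - V x‖ ≤ ∑ j ∈ Finset.Ico 1 M, ‖g (randComp T ω j x)‖ := by
      intro x
      have := prod_sub_norm_le (Finset.Ico 1 (N + 1)) (Finset.Ico M (N + 1))
        (Finset.Ico_subset_Ico (by omega) le_rfl) (fun i => F i x) (fun i => hF1 i x)
      refine this.trans ?_
      simp only [hF, add_sub_cancel_left]
      refine Finset.sum_le_sum_of_subset_of_nonneg ?_ (fun _ _ _ => norm_nonneg _)
      intro j hj
      simp only [Finset.mem_sdiff, Finset.mem_Ico] at hj ⊢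
      omega
    have ign : ∀ j, Integrable (fun x => ‖g (randComp T ω j x)‖) (ν ω) := fun j =>
      Integrable.of_bound (mg.comp (mR ω j)).norm.aestronglyMeasurable 2
        (Eventually.of_forall fun x => by rw [norm_norm]; exact hg2 _)
    have ignn : ∀ j, Integrable (fun x => ‖g x‖ * ‖g (randComp T ω j x)‖) (ν ω) := fun j =>
      (hgi ω).norm.mul_bdd (c := 2) (ign j).1
        (Eventually.of_forall fun x => by rw [norm_norm]; exact hg2 _)
    have b1 : ‖∫ x, g x * Q x - g x * V x ∂(ν ω)‖ ≤ S := by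
      refine le_trans ?_ (hS ω)
      rw [← integral_finsetSum _ (fun j _ => ignn j)]
      refine norm_integral_le_of_norm_le (integrable_finsetSum _ fun j _ => ignn j)
        (Eventually.of_forall fun x => ?_)
      rw [← mul_sub, norm_mul, ← Finset.mul_sum]
      exact mul_le_mul_of_nonneg_left (hQV x) (norm_nonneg _)
    have b2 : ‖∫ x, Q x - V x ∂(ν ω)‖ ≤ κ * M := by
      have : ∑ j ∈ Finset.Ico 1 M, ∫ x, ‖g (randComp T ω j x)‖ ∂(ν ω) ≤ κ * M := by
        calc _ ≤ ∑ j ∈ Finset.Ico 1 M, κ := by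
              refine Finset.sum_le_sum fun j _ => ?_
              rw [H.integral_comp ω j (F := fun x => ‖g x‖) mg.norm.stronglyMeasurable]
              exact hκ _
          _ ≤ κ * M := by
              rw [Finset.sum_const, Nat.card_Ico, nsmul_eq_mul, mul_comm]
              refine mul_le_mul_of_nonneg_left ?_ hκ0
              exact_mod_cast Nat.sub_le _ _
      refine le_trans ?_ this
      rw [← integral_finsetSum _ (fun j _ => ign j)]
      exact norm_integral_le_of_norm_le (integrable_finsetSum _ fun j _ => ign j)
        (Eventually.of_forall hQV)
    have b3 : ‖Eg‖ ≤ κ := (norm_integral_le_integral_norm _).trans (hκ ω)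
    -- the decorrelation
    have b4 : ‖∫ x, (g x - Eg) * V x ∂(ν ω)‖ ≤ 2 * C * D * rho gmax M := by
      have := H.dec_pair_complex hre him hDr hDi hgi ω hM
        (U := fun y => ∏ j ∈ Finset.range (N + 1 - M), (1 + g (randComp T (shift^[M] ω) j y)))
        (Finset.measurable_prod _ fun i _ => measurable_const.add (mg.comp (mR _ i)))
        (fun y => by
          rw [norm_prod]; exact Finset.prod_le_one (fun _ _ => norm_nonneg _) (fun i _ => hb _))
      convert this using 5 with x
      simp only [hV, hF]
      rw [Finset.prod_Ico_eq_prod_range]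
      refine Finset.prod_congr rfl fun j _ => ?_
      rw [randComp_add]
    have key : ∫ x, ∏ j ∈ Finset.range (N + 1), F j x ∂(ν ω) - (1 + Eg) * ∫ x, Q x ∂(ν ω) =
        (∫ x, g x * Q x - g x * V x ∂(ν ω)) + (∫ x, (g x - Eg) * V x ∂(ν ω)) -
          Eg * ∫ x, Q x - V x ∂(ν ω) := by
      simp_rw [eP, sub_mul]
      rw [integral_add iQ igQ, integral_sub igQ igV, integral_sub igV (iV.const_mul _),
        integral_sub iQ iV, integral_const_mul]
      ring
    have b5 : ‖∫ x, ∏ j ∈ Finset.range (N + 1), F j x ∂(ν ω) - (1 + Eg) * ∫ x, Q x ∂(ν ω)‖ ≤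
        S + 2 * C * D * rho gmax M + κ ^ 2 * M := by
      rw [key]
      refine (norm_sub_le _ _).trans ?_
      have : ‖Eg * ∫ x, Q x - V x ∂(ν ω)‖ ≤ κ ^ 2 * M := by
        rw [norm_mul]
        calc _ ≤ κ * (κ * M) := mul_le_mul b3 b2 (norm_nonneg _) hκ0
          _ = _ := by ring
      exact add_le_add ((norm_add_le _ _).trans (add_le_add b1 b4)) this
    have b6 : ‖1 + Eg‖ ≤ 1 := by
      have : 1 + Eg = ∫ x, (1 + g x) ∂(ν ω) := by
        rw [integral_add (integrable_const _) (hgi ω)]; simp [hEg]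
      rw [this]
      have := norm_integral_le_of_norm_le_const (μ := ν ω) (Eventually.of_forall hb)
      simpa using this
    have ih' := ih (shift ω)
    rw [← eQ] at ih'
    rw [Finset.prod_range_succ']
    simp only [Function.iterate_succ_apply, Function.iterate_zero, id_eq]
    rw [← hEg]
    set PP := ∏ k ∈ Finset.range N, (1 + ∫ x, g x ∂(ν (shift^[k] (shift ω)))) with hPP
    have e7 : ∫ x, ∏ j ∈ Finset.range (N + 1), F j x ∂(ν ω) - PP * (1 + Eg) =
      (∫ x, ∏ j ∈ Finset.range (N + 1), F j x ∂(ν ω) - (1 + Eg) * ∫ x, Q x ∂(ν ω)) +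
        (1 + Eg) * (∫ x, Q x ∂(ν ω) - PP) := by ring
    change ‖∫ x, ∏ j ∈ Finset.range (N + 1), F j x ∂(ν ω) - PP * (1 + Eg)‖ ≤ _
    rw [e7]
    have : ‖(1 + Eg) * (∫ x, Q x ∂(ν ω) - PP)‖ ≤
        N * (S + 2 * C * D * rho gmax M + κ ^ 2 * M) := by
      rw [norm_mul]
      exact (mul_le_of_le_one_left (norm_nonneg _) b6).trans ih'
    refine (norm_add_le _ _).trans ((add_le_add b5 this).trans (le_of_eq ?_))
    push_cast
    ring

end SysHyp

/-- products of `1 + z_k` -/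
lemma prod_tendsto_exp (z : ℕ → ℕ → ℂ) (K : ℝ) (hz : ∀ n k, ‖z n k‖ * n ≤ K)
    (hz1 : ∀ n k, ‖1 + z n k‖ ≤ 1) {L : ℂ}
    (hL : Tendsto (fun n => ∑ k ∈ Finset.range n, z n k) atTop (𝓝 L)) :
    Tendsto (fun n => ∏ k ∈ Finset.range n, (1 + z n k)) atTop (𝓝 (Complex.exp L)) := by
  have hre : ∀ n k, (z n k).re ≤ 0 := fun n k => by
    have := (Complex.re_le_norm (1 + z n k)).trans (hz1 n k)
    simp at this; linarith
  have hexp1 : ∀ n k, ‖Complex.exp (z n k)‖ ≤ 1 := fun n k => by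
    rw [Complex.norm_exp]; exact Real.exp_le_one_iff.2 (hre n k)
  have hK : 0 ≤ K := by have := hz 0 0; simpa using this
  have hprod : ∀ (F G : ℕ → ℂ) (_ : ∀ k, ‖F k‖ ≤ 1) (_ : ∀ k, ‖G k‖ ≤ 1) (n : ℕ),
      ‖∏ k ∈ Finset.range n, F k - ∏ k ∈ Finset.range n, G k‖ ≤
      ∑ k ∈ Finset.range n, ‖F k - G k‖ := by
    intro F G hF hG n
    induction n with
    | zero => simp
    | succ n ih =>
      rw [Finset.prod_range_succ, Finset.prod_range_succ, Finset.sum_range_succ]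
      have : (∏ k ∈ Finset.range n, F k) * F n - (∏ k ∈ Finset.range n, G k) * G n =
        (∏ k ∈ Finset.range n, F k - ∏ k ∈ Finset.range n, G k) * F n +
          (∏ k ∈ Finset.range n, G k) * (F n - G n) := by ring
      rw [this]
      refine (norm_add_le _ _).trans (add_le_add ?_ ?_)
      · rw [norm_mul]; exact (mul_le_of_le_one_right (norm_nonneg _) (hF n)).trans ih
      · rw [norm_mul]; refine mul_le_of_le_one_left (norm_nonneg _) ?_
        rw [norm_prod]; exact Finset.prod_le_one (fun _ _ => norm_nonneg _) (fun i _ => hG i)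
  have hlim : Tendsto (fun n : ℕ => Complex.exp (∑ k ∈ Finset.range n, z n k)) atTop
      (𝓝 (Complex.exp L)) := (Complex.continuous_exp.tendsto _).comp hL
  refine hlim.congr_dist ?_
  refine squeeze_zero' (Eventually.of_forall fun n => dist_nonneg) ?_
    (tendsto_const_div_atTop_nhds_zero_nat (K ^ 2))
  filter_upwards [eventually_ge_atTop (Nat.ceil K + 1)] with n hn
  have hn0 : (0 : ℝ) < n := by
    have : 0 < n := by omega
    exact_mod_cast this
  have hKn : K ≤ n := (Nat.le_ceil K).trans (by exact_mod_cast (by omega))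
  have hzn : ∀ k, ‖z n k‖ ≤ K / n := fun k => by
    rw [le_div_iff₀ hn0]; exact hz n k
  have hzn1 : ∀ k, ‖z n k‖ ≤ 1 := fun k => (hzn k).trans ((div_le_one hn0).2 hKn)
  rw [dist_eq_norm, Complex.exp_sum]
  refine (hprod _ _ (hexp1 n) (hz1 n) n).trans ?_
  calc _ ≤ ∑ k ∈ Finset.range n, (K / n) ^ 2 := by
        refine Finset.sum_le_sum fun k _ => ?_
        have := Complex.norm_exp_sub_one_sub_id_le (hzn1 k)
        rw [← sub_sub]
        refine this.trans ?_
        exact pow_le_pow_left₀ (norm_nonneg _) (hzn k) 2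
    _ = K ^ 2 / n := by
        rw [Finset.sum_const, Finset.card_range, nsmul_eq_mul]
        field_simp

end

section
section slln
open ProbabilityTheory

lemma shift_iter {m : ℕ} (ω : Om m) (k : ℕ) (z : ℤ) : shift^[k] ω z = ω (z + k) := by
  induction k generalizing ω with
  | zero => simp
  | succ k ih =>
    rw [Function.iterate_succ_apply, ih, shift]; push_cast; congr 1; ring

lemma shiftInv_iter {m : ℕ} (ω : Om m) (k : ℕ) (z : ℤ) : shiftInv^[k] ω z = ω (z - k) := by
  induction k generalizing ω with
  | zero => simp
  | succ k ih =>
    rw [Function.iterate_succ_apply, ih, shiftInv]; push_cast; congr 1; ring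

lemma shift_measurable {m : ℕ} : Measurable (shift : Om m → Om m) :=
  measurable_pi_lambda _ fun _ => measurable_pi_apply _

/-- the one-dimensional marginal -/
def marg {m : ℕ} (p : Fin m → ℝ) : Measure (Fin m) :=
  ∑ i, ENNReal.ofReal (p i) • Measure.dirac i

lemma marg_singleton {m : ℕ} (p : Fin m → ℝ) (a : Fin m) : marg p {a} = ENNReal.ofReal (p a) := by
  rw [marg, Measure.coe_finsetSum, Finset.sum_apply]
  rw [Finset.sum_eq_single a]
  · simp
  · intro b _ hb; simp [hb]
  · simp

lemma marg_prob {m : ℕ} (p : Fin m → ℝ) (hp : ∀ i, 0 < p i) (hp1 : ∑ i, p i = 1) :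
    IsProbabilityMeasure (marg p) := by
  constructor
  rw [marg, Measure.coe_finsetSum, Finset.sum_apply]
  simp only [Measure.smul_apply, measure_univ, smul_eq_mul, mul_one]
  rw [← ENNReal.ofReal_sum_of_nonneg (fun i _ => (hp i).le), hp1, ENNReal.ofReal_one]

lemma eq_pi {m : ℕ} (p : Fin m → ℝ) (hp : ∀ i, 0 < p i) (hp1 : ∑ i, p i = 1)
    (P : Measure (Om m)) (hPprob : IsProbabilityMeasure P)
    (hP : ∀ (s : Finset ℤ) (f : ℤ → Fin m),
      P {ω | ∀ i ∈ s, ω i = f i} = ENNReal.ofReal (∏ i ∈ s, p (f i))) :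
    P = Measure.infinitePi (fun _ : ℤ => marg p) := by
  have := marg_prob p hp hp1
  obtain ⟨ω0⟩ : Nonempty (Om m) := nonempty_of_isProbabilityMeasure P
  refine IsProjectiveLimit.unique ?_ (Measure.isProjectiveLimit_infinitePi (fun _ : ℤ => marg p))
  intro I
  refine Measure.ext_of_singleton fun u => ?_
  rw [Measure.map_apply (Finset.measurable_restrict I) (measurableSet_singleton _),
    Measure.pi_singleton]
  classical
  have e : (I.restrict (π := fun _ => Fin m)) ⁻¹' {u} =
      {ω : Om m | ∀ i ∈ I, ω i = (fun i => if hi : i ∈ I then u ⟨i, hi⟩ else ω0 i) i} := by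
    ext ω
    simp only [mem_preimage, mem_singleton_iff, mem_ofPred_eq]
    constructor
    · intro hω i hi
      simp only [hi, dif_pos]
      rw [← hω]; rfl
    · intro hω
      ext ⟨i, hi⟩
      have := hω i hi
      simp only [hi, dif_pos] at this
      simp [Finset.restrict, this]
  rw [e, hP, ENNReal.ofReal_prod_of_nonneg (fun i _ => (hp _).le)]
  rw [← Finset.prod_coe_sort]
  refine Finset.prod_congr rfl fun i _ => ?_
  rw [marg_singleton]
  simp

lemma map_shift {m : ℕ} (p : Fin m → ℝ) (hp : ∀ i, 0 < p i) (hp1 : ∑ i, p i = 1)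
    (P : Measure (Om m)) (hPprob : IsProbabilityMeasure P)
    (hP : ∀ (s : Finset ℤ) (f : ℤ → Fin m),
      P {ω | ∀ i ∈ s, ω i = f i} = ENNReal.ofReal (∏ i ∈ s, p (f i))) :
    MeasurePreserving shift P P := by
  have := marg_prob p hp hp1
  refine ⟨shift_measurable, ?_⟩
  rw [eq_pi p hp hp1 P hPprob hP]
  exact Measure.map_infinitePi_infinitePi_of_inj (P := fun _ : ℤ => marg p)
    (f := fun i : ℤ => i + 1) (fun a b h => by simpa using h)

lemma dep_factor {m : ℕ} {Φ : Om m → ℝ} {S : Finset ℤ} (hΦ : DependsOn Φ (S : Set ℤ)) :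
    ∃ G : (S → Fin m) → ℝ, Measurable G ∧ ∀ ω, Φ ω = G (fun i => ω i) := by
  obtain ⟨G, hG⟩ := dependsOn_iff_exists_comp.1 hΦ
  exact ⟨G, measurable_of_finite _, fun ω => by rw [hG]; rfl⟩

lemma dep_measurable {m : ℕ} {Φ : Om m → ℝ} {S : Finset ℤ} (hΦ : DependsOn Φ (S : Set ℤ)) :
    Measurable Φ := by
  obtain ⟨G, mG, hG⟩ := dep_factor hΦ
  have : Φ = G ∘ (fun ω (i : S) => ω i) := funext hG
  rw [this]
  exact mG.comp (measurable_pi_lambda _ fun _ => measurable_pi_apply _)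

lemma slln_dep {m : ℕ} (p : Fin m → ℝ) (hp : ∀ i, 0 < p i) (hp1 : ∑ i, p i = 1)
    (P : Measure (Om m)) (hPprob : IsProbabilityMeasure P)
    (hP : ∀ (s : Finset ℤ) (f : ℤ → Fin m),
      P {ω | ∀ i ∈ s, ω i = f i} = ENNReal.ofReal (∏ i ∈ s, p (f i)))
    {Φ : Om m → ℝ} {N : ℕ} (hΦ : DependsOn Φ (Finset.Icc (-(N : ℤ)) N : Set ℤ))
    {B : ℝ} (hB : ∀ ω, |Φ ω| ≤ B) :
    ∀ᵐ ω ∂P, Tendsto (fun n : ℕ => (∑ k ∈ Finset.range n, Φ (shift^[k] ω)) / n) atTop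
      (𝓝 (∫ ω, Φ ω ∂P)) := by
  have hmp := map_shift p hp hp1 P hPprob hP
  have mΦ : Measurable Φ := dep_measurable hΦ
  have iΦ : Integrable Φ P := Integrable.of_bound mΦ.aestronglyMeasurable B
    (Eventually.of_forall hB)
  have hind : iIndepFun (fun (i : ℤ) (ω : Om m) => ω i) P := by
    have := marg_prob p hp hp1
    rw [eq_pi p hp hp1 P hPprob hP]
    exact iIndepFun_infinitePi (X := fun _ x => x) (fun _ => measurable_id)
  set L := 2 * N + 1 with hL
  have hL0 : 0 < L := by omega
  have hdepk : ∀ k : ℕ, DependsOn (fun ω => Φ (shift^[k] ω))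
      (Finset.Icc (-(N : ℤ) + k) (N + k) : Set ℤ) := by
    intro k ω ω' hω
    refine hΦ fun i hi => ?_
    rw [shift_iter, shift_iter]
    apply hω
    simp only [Finset.coe_Icc, mem_Icc] at hi ⊢
    omega
  have hpair : ∀ k l : ℕ, k + L ≤ l →
      IndepFun (fun ω => Φ (shift^[k] ω)) (fun ω => Φ (shift^[l] ω)) P := by
    intro k l hkl
    obtain ⟨G1, m1, e1⟩ := dep_factor (hdepk k)
    obtain ⟨G2, m2, e2⟩ := dep_factor (hdepk l)
    have hd : Disjoint (Finset.Icc (-(N : ℤ) + k) (N + k)) (Finset.Icc (-(N : ℤ) + l) (N + l)) := by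
      rw [Finset.disjoint_left]
      intro a ha hb
      simp only [Finset.mem_Icc] at ha hb
      omega
    have := (hind.indepFun_finset _ _ hd (fun i => measurable_pi_apply _)).comp m1 m2
    convert this using 1
    · ext ω; exact e1 ω
    · ext ω; exact e2 ω
  have hr : ∀ r : ℕ, ∀ᵐ ω ∂P, Tendsto (fun q : ℕ =>
      (∑ i ∈ Finset.range q, Φ (shift^[L * i + r] ω)) / q) atTop (𝓝 (∫ ω, Φ ω ∂P)) := by
    intro r
    have hid : ∀ k, IdentDistrib (fun ω => Φ (shift^[k] ω)) Φ P P := fun k =>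
      (⟨(hmp.iterate k).measurable.aemeasurable, aemeasurable_id, by
        rw [(hmp.iterate k).map_eq, Measure.map_id]⟩ :
          IdentDistrib (shift^[k]) id P P).comp mΦ
    have hint0 : Integrable (fun ω => Φ (shift^[L * 0 + r] ω)) P :=
      (hmp.iterate _).integrable_comp_of_integrable iΦ
    have := strong_law_ae_real (fun i ω => Φ (shift^[L * i + r] ω)) hint0 (by
      intro i j hij
      rcases lt_or_gt_of_ne hij with hlt | hlt
      · exact hpair _ _ (by nlinarith)
      · exact (hpair _ _ (by nlinarith)).symm) (fun i => (hid _).trans (hid _).symm)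
    rw [(hid _).integral_eq] at this
    exact this
  filter_upwards [ae_all_iff.2 hr] with ω hω
  set E := ∫ ω, Φ ω ∂P with hE
  set S : ℕ → ℝ := fun n => ∑ k ∈ Finset.range n, Φ (shift^[k] ω) with hS
  have hblock : ∀ q : ℕ, S (L * q) =
      ∑ r ∈ Finset.range L, ∑ i ∈ Finset.range q, Φ (shift^[L * i + r] ω) := by
    intro q
    induction q with
    | zero => simp [hS]
    | succ q ih =>
      have : S (L * (q + 1)) = S (L * q) + ∑ r ∈ Finset.range L, Φ (shift^[L * q + r] ω) := by
        simp only [hS]; rw [Nat.mul_succ, Finset.sum_range_add]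
      rw [this, ih, ← Finset.sum_add_distrib]
      refine Finset.sum_congr rfl fun r _ => ?_
      rw [Finset.sum_range_succ]
  have hq : Tendsto (fun q : ℕ => S (L * q) / q) atTop (𝓝 (L * E)) := by
    have : Tendsto (fun q : ℕ => ∑ r ∈ Finset.range L,
        (∑ i ∈ Finset.range q, Φ (shift^[L * i + r] ω)) / q) atTop
        (𝓝 (∑ r ∈ Finset.range L, E)) := tendsto_finsetSum _ fun r _ => hω r
    rw [Finset.sum_const, Finset.card_range, nsmul_eq_mul] at this
    refine this.congr fun q => ?_
    rw [hblock, Finset.sum_div]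
  have hdivtop : Tendsto (fun n : ℕ => n / L) atTop atTop := Nat.tendsto_div_const_atTop hL0.ne'
  have hLr : (0 : ℝ) < L := by exact_mod_cast hL0
  have hratio : Tendsto (fun n : ℕ => ((n / L : ℕ) : ℝ) / n) atTop (𝓝 (1 / L)) := by
    have h1 : Tendsto (fun n : ℕ => 1 / (L : ℝ) - 1 / n) atTop (𝓝 (1 / L)) := by
      simpa using (tendsto_const_nhds (x := 1 / (L : ℝ))).sub
        (tendsto_const_div_atTop_nhds_zero_nat (1 : ℝ))
    refine tendsto_of_tendsto_of_tendsto_of_le_of_le' h1 tendsto_const_nhds ?_ ?_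
    · filter_upwards [eventually_gt_atTop 0] with n hn
      have hn' : (0 : ℝ) < n := by exact_mod_cast hn
      have h2 : n < L * (n / L + 1) := Nat.lt_mul_div_succ n hL0
      have h3 : (n : ℝ) < L * (((n / L : ℕ) : ℝ) + 1) := by exact_mod_cast h2
      rw [le_div_iff₀ hn']
      have e : (1 / (L : ℝ) - 1 / n) * n = n / L - 1 := by field_simp
      rw [e, sub_le_iff_le_add, div_le_iff₀ hLr]
      linarith
    · filter_upwards [eventually_gt_atTop 0] with n hn
      have hn' : (0 : ℝ) < n := by exact_mod_cast hn
      rw [div_le_div_iff₀ hn' hLr]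
      have h2 : n / L * L ≤ n := Nat.div_mul_le_self n L
      have : ((n / L : ℕ) : ℝ) * L ≤ n := by exact_mod_cast h2
      linarith
  have hmain : Tendsto (fun n : ℕ => S (L * (n / L)) / ((n / L : ℕ) : ℝ) *
      (((n / L : ℕ) : ℝ) / n)) atTop (𝓝 E) := by
    have := (hq.comp hdivtop).mul hratio
    have e : (L : ℝ) * E * (1 / L) = E := by field_simp
    rw [e] at this
    exact this
  refine hmain.congr_dist ?_
  refine squeeze_zero' (Eventually.of_forall fun n => dist_nonneg) ?_
    (tendsto_const_div_atTop_nhds_zero_nat (L * B))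
  filter_upwards [eventually_ge_atTop L] with n hn
  have hn' : (0 : ℝ) < n := by exact_mod_cast (by omega : 0 < n)
  have hq0 : 0 < n / L := Nat.div_pos hn hL0
  have hq0' : (0 : ℝ) < ((n / L : ℕ) : ℝ) := by exact_mod_cast hq0
  have e1 : S (L * (n / L)) / ((n / L : ℕ) : ℝ) * (((n / L : ℕ) : ℝ) / n) = S (L * (n / L)) / n := by
    field_simp
  have e2 : S n = S (L * (n / L)) + ∑ r ∈ Finset.range (n % L), Φ (shift^[L * (n / L) + r] ω) := by
    conv_lhs => rw [← Nat.div_add_mod n L]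
    simp only [hS]; rw [Finset.sum_range_add]
  have hB0 : 0 ≤ B := (abs_nonneg _).trans (hB ω)
  rw [e1, Real.dist_eq]
  change |S (L * (n / L)) / n - S n / n| ≤ _
  rw [← sub_div, abs_div, abs_of_pos hn', e2]
  apply div_le_div_of_nonneg_right _ hn'.le
  rw [sub_add_cancel_left, abs_neg]
  refine (Finset.abs_sum_le_sum_abs _ _).trans ?_
  refine (Finset.sum_le_sum fun i _ => hB _).trans ?_
  rw [Finset.sum_const, Finset.card_range, nsmul_eq_mul]
  refine mul_le_mul_of_nonneg_right ?_ hB0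
  exact_mod_cast (Nat.mod_lt n hL0).le

/-- strong law for uniform limits of cylinder functions -/
lemma slln {m : ℕ} (p : Fin m → ℝ) (hp : ∀ i, 0 < p i) (hp1 : ∑ i, p i = 1)
    (P : Measure (Om m)) (hPprob : IsProbabilityMeasure P)
    (hP : ∀ (s : Finset ℤ) (f : ℤ → Fin m),
      P {ω | ∀ i ∈ s, ω i = f i} = ENNReal.ofReal (∏ i ∈ s, p (f i)))
    {Φ : Om m → ℝ} {B : ℝ} (hB : ∀ ω, |Φ ω| ≤ B)
    (happ : ∀ ε > 0, ∃ (N : ℕ) (Ψ : Om m → ℝ), DependsOn Ψ (Finset.Icc (-(N : ℤ)) N : Set ℤ) ∧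
      ∀ ω, |Φ ω - Ψ ω| ≤ ε) :
    Measurable Φ ∧ ∀ᵐ ω ∂P, Tendsto (fun n : ℕ => (∑ k ∈ Finset.range n, Φ (shift^[k] ω)) / n) atTop
      (𝓝 (∫ ω, Φ ω ∂P)) := by
  have hε : ∀ k : ℕ, (0 : ℝ) < 1 / (k + 1) := fun k => by positivity
  choose N Ψ hdep hclose using fun k : ℕ => happ _ (hε k)
  have mΨ : ∀ k, Measurable (Ψ k) := fun k => dep_measurable (hdep k)
  have mΦ : Measurable Φ := by
    refine measurable_of_tendsto_metrizable mΨ (tendsto_pi_nhds.2 fun ω => ?_)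
    rw [tendsto_iff_dist_tendsto_zero]
    refine squeeze_zero (fun _ => dist_nonneg) (fun k => ?_) tendsto_one_div_add_atTop_nhds_zero_nat
    rw [Real.dist_eq, abs_sub_comm]
    exact hclose k ω
  refine ⟨mΦ, ?_⟩
  have hΨB : ∀ k ω, |Ψ k ω| ≤ B + 1 / (k + 1) := fun k ω => by
    have h1 := hclose k ω
    have h2 := hB ω
    rw [abs_le] at h1 h2 ⊢
    constructor <;> linarith [h1.1, h1.2, h2.1, h2.2]
  have hall := ae_all_iff.2 fun k => slln_dep p hp hp1 P hPprob hP (hdep k) (hΨB k)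
  filter_upwards [hall] with ω hω
  rw [Metric.tendsto_atTop]
  intro ε hε0
  obtain ⟨k, hk⟩ := exists_nat_one_div_lt (show 0 < ε / 3 by positivity)
  obtain ⟨n0, hn0⟩ := Metric.tendsto_atTop.1 (hω k) (ε / 3) (by positivity)
  refine ⟨n0 + 1, fun n hn => ?_⟩
  have h1 := hn0 n (by omega)
  have hn' : (0 : ℝ) < n := by exact_mod_cast (by omega : 0 < n)
  have iΦ : Integrable Φ P := Integrable.of_bound mΦ.aestronglyMeasurable B
    (Eventually.of_forall hB)
  have iΨ : Integrable (Ψ k) P := Integrable.of_bound (mΨ k).aestronglyMeasurable _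
    (Eventually.of_forall (hΨB k))
  have h2 : |∫ ω, Φ ω ∂P - ∫ ω, Ψ k ω ∂P| ≤ 1 / (k + 1) := by
    rw [← integral_sub iΦ iΨ]
    have := norm_integral_le_of_norm_le_const (μ := P) (f := fun ω => Φ ω - Ψ k ω)
      (Eventually.of_forall (hclose k))
    simpa using this
  have h3 : |(∑ i ∈ Finset.range n, Φ (shift^[i] ω)) / n -
      (∑ i ∈ Finset.range n, Ψ k (shift^[i] ω)) / n| ≤ 1 / (k + 1) := by
    rw [← sub_div, abs_div, abs_of_pos hn', div_le_iff₀ hn', ← Finset.sum_sub_distrib]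
    refine (Finset.abs_sum_le_sum_abs _ _).trans ?_
    refine (Finset.sum_le_sum fun i _ => hclose k _).trans ?_
    rw [Finset.sum_const, Finset.card_range, nsmul_eq_mul]
    linarith
  rw [Real.dist_eq] at h1 ⊢
  rw [abs_lt] at h1 ⊢
  rw [abs_le] at h2 h3
  constructor <;> linarith [h1.1, h1.2, h2.1, h2.2, h3.1, h3.2]

end slln

end

section
lemma rho_le {gmax : ℝ} (g0 : 0 < gmax) (g1 : gmax < 1 / 3) :
    ∃ θ : ℝ, 2 < θ ∧ ∀ᶠ n : ℕ in atTop, rho gmax n ≤ (n : ℝ) ^ (-θ) := by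
  have h1 : 3 < 1 / gmax := by rw [lt_div_iff₀ g0]; linarith
  refine ⟨(1 / gmax - 1 + 2) / 2, by linarith, ?_⟩
  set s := 1 / gmax - 1 - (1 / gmax - 1 + 2) / 2 with hs
  have hs0 : 0 < s := by rw [hs]; linarith
  have hlo := (isLittleO_log_rpow_rpow_atTop (1 / gmax) hs0).bound (c := 1) one_pos
  filter_upwards [tendsto_natCast_atTop_atTop.eventually hlo, eventually_ge_atTop 1] with n hn hn1
  have hn1' : (1 : ℝ) ≤ n := by exact_mod_cast hn1
  have hn0 : (0 : ℝ) < n := by linarith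
  have h2 : (Real.log n) ^ (1 / gmax) ≤ (n : ℝ) ^ s := by
    have h3 := (Real.le_norm_self _).trans hn
    rwa [one_mul, Real.norm_of_nonneg (Real.rpow_nonneg hn0.le _)] at h3
  rw [rho]
  calc _ ≤ (n : ℝ) ^ (1 - 1 / gmax) * (n : ℝ) ^ s :=
        mul_le_mul_of_nonneg_left h2 (Real.rpow_nonneg hn0.le _)
    _ = _ := by
        rw [← Real.rpow_add hn0]; congr 1; rw [hs]; ring

lemma rho_tendsto {gmax : ℝ} (g0 : 0 < gmax) (g1 : gmax < 1 / 3) :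
    Tendsto (fun n => rho gmax n) atTop (𝓝 0) := by
  obtain ⟨θ, hθ, hr⟩ := rho_le g0 g1
  refine squeeze_zero' (Eventually.of_forall fun n => rho_nonneg _ _) hr ?_
  exact (tendsto_rpow_neg_atTop (by linarith)).comp tendsto_natCast_atTop_atTop

lemma tvDist_le {μ ν : Measure ℝ} [IsProbabilityMeasure μ] [IsProbabilityMeasure ν] {A : Set ℝ}
    (hA : MeasurableSet A) : |ν.real A - μ.real A| ≤ tvDist μ ν := by
  have hb : ∀ (μ ν : Measure ℝ) [IsProbabilityMeasure μ] [IsProbabilityMeasure ν],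
      BddAbove (range fun A : {A : Set ℝ // MeasurableSet A} => ((μ A).toReal - (ν A).toReal)) := by
    intro μ ν _ _
    refine ⟨1, ?_⟩
    rintro _ ⟨A, rfl⟩
    have h1 : μ.real A ≤ 1 := measureReal_le_one
    have h2 : 0 ≤ ν.real A := measureReal_nonneg
    simp only [Measure.real] at h1 h2
    simp only
    linarith
  have h0 : ∀ (μ ν : Measure ℝ) [IsProbabilityMeasure μ] [IsProbabilityMeasure ν],
      0 ≤ ⨆ A : {A : Set ℝ // MeasurableSet A}, ((μ A).toReal - (ν A).toReal) := by
    intro μ ν _ _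
    have := le_ciSup (hb μ ν) ⟨∅, MeasurableSet.empty⟩
    simpa using this
  have h1 := le_ciSup (hb μ ν) ⟨A, hA⟩
  have h2 := le_ciSup (hb ν μ) ⟨A, hA⟩
  simp only at h1 h2
  have h3 := h0 μ ν
  have h4 := h0 ν μ
  rw [tvDist, abs_le]
  simp only [Measure.real]
  constructor <;> linarith

lemma randComp_congr {m : ℕ} (T : Fin m → ℝ → ℝ) {ω ω' : Om m} (n : ℕ)
    (hω : ∀ k : ℕ, k < n → ω k = ω' k) : randComp T ω n = randComp T ω' n := by
  induction n with
  | zero => rfl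
  | succ n ih =>
    funext x
    simp only [randComp]
    rw [ih (fun k hk => hω k (by omega)), hω n (by omega)]

instance : IsProbabilityMeasure mLeb := ⟨by simp [mLeb]⟩

namespace SysHyp
variable {m : ℕ} {γ : Fin m → ℝ} {gmax : ℝ} {ν : Om m → Measure ℝ} {h : Om m → ℝ → ℝ}
    {acone C : ℝ}

lemma local_int (H : SysHyp γ gmax ν h acone C) {x0 : ℝ} (hx0 : x0 ∈ Ioo (0 : ℝ) 1) {η : ℝ}
    (hη : 0 < η) : ∃ δ > 0, ∀ ω, ∀ F : ℝ → ℂ, Integrable F → (∀ x, δ ≤ |x - x0| → F x = 0) →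
      ‖∫ x, F x ∂(ν ω) - h ω x0 * ∫ x, F x‖ ≤ η * ∫ x, ‖F x‖ := by
  obtain ⟨δ, hδ, hcl⟩ := H.equicont hx0 hη
  refine ⟨δ, hδ, fun ω F hF hF0 => ?_⟩
  have e1 : ∫ x, F x ∂(ν ω) = ∫ x, (h ω x : ℂ) * F x := by
    rw [H.dens, integral_withDensity_eq_integral_toReal_smul (H.meas ω).ennreal_ofReal
      (Eventually.of_forall fun x => ENNReal.ofReal_lt_top), mLeb]
    rw [← integral_indicator measurableSet_Icc]
    congr 1
    ext x
    by_cases hx : |x - x0| < δ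
    · have := (hcl ω x hx).1
      have hm : x ∈ Icc (0 : ℝ) 1 := ⟨this.1.le, this.2⟩
      rw [indicator_of_mem hm, ENNReal.toReal_ofReal ((H.cone ω).2.1 x)]
      simp
    · rw [hF0 x (not_lt.1 hx)]
      simp only [indicator, mul_zero]
      split_ifs <;> simp [hF0 x (not_lt.1 hx)]
  have hdiff : ∀ x, ‖((h ω x : ℂ) - h ω x0) * F x‖ ≤ η * ‖F x‖ := by
    intro x
    by_cases hx : |x - x0| < δ
    · rw [norm_mul]
      refine mul_le_mul_of_nonneg_right ?_ (norm_nonneg _)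
      rw [← Complex.ofReal_sub, Complex.norm_real]
      exact (hcl ω x hx).2
    · rw [hF0 x (not_lt.1 hx)]; simp
  have id : Integrable (fun x => ((h ω x : ℂ) - h ω x0) * F x) := by
    refine Integrable.mono' (hF.norm.const_mul η) ?_ (Eventually.of_forall hdiff)
    exact (((Complex.measurable_ofReal.comp (H.meas ω)).sub_const _).aestronglyMeasurable).mul hF.1
  have e2 : ∫ x, (h ω x : ℂ) * F x = ∫ x, (((h ω x : ℂ) - h ω x0) * F x + h ω x0 * F x) := by
    congr 1; ext x; ring
  rw [e1, e2, integral_add id (hF.const_mul _), integral_const_mul, add_sub_cancel_right]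
  rw [← integral_const_mul]
  exact norm_integral_le_of_norm_le (hF.norm.const_mul η) (Eventually.of_forall hdiff)

lemma ball_meas (H : SysHyp γ gmax ν h acone C) {x0 : ℝ} (hx0 : x0 ∈ Ioo (0 : ℝ) 1) {η : ℝ}
    (hη : 0 < η) : ∃ δ > 0, ∀ ω, ∀ ε, 0 < ε → ε ≤ δ →
      |(ν ω).real {x | |x - x0| < ε} - 2 * ε * h ω x0| ≤ 2 * ε * η := by
  obtain ⟨δ, hδ, hl⟩ := H.local_int hx0 hη
  refine ⟨δ, hδ, fun ω ε hε hεδ => ?_⟩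
  have hprob := H.prob ω
  have eball : {x : ℝ | |x - x0| < ε} = Metric.ball x0 ε := by
    ext x; rw [Metric.mem_ball, Real.dist_eq]; rfl
  rw [eball]
  have hv : (volume : Measure ℝ).real (Metric.ball x0 ε) = 2 * ε := by
    rw [Measure.real, Real.volume_ball, ENNReal.toReal_ofReal (by linarith)]
  have := hl ω ((Metric.ball x0 ε).indicator fun _ => (1 : ℂ))
    ((integrable_indicator_iff measurableSet_ball).2
      (integrableOn_const (by rw [Real.volume_ball]; exact ENNReal.ofReal_ne_top)))
    (fun x hx => indicator_of_notMem (by rw [Metric.mem_ball, Real.dist_eq]; linarith) _)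
  rw [integral_indicator measurableSet_ball, integral_indicator measurableSet_ball] at this
  have e3 : ∀ x, ‖(Metric.ball x0 ε).indicator (fun _ => (1 : ℂ)) x‖ =
      (Metric.ball x0 ε).indicator (fun _ => (1 : ℝ)) x := by
    intro x; rw [norm_indicator_eq_indicator_norm]; simp
  simp_rw [e3] at this
  rw [integral_indicator measurableSet_ball] at this
  simp only [integral_const, measureReal_restrict_apply_univ, hv, smul_eq_mul, mul_one,
    Complex.real_smul] at this
  rw [← Complex.ofReal_mul, ← Complex.ofReal_sub, Complex.norm_real] at this
  rw [mul_comm (2 * ε) (h ω x0), mul_comm (2 * ε) η]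
  exact this

lemma h_bdd (H : SysHyp γ gmax ν h acone C) {x0 : ℝ} (hx0 : x0 ∈ Ioo (0 : ℝ) 1) (ω : Om m) :
    |h ω x0| ≤ acone * x0 ^ (-gmax) := by
  rw [abs_of_nonneg ((H.cone ω).2.1 x0)]
  exact (H.cone ω).2.2.2.2 x0 ⟨hx0.1, hx0.2.le⟩

lemma h_slln (H : SysHyp γ gmax ν h acone C) {x0 : ℝ} (hx0 : x0 ∈ Ioo (0 : ℝ) 1)
    (hpull : ∀ (ω : Om m) (n : ℕ), 2 ≤ n →
      tvDist (mLeb.map (randComp (fun i => lsv (γ i)) (shiftInv^[n] ω) n)) (ν ω) ≤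
        C * (n : ℝ) ^ (1 - 1 / gmax) * (Real.log n) ^ (1 / gmax))
    (p : Fin m → ℝ) (hp : ∀ i, 0 < p i) (hp1 : ∑ i, p i = 1)
    (P : Measure (Om m)) (hPprob : IsProbabilityMeasure P)
    (hP : ∀ (s : Finset ℤ) (f : ℤ → Fin m),
      P {ω | ∀ i ∈ s, ω i = f i} = ENNReal.ofReal (∏ i ∈ s, p (f i))) :
    Measurable (fun ω => h ω x0) ∧ ∀ᵐ ω ∂P,
      Tendsto (fun n : ℕ => (∑ k ∈ Finset.range n, h (shift^[k] ω) x0) / n) atTop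
      (𝓝 (∫ ω, h ω x0 ∂P)) := by
  refine slln p hp hp1 P hPprob hP (H.h_bdd hx0) fun ε hε => ?_
  obtain ⟨δ, hδ, hb⟩ := H.ball_meas hx0 (show 0 < ε / 2 by positivity)
  have ht := (rho_tendsto H.g0 H.g1).const_mul (C / (2 * δ))
  rw [mul_zero] at ht
  obtain ⟨N, hN, hN2⟩ := ((ht.eventually_lt_const (show 0 < ε / 2 by positivity)).and
    (eventually_ge_atTop 2)).exists
  set B : Set ℝ := {x | |x - x0| < δ} with hB
  have mB : MeasurableSet B := by
    have : B = Metric.ball x0 δ := by ext x; rw [Metric.mem_ball, Real.dist_eq]; rfl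
    rw [this]; exact measurableSet_ball
  refine ⟨N, fun ω =>
    (mLeb.map (randComp (fun i => lsv (γ i)) (shiftInv^[N] ω) N)).real B / (2 * δ), ?_, ?_⟩
  · intro ω ω' hω
    simp only
    rw [randComp_congr (fun i => lsv (γ i)) N (ω := shiftInv^[N] ω) (ω' := shiftInv^[N] ω')]
    intro k hk
    rw [shiftInv_iter, shiftInv_iter]
    apply hω
    simp only [Finset.coe_Icc, mem_Icc]
    omega
  · intro ω
    have hprob := H.prob ω
    have : IsProbabilityMeasure (mLeb.map (randComp (fun i => lsv (γ i)) (shiftInv^[N] ω) N)) :=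
      Measure.isProbabilityMeasure_map (randComp_measurable _ _ _).aemeasurable
    have h1 := (tvDist_le mB).trans (hpull ω N hN2)
    have h2 := hb ω δ hδ le_rfl
    rw [mul_assoc] at h1
    change _ ≤ C * rho gmax N at h1
    have h3 : C * rho gmax N ≤ ε / 2 * (2 * δ) := by
      have e : C / (2 * δ) * rho gmax N = C * rho gmax N / (2 * δ) := by ring
      rw [e, div_lt_iff₀ (by positivity)] at hN
      exact hN.le
    have h4 : |2 * δ * h ω x0 -
        (mLeb.map (randComp (fun i => lsv (γ i)) (shiftInv^[N] ω) N)).real B| ≤ ε * (2 * δ) := by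
      rw [abs_le] at h1 h2 ⊢
      constructor <;> nlinarith [h1.1, h1.2, h2.1, h2.2]
    have e : h ω x0 - (mLeb.map (randComp (fun i => lsv (γ i)) (shiftInv^[N] ω) N)).real B /
      (2 * δ) = (2 * δ * h ω x0 -
        (mLeb.map (randComp (fun i => lsv (γ i)) (shiftInv^[N] ω) N)).real B) / (2 * δ) := by
      field_simp
    rw [e, abs_div, abs_of_pos (by positivity : (0 : ℝ) < 2 * δ), div_le_iff₀ (by positivity)]
    exact h4

lemma b_limit (H : SysHyp γ gmax ν h acone C) {x0 : ℝ} (hx0 : x0 ∈ Ioo (0 : ℝ) 1)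
    (P : Measure (Om m)) (hPprob : IsProbabilityMeasure P)
    (mh : Measurable (fun ω => h ω x0)) (νa : Measure ℝ)
    (hνa : ∀ A : Set ℝ, MeasurableSet A → νa A = ∫⁻ ω, ν ω A ∂P) :
    0 < 2 * ∫ ω, h ω x0 ∂P ∧ 
    Tendsto (fun ε : ℝ => (νa {x | |x - x0| < ε}).toReal / ε) (𝓝[>] (0 : ℝ))
      (𝓝 (2 * ∫ ω, h ω x0 ∂P)) := by
  have ih : Integrable (fun ω => h ω x0) P := Integrable.of_bound mh.aestronglyMeasurable _
    (Eventually.of_forall (H.h_bdd hx0))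
  obtain ⟨κ, hκ, hmin⟩ := H.exists_min
  have hpos : κ ≤ ∫ ω, h ω x0 ∂P := by
    have := integral_mono (μ := P) (integrable_const κ) ih
      (fun ω => hmin ω x0 ⟨hx0.1, hx0.2.le⟩)
    simpa using this
  refine ⟨by linarith, ?_⟩
  set I := ∫ ω, h ω x0 ∂P with hI
  rw [Metric.tendsto_nhds]
  intro η hη
  obtain ⟨δ, hδ, hb⟩ := H.ball_meas hx0 (show 0 < min (η / 4) (κ / 2) by positivity)
  set η' := min (η / 4) (κ / 2) with hη'
  have hη1 : η' ≤ η / 4 := min_le_left _ _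
  have hη2 : η' ≤ κ / 2 := min_le_right _ _
  filter_upwards [Ioc_mem_nhdsGT hδ] with ε hε
  have hε0 : 0 < ε := hε.1
  set B : Set ℝ := {x | |x - x0| < ε} with hB
  have mB : MeasurableSet B := by
    have : B = Metric.ball x0 ε := by ext x; rw [Metric.mem_ball, Real.dist_eq]; rfl
    rw [this]; exact measurableSet_ball
  have hbω := fun ω => abs_le.1 (hb ω ε hε.1 hε.2)
  have ec : ∀ c : ℝ, ∫ ω, 2 * ε * (h ω x0 + c) ∂P = 2 * ε * (I + c) := by
    intro c
    rw [integral_const_mul, integral_add ih (integrable_const c)]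
    simp [hI]
  have iadd : ∀ c : ℝ, Integrable (fun ω => 2 * ε * (h ω x0 + c)) P := fun c =>
    (ih.add (integrable_const c)).const_mul _
  have hle : νa B ≤ ENNReal.ofReal (2 * ε * (I + η')) := by
    rw [hνa B mB, ← ec, ofReal_integral_eq_lintegral_ofReal (iadd _)]
    · refine lintegral_mono fun ω => ?_
      have := H.prob ω
      rw [← ENNReal.ofReal_toReal (measure_ne_top (ν ω) B)]
      apply ENNReal.ofReal_le_ofReal
      have := (hbω ω).2
      simp only [Measure.real] at this
      linarith
    · refine Eventually.of_forall fun ω => ?_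
      have := (H.cone ω).2.1 x0
      simp only [Pi.zero_apply]
      positivity
  have hge : ENNReal.ofReal (2 * ε * (I + -η')) ≤ νa B := by
    rw [hνa B mB, ← ec, ofReal_integral_eq_lintegral_ofReal (iadd _)]
    · refine lintegral_mono fun ω => ?_
      have := H.prob ω
      rw [← ENNReal.ofReal_toReal (measure_ne_top (ν ω) B)]
      apply ENNReal.ofReal_le_ofReal
      have := (hbω ω).1
      simp only [Measure.real] at this
      linarith
    · refine Eventually.of_forall fun ω => ?_
      have := hmin ω x0 ⟨hx0.1, hx0.2.le⟩
      simp only [Pi.zero_apply]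
      have : 0 ≤ h ω x0 + -η' := by linarith
      positivity
  have hfin : νa B ≠ ∞ := ne_top_of_le_ne_top ENNReal.ofReal_ne_top hle
  have h1 : (νa B).toReal ≤ 2 * ε * (I + η') := by
    refine ENNReal.toReal_le_of_le_ofReal ?_ hle
    have : 0 < η' := by positivity
    have : 0 ≤ I + η' := by linarith
    positivity
  have h2 : 2 * ε * (I + -η') ≤ (νa B).toReal := (ENNReal.ofReal_le_iff_le_toReal hfin).1 hge
  have h1' : (νa B).toReal / ε ≤ 2 * (I + η') := by rw [div_le_iff₀ hε0]; linarith
  have h2' : 2 * (I + -η') ≤ (νa B).toReal / ε := by rw [le_div_iff₀ hε0]; linarith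
  rw [Real.dist_eq, abs_lt]
  constructor <;> linarith

end SysHyp

end

section
/-- generic points: not periodic and not a preimage of the discontinuity -/
structure GoodPt {m : ℕ} (γ : Fin m → ℝ) (x0 : ℝ) : Prop where
  mem : x0 ∈ Ioo (0 : ℝ) 1
  nonper : ∀ (ω : Om m) (j : ℕ), 1 ≤ j → randComp (fun i => lsv (γ i)) ω j x0 ≠ x0
  nonhalf : ∀ (ω : Om m) (j : ℕ), randComp (fun i => lsv (γ i)) ω j x0 ≠ 1 / 2

/-- extension of a finite word -/
def extW {m : ℕ} (a : Fin m) {j : ℕ} (v : Fin j → Fin m) : Om m := fun z =>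
  if hz : z.toNat < j then v ⟨z.toNat, hz⟩ else a

lemma randComp_extW {m : ℕ} (T : Fin m → ℝ → ℝ) (a : Fin m) (ω : Om m) (j : ℕ) :
    randComp T ω j = randComp T (extW a (fun k : Fin j => ω (k : ℕ))) j := by
  refine randComp_congr T j fun k hk => ?_
  simp [extW, hk]

lemma ae_goodPt {m : ℕ} {γ : Fin m → ℝ} (hγ : ∀ i, 0 < γ i) (a : Fin m) :
    ∀ᵐ x0 ∂mLeb, GoodPt γ x0 := by
  set S1 : Set ℝ := ⋃ j : ℕ, ⋃ v : Fin (j + 1) → Fin m, ⋃ w : Fin (j + 1) → Bool,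
    {x | x ∈ Ioc (0 : ℝ) 1 ∧ brI γ (j + 1) (extW a v) w x = x} with hS1
  set S2 : Set ℝ := ⋃ j : ℕ, ⋃ v : Fin j → Fin m, ⋃ w : Fin j → Bool,
    {brI γ j (extW a v) w (1 / 2)} with hS2
  have c1 : S1.Countable := by
    refine countable_iUnion fun j => countable_iUnion fun v => countable_iUnion fun w => ?_
    refine Set.Subsingleton.countable ?_
    intro x hx y hy
    by_contra hne
    rcases lt_or_gt_of_ne hne with hlt | hlt
    · have := brI_contract' hγ (j + 1) (by omega) (extW a v) w ⟨hx.1.1.le, hx.1.2⟩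
        ⟨hy.1.1.le, hy.1.2⟩ hlt
      rw [hx.2, hy.2] at this
      exact lt_irrefl _ this
    · have := brI_contract' hγ (j + 1) (by omega) (extW a v) w ⟨hy.1.1.le, hy.1.2⟩
        ⟨hx.1.1.le, hx.1.2⟩ hlt
      rw [hx.2, hy.2] at this
      exact lt_irrefl _ this
  have c2 : S2.Countable :=
    countable_iUnion fun j => countable_iUnion fun v => countable_iUnion fun w =>
      countable_singleton _
  have c3 : (S1 ∪ S2 ∪ {0, 1}).Countable := (c1.union c2).union (by simp)
  have hnull : volume (S1 ∪ S2 ∪ {0, 1}) = 0 := c3.measure_zero _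
  rw [mLeb, ae_restrict_iff' measurableSet_Icc]
  filter_upwards [measure_eq_zero_iff_ae_notMem.1 hnull] with x hx hx01
  simp only [mem_union, mem_insert_iff, mem_singleton_iff, not_or] at hx
  obtain ⟨⟨hx1, hx2⟩, hx3, hx4⟩ := hx
  have hm : x ∈ Ioo (0 : ℝ) 1 :=
    ⟨lt_of_le_of_ne hx01.1 (Ne.symm hx3), lt_of_le_of_ne hx01.2 hx4⟩
  have hm' : x ∈ Ioc (0 : ℝ) 1 := ⟨hm.1, hm.2.le⟩
  refine ⟨hm, ?_, ?_⟩
  · intro ω j hj he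
    obtain ⟨j, rfl⟩ : ∃ k, j = k + 1 := ⟨j - 1, by omega⟩
    rw [randComp_extW _ a] at he
    obtain ⟨w, hw⟩ := brI_randComp hγ (j + 1)
      (extW a (fun k : Fin (j + 1) => ω (k : ℕ))) hm'
    rw [he] at hw
    apply hx1
    simp only [hS1, mem_iUnion]
    exact ⟨j, _, w, hm', hw⟩
  · intro ω j he
    rw [randComp_extW _ a] at he
    obtain ⟨w, hw⟩ := brI_randComp hγ j (extW a (fun k : Fin j => ω (k : ℕ))) hm'
    rw [he] at hw
    apply hx2
    simp only [hS2, mem_iUnion]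
    exact ⟨j, _, w, hw.symm⟩

lemma lsv_continuousAt {γ : ℝ} (hγ : 0 < γ) {x : ℝ} (hx : x ≠ 1 / 2) : ContinuousAt (lsv γ) x := by
  rcases lt_or_gt_of_ne hx with h | h
  · have : ContinuousAt (fun x : ℝ => x * (1 + 2 ^ γ * x ^ γ)) x := by
      have := (Real.continuous_rpow_const hγ.le).continuousAt (x := x)
      fun_prop
    refine this.congr ?_
    filter_upwards [Iio_mem_nhds h] with y hy
    have : y ≤ 1 / 2 := le_of_lt hy
    simp only [lsv, this, if_true]
  · have : ContinuousAt (fun x : ℝ => 2 * x - 1) x := by fun_prop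
    refine this.congr ?_
    filter_upwards [Ioi_mem_nhds h] with y hy
    have : ¬ y ≤ 1 / 2 := not_le.2 hy
    simp only [lsv, this, if_false]

lemma GoodPt.continuousAt {m : ℕ} {γ : Fin m → ℝ} (hγ : ∀ i, 0 < γ i) {x0 : ℝ}
    (hx : GoodPt γ x0) (ω : Om m) (j : ℕ) :
    ContinuousAt (randComp (fun i => lsv (γ i)) ω j) x0 := by
  induction j with
  | zero => exact continuousAt_id
  | succ j ih =>
    exact ContinuousAt.comp (f := randComp (fun i => lsv (γ i)) ω j) (g := lsv (γ (ω j)))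
      (lsv_continuousAt (hγ _) (hx.nonhalf ω j)) ih

lemma GoodPt.noReturn {m : ℕ} {γ : Fin m → ℝ} (hγ : ∀ i, 0 < γ i) {x0 : ℝ} (a : Fin m)
    (hx : GoodPt γ x0) (j : ℕ) (hj : 1 ≤ j) :
    ∃ r > 0, ∀ (ω : Om m) (x : ℝ), |x - x0| ≤ r →
      r < |randComp (fun i => lsv (γ i)) ω j x - x0| := by
  have key : ∀ v : Fin j → Fin m, ∀ᶠ r : ℝ in 𝓝[>] 0, ∀ x, |x - x0| ≤ r →
      r < |randComp (fun i => lsv (γ i)) (extW a v) j x - x0| := by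
    intro v
    set f := randComp (fun i => lsv (γ i)) (extW a v) j with hf
    have hc : ContinuousAt (fun x => |f x - x0|) x0 :=
      ((hx.continuousAt hγ (extW a v) j).sub continuousAt_const).abs
    have hpos : 0 < |f x0 - x0| := abs_pos.2 (sub_ne_zero.2 (hx.nonper _ j hj))
    obtain ⟨δ, hδ, hd⟩ := Metric.eventually_nhds_iff.1
      (hc.eventually (lt_mem_nhds (half_lt_self hpos)))
    filter_upwards [Ioo_mem_nhdsGT (show 0 < min δ (|f x0 - x0| / 2) by positivity)] with r hr x hxr
    have h1 : r < δ := hr.2.trans_le (min_le_left _ _)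
    have h2 : r < |f x0 - x0| / 2 := hr.2.trans_le (min_le_right _ _)
    exact h2.trans (hd (by rw [Real.dist_eq]; linarith))
  obtain ⟨r, hr, hr0⟩ := ((eventually_all.2 key).and self_mem_nhdsWithin).exists
  refine ⟨r, hr0, fun ω x hxr => ?_⟩
  rw [randComp_extW _ a]
  exact hr _ x hxr

lemma GoodPt.noReturn' {m : ℕ} {γ : Fin m → ℝ} (hγ : ∀ i, 0 < γ i) {x0 : ℝ} (a : Fin m)
    (hx : GoodPt γ x0) (J : ℕ) :
    ∃ r > 0, ∀ j, 1 ≤ j → j < J → ∀ (ω : Om m) (x : ℝ), |x - x0| ≤ r →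
      r < |randComp (fun i => lsv (γ i)) ω j x - x0| := by
  induction J with
  | zero => exact ⟨1, one_pos, fun j _ h => by omega⟩
  | succ J ih =>
    obtain ⟨r, hr, h1⟩ := ih
    by_cases hJ : 1 ≤ J
    · obtain ⟨r', hr', h2⟩ := hx.noReturn hγ a J hJ
      refine ⟨min r r', lt_min hr hr', fun j hj hjJ ω x hxr => ?_⟩
      rcases Nat.lt_succ_iff_lt_or_eq.1 hjJ with hlt | rfl
      · exact (min_le_left _ _).trans_lt (h1 j hj hlt ω x (hxr.trans (min_le_left _ _)))
      · exact (min_le_right _ _).trans_lt (h2 ω x (hxr.trans (min_le_right _ _)))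
    · exact ⟨r, hr, fun j hj hjJ => by omega⟩

namespace SysHyp
variable {m : ℕ} {γ : Fin m → ℝ} {gmax : ℝ} {ν : Om m → Measure ℝ} {h : Om m → ℝ → ℝ}
    {acone C : ℝ}

lemma ret_bound (H : SysHyp γ gmax ν h acone C) {x0 : ℝ} (hx0 : x0 ∈ Ioo (0 : ℝ) 1) :
    ∃ K > 0, ∃ r0 > 0, ∀ r, 0 < r → r ≤ r0 → ∀ (ω : Om m) (j : ℕ), 2 ≤ j →
      (ν ω).real {x | |x - x0| ≤ r ∧ |randComp (fun i => lsv (γ i)) ω j x - x0| ≤ r} ≤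
        K * r * (r + √(rho gmax j)) := by
  obtain ⟨K', hK', hcyl⟩ := H.cyl_len
  set c := x0 / 2 with hc
  have hc0 : 0 < c := by have := hx0.1; positivity
  set A := acone * c ^ (-gmax) with hA
  have hA0 : 0 < A := mul_pos H.a0 (Real.rpow_pos_of_pos hc0 _)
  refine ⟨A * (2 / c) * (2 + 2 * √K'), by positivity, min c (1 - x0),
    lt_min hc0 (by linarith [hx0.2]), ?_⟩
  intro r hr hr0 ω j hj
  have hprob := H.prob ω
  have hr1 : r ≤ c := hr0.trans (min_le_left _ _)
  have hr2 : r ≤ 1 - x0 := hr0.trans (min_le_right _ _)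
  set R := randComp (fun i => lsv (γ i)) ω j with hR
  have mR : Measurable R := randComp_measurable _ _ _
  set d := √(K' * rho gmax j) with hd
  have hdw : ∀ w, brI γ j ω w 1 - brI γ j ω w 0 ≤ d := fun w => Real.le_sqrt_of_sq_le (hcyl ω j hj w)
  have hs := short_measure H.hγ j ω (c := c) (p := x0 - r) (q := x0 + r) (β₁ := x0 - r)
    (β₂ := x0 + r) hc0 (by linarith) (by linarith) (by linarith) (by linarith) hdw
  set S := Icc (x0 - r) (x0 + r) ∩ Ioc 0 1 ∩ R ⁻¹' (Icc (x0 - r) (x0 + r)) with hS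
  have mS : MeasurableSet S := (measurableSet_Icc.inter measurableSet_Ioc).inter
    (mR measurableSet_Icc)
  have hsub : {x | |x - x0| ≤ r ∧ |R x - x0| ≤ r} ∩ Ioc 0 1 ⊆ S := by
    rintro x ⟨⟨h1, h2⟩, h3⟩
    rw [abs_le] at h1 h2
    exact ⟨⟨⟨by linarith [h1.1], by linarith [h1.2]⟩, h3⟩, ⟨by linarith [h2.1], by linarith [h2.2]⟩⟩
  have h1 : ν ω {x | |x - x0| ≤ r ∧ |R x - x0| ≤ r} ≤ ν ω S := by
    apply measure_mono_ae
    filter_upwards [H.ae_mem ω] with x hx hxs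
    exact hsub ⟨hxs, hx⟩
  have hSc : S ⊆ Ici c := by
    rintro x ⟨⟨h1, _⟩, _⟩
    have := h1.1
    rw [mem_Ici]; linarith
  have h2 : ν ω S ≤ ENNReal.ofReal A * volume S := by
    have := H.le_vol hc0 ω S
    rw [Measure.restrict_apply mS, inter_eq_left.2 hSc] at this
    simpa using this
  have h3 : ν ω {x | |x - x0| ≤ r ∧ |R x - x0| ≤ r} ≤
      ENNReal.ofReal (A * ((x0 + r - (x0 - r)) / c * (x0 + r - (x0 - r) + 2 * d))) := by
    rw [ENNReal.ofReal_mul hA0.le]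
    exact (h1.trans h2).trans (mul_le_mul_right hs _)
  have hd0 : 0 ≤ d := Real.sqrt_nonneg _
  have h4 : (ν ω).real {x | |x - x0| ≤ r ∧ |R x - x0| ≤ r} ≤
      A * ((x0 + r - (x0 - r)) / c * (x0 + r - (x0 - r) + 2 * d)) := by
    refine ENNReal.toReal_le_of_le_ofReal ?_ h3
    have : x0 + r - (x0 - r) = 2 * r := by ring
    rw [this]; positivity
  refine h4.trans ?_
  have e1 : x0 + r - (x0 - r) = 2 * r := by ring
  have e2 : d = √K' * √(rho gmax j) := Real.sqrt_mul hK'.le _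
  rw [e1, e2]
  have hq : 0 ≤ √(rho gmax j) := Real.sqrt_nonneg _
  have hk : 0 ≤ √K' := Real.sqrt_nonneg _
  have : 2 * r + 2 * (√K' * √(rho gmax j)) ≤ (2 + 2 * √K') * (r + √(rho gmax j)) := by
    nlinarith [mul_nonneg hk hr.le, mul_nonneg hk hq]
  calc A * (2 * r / c * (2 * r + 2 * (√K' * √(rho gmax j))))
      ≤ A * (2 * r / c * ((2 + 2 * √K') * (r + √(rho gmax j)))) := by gcongr
    _ = _ := by ring

end SysHyp

end

section
lemma summable_sqrt_rho {gmax : ℝ} (g0 : 0 < gmax) (g1 : gmax < 1 / 3) :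
    Summable (fun j => √(rho gmax j)) := by
  obtain ⟨θ, hθ, he⟩ := rho_le g0 g1
  have hs : Summable (fun j : ℕ => (j : ℝ) ^ (-(θ / 2))) :=
    Real.summable_nat_rpow.2 (by linarith)
  refine Summable.of_norm_bounded_eventually_nat hs ?_
  filter_upwards [he] with n hn
  rw [Real.norm_of_nonneg (Real.sqrt_nonneg _)]
  refine (Real.sqrt_le_sqrt hn).trans (le_of_eq ?_)
  rw [Real.sqrt_eq_rpow, ← Real.rpow_mul (by positivity)]
  congr 1; ring

lemma exists_gap {gmax : ℝ} (g0 : 0 < gmax) (g1 : gmax < 1 / 3) :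
    ∃ M : ℕ → ℕ, (∀ n, 2 ≤ M n) ∧ Tendsto (fun n : ℕ => (M n : ℝ) / n) atTop (𝓝 0) ∧
      Tendsto (fun n : ℕ => (n : ℝ) ^ 2 * rho gmax (M n)) atTop (𝓝 0) := by
  obtain ⟨θ, hθ, he⟩ := rho_le g0 g1
  obtain ⟨β, hβ1, hβ2⟩ : ∃ β, 2 / θ < β ∧ β < 1 := exists_between (by
    rw [div_lt_one (by linarith)]; exact hθ)
  have hβ0 : 0 < β := lt_trans (by positivity) hβ1
  have hβθ : 2 < β * θ := by rwa [div_lt_iff₀ (by linarith)] at hβ1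
  have hceil : ∀ n : ℕ, (n : ℝ) ^ β ≤ (⌈(n : ℝ) ^ β⌉₊ + 2 : ℕ) := fun n => by
    push_cast; linarith [Nat.le_ceil ((n : ℝ) ^ β)]
  refine ⟨fun n => ⌈(n : ℝ) ^ β⌉₊ + 2, fun n => Nat.le_add_left _ _, ?_, ?_⟩
  · have h1 : Tendsto (fun n : ℕ => (n : ℝ) ^ (-(1 - β)) + 3 * (n : ℝ)⁻¹) atTop (𝓝 (0 + 3 * 0)) :=
      ((tendsto_rpow_neg_atTop (by linarith)).comp tendsto_natCast_atTop_atTop).add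
        (tendsto_inv_atTop_nhds_zero_nat.const_mul _)
    simp only [mul_zero, add_zero] at h1
    refine squeeze_zero' (Eventually.of_forall fun n => by positivity) ?_ h1
    filter_upwards [eventually_ge_atTop 1] with n hn
    have hn' : (0 : ℝ) < n := by exact_mod_cast hn
    have e : (n : ℝ) ^ (-(1 - β)) = (n : ℝ) ^ β / n := by
      rw [show -(1 - β) = β - 1 by ring, Real.rpow_sub hn', Real.rpow_one]
    rw [e, ← div_eq_mul_inv, ← add_div]
    gcongr
    push_cast
    have := (Nat.ceil_lt_add_one (Real.rpow_nonneg hn'.le β)).le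
    linarith
  · have hM : Tendsto (fun n : ℕ => ⌈(n : ℝ) ^ β⌉₊ + 2) atTop atTop := by
      refine tendsto_atTop_mono (fun n => Nat.le_add_right _ _) ?_
      exact tendsto_nat_ceil_atTop.comp
        ((tendsto_rpow_atTop hβ0).comp tendsto_natCast_atTop_atTop)
    have h1 : Tendsto (fun n : ℕ => (n : ℝ) ^ (-(β * θ - 2))) atTop (𝓝 0) :=
      (tendsto_rpow_neg_atTop (by linarith)).comp tendsto_natCast_atTop_atTop
    refine squeeze_zero' (Eventually.of_forall fun n => by
      have := rho_nonneg gmax (⌈(n : ℝ) ^ β⌉₊ + 2); positivity) ?_ h1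
    filter_upwards [eventually_ge_atTop 1, hM.eventually he] with n hn h2
    have hn' : (0 : ℝ) < n := by exact_mod_cast hn
    have h3 : ((⌈(n : ℝ) ^ β⌉₊ + 2 : ℕ) : ℝ) ^ (-θ) ≤ ((n : ℝ) ^ β) ^ (-θ) :=
      Real.rpow_le_rpow_of_nonpos (by positivity) (hceil n) (by linarith)
    calc (n : ℝ) ^ 2 * rho gmax (⌈(n : ℝ) ^ β⌉₊ + 2)
        ≤ (n : ℝ) ^ 2 * ((n : ℝ) ^ β) ^ (-θ) := by gcongr; exact h2.trans h3
      _ = _ := by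
        rw [← Real.rpow_mul hn'.le, ← Real.rpow_natCast, ← Real.rpow_add hn']
        congr 1; push_cast; ring

lemma integral_scale {E : Type*} [NormedAddCommGroup E] [NormedSpace ℝ E] (F : ℝ → E) {s : ℝ}
    (hs : 0 < s) (x0 : ℝ) : ∫ x, F (s * (x - x0)) = s⁻¹ • ∫ y, F y := by
  rw [integral_sub_right_eq_self (fun x => F (s * x)) x0, Measure.integral_comp_mul_left,
    abs_of_pos (by positivity)]

lemma integrable_scale {E : Type*} [NormedAddCommGroup E] [NormedSpace ℝ E] {F : ℝ → E}
    (hF : Integrable F) {s : ℝ}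
    (hs : 0 < s) (x0 : ℝ) : Integrable (fun x => F (s * (x - x0))) :=
  (hF.comp_mul_left' hs.ne').comp_sub_right x0

/-- admissible test functions -/
structure GoodG (G : ℝ → ℂ) (B R : ℝ) : Prop where
  re : ContDiff ℝ 1 (fun x => (G x).re)
  im : ContDiff ℝ 1 (fun x => (G x).im)
  dre : ∀ x, |deriv (fun x => (G x).re) x| ≤ B
  dim : ∀ x, |deriv (fun x => (G x).im) x| ≤ B
  B0 : 0 ≤ B
  R0 : 0 < R
  supp : ∀ x, R ≤ |x| → G x = 0
  one : ∀ x, ‖1 + G x‖ ≤ 1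

namespace GoodG
variable {G : ℝ → ℂ} {B R : ℝ}

lemma le_two (hG : GoodG G B R) (x : ℝ) : ‖G x‖ ≤ 2 := by
  have : G x = (1 + G x) - 1 := by ring
  rw [this]
  refine (norm_sub_le _ _).trans ?_
  have := hG.one x
  rw [norm_one]; linarith

lemma cont (hG : GoodG G B R) : Continuous G := by
  have : G = fun x => ((G x).re : ℂ) + ((G x).im : ℂ) * Complex.I := by
    ext x; simp
  rw [this]
  have h1 := hG.re.continuous
  have h2 := hG.im.continuous
  fun_prop

lemma integrable (hG : GoodG G B R) : Integrable G := by
  refine hG.cont.integrable_of_hasCompactSupport ?_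
  refine HasCompactSupport.intro (isCompact_closedBall (0 : ℝ) R) fun x hx => hG.supp x ?_
  simp at hx; exact hx.le

lemma C1 (hG : GoodG G B R) {f : ℝ → ℝ} (hf : ContDiff ℝ 1 f) (hB : ∀ x, |deriv f x| ≤ B)
    (h2 : ∀ x, |f x| ≤ 2) {s : ℝ} (hs : 0 ≤ s) (x0 : ℝ) :
    C1norm (fun x => f (s * (x - x0))) ≤ 2 + B * s := by
  refine C1norm_le (fun x => h2 _) fun x => ?_
  have h1 : HasDerivAt (fun x => s * (x - x0)) (s * 1) x :=
    ((hasDerivAt_id x).sub_const x0).const_mul s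
  have h3 := ((hf.differentiable one_ne_zero) (s * (x - x0))).hasDerivAt.comp x h1
  have h4 : deriv (fun x => f (s * (x - x0))) x = deriv f (s * (x - x0)) * (s * 1) := h3.deriv
  rw [h4, abs_mul, mul_one, abs_of_nonneg hs]
  exact mul_le_mul_of_nonneg_right (hB _) hs

end GoodG

namespace SysHyp
variable {m : ℕ} {γ : Fin m → ℝ} {gmax : ℝ} {ν : Om m → Measure ℝ} {h : Om m → ℝ → ℝ}
    {acone C : ℝ}

lemma kappa_bound (H : SysHyp γ gmax ν h acone C) {x0 : ℝ} (hx0 : x0 ∈ Ioo (0 : ℝ) 1)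
    {G : ℝ → ℂ} {B R : ℝ} (hG : GoodG G B R) {b : ℝ} (hb : 0 < b) :
    ∃ K > 0, ∀ᶠ n : ℕ in atTop, ∀ ω, ∫ x, ‖G (b * n * (x - x0))‖ ∂ν ω ≤ K / n := by
  obtain ⟨δ, hδ, hball⟩ := H.ball_meas hx0 one_pos
  set A := acone * x0 ^ (-gmax) with hA
  have hA0 : 0 < A := mul_pos H.a0 (Real.rpow_pos_of_pos hx0.1 _)
  have hR0 := hG.R0
  refine ⟨2 * (2 * (R / b) * (1 + A)), by positivity, ?_⟩
  have hev : ∀ᶠ n : ℕ in atTop, R / b / n ≤ δ :=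
    ((tendsto_const_div_atTop_nhds_zero_nat (R / b)).eventually_le_const hδ)
  filter_upwards [hev, eventually_ge_atTop 1] with n h1 hn ω
  have hn' : (0 : ℝ) < n := by exact_mod_cast hn
  have := H.prob ω
  set ε := R / b / n with hε
  have hε0 : 0 < ε := by positivity
  have h2 := hball ω ε hε0 h1
  have h3 := H.h_bdd hx0 ω
  have h4 : (ν ω).real {x | |x - x0| < ε} ≤ 2 * ε * (1 + A) := by
    have e1 := (abs_le.1 h2).2
    have e2 := (abs_le.1 h3).2
    nlinarith
  have mS : MeasurableSet {x : ℝ | |x - x0| < ε} := measurableSet_lt (by fun_prop) (by fun_prop)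
  have h5 : ∀ x, ‖G (b * n * (x - x0))‖ ≤ {x : ℝ | |x - x0| < ε}.indicator (fun _ => (2 : ℝ)) x := by
    intro x
    by_cases hx : x ∈ {x : ℝ | |x - x0| < ε}
    · rw [indicator_of_mem hx]; exact hG.le_two _
    · rw [indicator_of_notMem hx, hG.supp, norm_zero]
      rw [mem_ofPred_eq, not_lt] at hx
      rw [abs_mul, abs_of_pos (by positivity : 0 < b * n)]
      have : R = b * n * ε := by rw [hε]; field_simp
      rw [this]; gcongr
  calc ∫ x, ‖G (b * n * (x - x0))‖ ∂ν ω ≤ ∫ x, {x : ℝ | |x - x0| < ε}.indicator (fun _ => (2 : ℝ)) x ∂ν ω := by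
        refine integral_mono_of_nonneg (Eventually.of_forall fun x => norm_nonneg _) ?_
          (Eventually.of_forall h5)
        exact (integrable_const _).indicator mS
    _ = (ν ω).real {x | |x - x0| < ε} * 2 := by
        rw [integral_indicator mS, setIntegral_const, smul_eq_mul]
    _ ≤ 2 * ε * (1 + A) * 2 := by gcongr
    _ = _ := by rw [hε]; ring

lemma short_bound (H : SysHyp γ gmax ν h acone C) {x0 : ℝ} (hx0 : GoodPt γ x0) (a : Fin m)
    {G : ℝ → ℂ} {B R : ℝ} (hG : GoodG G B R) {b : ℝ} (hb : 0 < b) {M : ℕ → ℕ}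
    (hM : Tendsto (fun n : ℕ => (M n : ℝ) / n) atTop (𝓝 0)) {ε : ℝ} (hε : 0 < ε) :
    ∀ᶠ n : ℕ in atTop, ∀ ω, ∑ j ∈ Finset.Ico 1 (M n), ∫ x, ‖G (b * n * (x - x0))‖ *
      ‖G (b * n * (randComp (fun i => lsv (γ i)) ω j x - x0))‖ ∂ν ω ≤ ε / n := by
  obtain ⟨K, hK, r0, hr0, hret⟩ := H.ret_bound hx0.mem
  have hR0 := hG.R0
  set Q := 4 * K * (R / b) with hQ
  have hQ0 : 0 < Q := by positivity
  obtain ⟨s, hs⟩ := summable_iff_vanishing_norm.1 (summable_sqrt_rho H.g0 H.g1) (ε / (2 * Q)) (by positivity)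
  set J := s.sup id + 2 with hJ
  obtain ⟨r1, hr1, hnr⟩ := hx0.noReturn' H.hγ a J
  have hev : ∀ᶠ n : ℕ in atTop, R / b / n ≤ min r0 r1 :=
    ((tendsto_const_div_atTop_nhds_zero_nat (R / b)).eventually_le_const (lt_min hr0 hr1))
  have hev2 : ∀ᶠ n : ℕ in atTop, Q * (R / b) * ((M n : ℝ) / n) ≤ ε / 2 := by
    have : Tendsto (fun n : ℕ => Q * (R / b) * ((M n : ℝ) / n)) atTop (𝓝 (Q * (R / b) * 0)) :=
      hM.const_mul _
    rw [mul_zero] at this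
    exact this.eventually_le_const (by positivity)
  filter_upwards [hev, hev2, eventually_ge_atTop 1] with n h1 h2 hn ω
  have hn' : (0 : ℝ) < n := by exact_mod_cast hn
  have := H.prob ω
  set r := R / b / n with hr
  have hrp : 0 < r := by positivity
  have hsupp : ∀ x, r < |x - x0| → G (b * n * (x - x0)) = 0 := by
    intro x hx
    apply hG.supp
    rw [abs_mul, abs_of_pos (by positivity : 0 < b * n)]
    have : R = b * n * r := by rw [hr]; field_simp
    rw [this]; gcongr
  set f : ℕ → ℝ := fun j => if J ≤ j then √(rho gmax j) else 0 with hf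
  have hterm : ∀ j ∈ Finset.Ico 1 (M n), ∫ x, ‖G (b * n * (x - x0))‖ *
      ‖G (b * n * (randComp (fun i => lsv (γ i)) ω j x - x0))‖ ∂ν ω ≤ 4 * K * r * (r + f j) := by
    intro j hj
    rw [Finset.mem_Ico] at hj
    by_cases hjJ : J ≤ j
    · simp only [hf, hjJ, if_true]
      have h3 := hret r hrp (h1.trans (min_le_left _ _)) ω j (by omega)
      set S := {x | |x - x0| ≤ r ∧ |randComp (fun i => lsv (γ i)) ω j x - x0| ≤ r} with hS
      have mT := randComp_measurable γ ω j
      have mS : MeasurableSet S :=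
        (measurableSet_le (f := fun x : ℝ => |x - x0|) (g := fun _ => r)
          (by fun_prop) (by fun_prop)).inter
          (measurableSet_le (f := fun x : ℝ => |randComp (fun i => lsv (γ i)) ω j x - x0|)
            (g := fun _ => r) (by fun_prop) (by fun_prop))
      have h5 : ∀ x, ‖G (b * n * (x - x0))‖ *
          ‖G (b * n * (randComp (fun i => lsv (γ i)) ω j x - x0))‖ ≤ S.indicator (fun _ => (4 : ℝ)) x := by
        intro x
        by_cases hx : x ∈ S
        · rw [indicator_of_mem hx]
          have e1 := hG.le_two (b * n * (x - x0))
          have e2 := hG.le_two (b * n * (randComp (fun i => lsv (γ i)) ω j x - x0))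
          nlinarith [norm_nonneg (G (b * n * (x - x0))), norm_nonneg (G (b * n * (randComp (fun i => lsv (γ i)) ω j x - x0)))]
        · rw [indicator_of_notMem hx]
          rw [hS, mem_ofPred_eq, not_and_or, not_le, not_le] at hx
          rcases hx with hx | hx <;> simp [hsupp _ hx]
      calc _ ≤ ∫ x, S.indicator (fun _ => (4 : ℝ)) x ∂ν ω := by
            refine integral_mono_of_nonneg (Eventually.of_forall fun x => by positivity) ?_
              (Eventually.of_forall h5)
            exact (integrable_const _).indicator mS
        _ = (ν ω).real S * 4 := by
            rw [integral_indicator mS, setIntegral_const, smul_eq_mul]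
        _ ≤ K * r * (r + √(rho gmax j)) * 4 := by gcongr
        _ = _ := by ring
    · simp only [hf, hjJ, if_false]
      have : ∀ x, ‖G (b * n * (x - x0))‖ *
          ‖G (b * n * (randComp (fun i => lsv (γ i)) ω j x - x0))‖ = 0 := by
        intro x
        by_cases hx : |x - x0| ≤ r
        · have hr1' := h1.trans (min_le_right _ _)
          have := hnr j hj.1 (by omega) ω x (hx.trans hr1')
          simp [hsupp _ (hr1'.trans_lt this)]
        · simp [hsupp _ (not_le.1 hx)]
      simp only [this, integral_zero]
      positivity
  have hfs : ∑ j ∈ Finset.Ico 1 (M n), f j ≤ ε / (2 * Q) := by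
    rw [hf, ← Finset.sum_filter]
    refine (le_abs_self _).trans (hs _ ?_).le
    rw [Finset.disjoint_left]
    intro j hj hjs
    rw [Finset.mem_filter] at hj
    have : j ≤ s.sup id := Finset.le_sup (f := id) hjs
    omega
  calc _ ≤ ∑ j ∈ Finset.Ico 1 (M n), 4 * K * r * (r + f j) := Finset.sum_le_sum hterm
    _ = 4 * K * r * (((M n - 1 : ℕ) : ℝ) * r + ∑ j ∈ Finset.Ico 1 (M n), f j) := by
        rw [← Finset.mul_sum, Finset.sum_add_distrib]; simp
    _ ≤ 4 * K * r * ((M n : ℝ) * r + ε / (2 * Q)) := by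
        have : ((M n - 1 : ℕ) : ℝ) ≤ M n := by exact_mod_cast Nat.sub_le _ _
        gcongr
    _ = (Q * (R / b) * ((M n : ℝ) / n) + ε / 2) / n := by
        rw [hr, hQ]; field_simp
    _ ≤ (ε / 2 + ε / 2) / n := by gcongr
    _ = _ := by ring

lemma sum_limit (H : SysHyp γ gmax ν h acone C) {x0 : ℝ} (hx0 : x0 ∈ Ioo (0 : ℝ) 1)
    {G : ℝ → ℂ} {B R : ℝ} (hG : GoodG G B R) {b : ℝ} (hb : 0 < b) {ω : Om m}
    (hω : Tendsto (fun n : ℕ => (∑ k ∈ Finset.range n, h (shift^[k] ω) x0) / n) atTop (𝓝 (b / 2))) :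
    Tendsto (fun n : ℕ => ∑ k ∈ Finset.range n, ∫ x, G (b * n * (x - x0)) ∂ν (shift^[k] ω))
      atTop (𝓝 (1 / 2 * ∫ y, G y)) := by
  have hI := hG.integrable
  have hlim : Tendsto (fun n : ℕ => (((∑ k ∈ Finset.range n, h (shift^[k] ω) x0) / n : ℝ) : ℂ) *
      ((b⁻¹ : ℝ) * ∫ y, G y)) atTop (𝓝 (1 / 2 * ∫ y, G y)) := by
    have := ((Complex.continuous_ofReal.tendsto _).comp hω).mul_const ((b⁻¹ : ℝ) * ∫ y, G y)
    have hb' : (b : ℂ) ≠ 0 := by exact_mod_cast hb.ne'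
    have e : ((b / 2 : ℝ) : ℂ) * ((b⁻¹ : ℝ) * ∫ y, G y) = 1 / 2 * ∫ y, G y := by
      push_cast; field_simp
    rw [e] at this
    exact this
  have hdiff : Tendsto (fun n : ℕ => ∑ k ∈ Finset.range n, ∫ x, G (b * n * (x - x0)) ∂ν (shift^[k] ω)
      - (((∑ k ∈ Finset.range n, h (shift^[k] ω) x0) / n : ℝ) : ℂ) *
      ((b⁻¹ : ℝ) * ∫ y, G y)) atTop (𝓝 0) := by
    rw [NormedAddGroup.tendsto_nhds_zero]
    intro ε hε
    set L := ∫ y, ‖G y‖ with hL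
    have hL0 : 0 ≤ L := integral_nonneg fun y => norm_nonneg _
    set η := ε * b / (2 * (L + 1)) with hη
    obtain ⟨δ, hδ, hloc⟩ := H.local_int hx0 (η := η) (by positivity)
    have hev : ∀ᶠ n : ℕ in atTop, R / b / n ≤ δ :=
      ((tendsto_const_div_atTop_nhds_zero_nat (R / b)).eventually_le_const hδ)
    filter_upwards [hev, eventually_ge_atTop 1] with n h1 hn
    have hn' : (0 : ℝ) < n := by exact_mod_cast hn
    have hs : 0 < b * n := by positivity
    have h2 : ∀ k, ‖∫ x, G (b * n * (x - x0)) ∂ν (shift^[k] ω) -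
        h (shift^[k] ω) x0 * (((b * n)⁻¹ : ℝ) * ∫ y, G y)‖ ≤ η * ((b * n)⁻¹ * L) := by
      intro k
      have := hloc (shift^[k] ω) (fun x => G (b * n * (x - x0))) (integrable_scale hI hs x0) ?_
      · rw [integral_scale G hs x0, integral_scale (fun y => ‖G y‖) hs x0, Complex.real_smul,
          smul_eq_mul] at this
        exact this
      · intro x hx
        apply hG.supp
        rw [abs_mul, abs_of_pos hs]
        rw [div_div, div_le_iff₀ hs] at h1
        nlinarith
    have e : (((∑ k ∈ Finset.range n, h (shift^[k] ω) x0) / n : ℝ) : ℂ) * ((b⁻¹ : ℝ) * ∫ y, G y) =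
        ∑ k ∈ Finset.range n, (h (shift^[k] ω) x0 * (((b * n)⁻¹ : ℝ) * ∫ y, G y) : ℂ) := by
      rw [← Finset.sum_mul]; push_cast; rw [mul_inv]; ring
    rw [e, ← Finset.sum_sub_distrib]
    calc _ ≤ ∑ k ∈ Finset.range n, η * ((b * n)⁻¹ * L) :=
          norm_sum_le_of_le _ fun k _ => h2 k
      _ = η * L / b := by simp; field_simp
      _ = ε / 2 * (L / (L + 1)) := by rw [hη]; field_simp
      _ ≤ ε / 2 * 1 := by
          gcongr; rw [div_le_one (by positivity)]; linarith
      _ < ε := by linarith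
  have := hdiff.add hlim
  simpa using this

theorem main_limit (H : SysHyp γ gmax ν h acone C) {x0 : ℝ} (hx0 : GoodPt γ x0) (a : Fin m)
    {G : ℝ → ℂ} {B R : ℝ} (hG : GoodG G B R) {b : ℝ} (hb : 0 < b) {ω : Om m}
    (hω : Tendsto (fun n : ℕ => (∑ k ∈ Finset.range n, h (shift^[k] ω) x0) / n) atTop (𝓝 (b / 2))) :
    Tendsto (fun n : ℕ => ∫ x, ∏ j ∈ Finset.range n,
      (1 + G (b * n * (randComp (fun i => lsv (γ i)) ω j x - x0))) ∂ν ω)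
      atTop (𝓝 (Complex.exp (1 / 2 * ∫ y, G y))) := by
  obtain ⟨K, hK, hκ⟩ := H.kappa_bound hx0.mem hG hb
  obtain ⟨M, hM2, hM, hMr⟩ := exists_gap H.g0 H.g1
  have hprob := H.prob
  have hC0 := H.C0
  have hB0 := hG.B0
  obtain ⟨N0, hN0⟩ := eventually_atTop.1 hκ
  have hgcont : ∀ n : ℕ, Continuous (fun x => G (b * n * (x - x0))) := fun n =>
    hG.cont.comp (by fun_prop)
  have hlim : Tendsto (fun n : ℕ => ∏ k ∈ Finset.range n,
      (1 + ∫ x, G (b * n * (x - x0)) ∂ν (shift^[k] ω))) atTop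
      (𝓝 (Complex.exp (1 / 2 * ∫ y, G y))) := by
    refine prod_tendsto_exp (fun n k => ∫ x, G (b * n * (x - x0)) ∂ν (shift^[k] ω))
      (K + 2 * N0) ?_ ?_ (H.sum_limit hx0.mem hG hb hω)
    · intro n k
      by_cases hn : N0 ≤ n
      · have h1 := (norm_integral_le_integral_norm _).trans (hN0 n hn (shift^[k] ω))
        rcases Nat.eq_zero_or_pos n with rfl | hn0
        · simp; positivity
        · have hn' : (0 : ℝ) < n := by exact_mod_cast hn0
          rw [le_div_iff₀ hn'] at h1
          have : (0 : ℝ) ≤ 2 * N0 := by positivity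
          linarith
      · have h1 : ‖∫ x, G (b * n * (x - x0)) ∂ν (shift^[k] ω)‖ ≤ 2 := by
          have := norm_integral_le_of_norm_le_const (μ := ν (shift^[k] ω))
            (f := fun x => G (b * n * (x - x0))) (Eventually.of_forall fun x => hG.le_two _)
          simpa using this
        have h2 : (n : ℝ) ≤ N0 := by exact_mod_cast (not_le.1 hn).le
        calc _ ≤ 2 * (N0 : ℝ) := by gcongr
          _ ≤ _ := by linarith
    · intro n k
      have hint : Integrable (fun x => G (b * n * (x - x0))) (ν (shift^[k] ω)) :=
        Integrable.of_bound (hgcont n).aestronglyMeasurable 2 (Eventually.of_forall fun x => hG.le_two _)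
      have e : 1 + ∫ x, G (b * n * (x - x0)) ∂ν (shift^[k] ω) =
          ∫ x, (1 + G (b * n * (x - x0))) ∂ν (shift^[k] ω) := by
        rw [integral_add (integrable_const _) hint]; simp
      rw [e]
      have := norm_integral_le_of_norm_le_const (μ := ν (shift^[k] ω))
            (f := fun x => 1 + G (b * n * (x - x0))) (Eventually.of_forall fun x => hG.one _)
      simpa using this
  have hdiff : Tendsto (fun n : ℕ => ∫ x, ∏ j ∈ Finset.range n,
      (1 + G (b * n * (randComp (fun i => lsv (γ i)) ω j x - x0))) ∂ν ω -
      ∏ k ∈ Finset.range n, (1 + ∫ x, G (b * n * (x - x0)) ∂ν (shift^[k] ω))) atTop (𝓝 0) := by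
    rw [NormedAddGroup.tendsto_nhds_zero]
    intro ε hε
    have hE : Tendsto (fun n : ℕ => 2 * C * (2 + B * b) * ((n : ℝ) ^ 2 * rho gmax (M n)) +
        K ^ 2 * ((M n : ℝ) / n)) atTop (𝓝 (2 * C * (2 + B * b) * 0 + K ^ 2 * 0)) :=
      (hMr.const_mul _).add (hM.const_mul _)
    simp only [mul_zero, add_zero] at hE
    filter_upwards [hκ, H.short_bound hx0 a hG hb hM (half_pos hε), eventually_ge_atTop 1,
      hE.eventually_lt_const (half_pos hε)] with n h1 h2 hn h3
    have hn' : (0 : ℝ) < n := by exact_mod_cast hn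
    have hn1 : (1 : ℝ) ≤ n := by exact_mod_cast hn
    have hs : 0 ≤ b * n := by positivity
    have h4 := H.decouple (g := fun x => G (b * n * (x - x0))) (D := 2 + B * (b * n))
      (M := M n) (κ := K / n) (S := ε / 2 / n)
      (hG.re.comp (by fun_prop)) (hG.im.comp (by fun_prop))
      (hG.C1 hG.re hG.dre (fun x => (Complex.abs_re_le_norm _).trans (hG.le_two _)) hs x0)
      (hG.C1 hG.im hG.dim (fun x => (Complex.abs_im_le_norm _).trans (hG.le_two _)) hs x0)
      (hgcont n) (fun x => hG.one _) (hM2 n) h1 h2 n ω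
    refine h4.trans_lt ?_
    have hr := rho_nonneg gmax (M n)
    calc (n : ℝ) * (ε / 2 / n + 2 * C * (2 + B * (b * n)) * rho gmax (M n) + (K / n) ^ 2 * M n)
        ≤ (n : ℝ) * (ε / 2 / n + 2 * C * ((2 + B * b) * n) * rho gmax (M n) + (K / n) ^ 2 * M n) := by
          gcongr; nlinarith
      _ = ε / 2 + (2 * C * (2 + B * b) * ((n : ℝ) ^ 2 * rho gmax (M n)) + K ^ 2 * ((M n : ℝ) / n)) := by
          field_simp; ring
      _ < ε := by linarith
  simpa using hdiff.add hlim

end SysHyp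

end

section
/-- the jump functional -/
def Gst (α t y : ℝ) : ℂ := Complex.exp (Complex.I * ((t * |y| ^ (-α⁻¹) : ℝ) : ℂ)) - 1

lemma Gst_le (α t y : ℝ) : ‖Gst α t y‖ ≤ |t| * |y| ^ (-α⁻¹) := by
  refine (Real.norm_exp_I_mul_ofReal_sub_one_le).trans ?_
  rw [Real.norm_eq_abs, abs_mul, abs_of_nonneg (Real.rpow_nonneg (abs_nonneg y) _)]

lemma Gst_one (α t y : ℝ) : ‖1 + Gst α t y‖ = 1 := by
  have : 1 + Gst α t y = Complex.exp (Complex.I * ((t * |y| ^ (-α⁻¹) : ℝ) : ℂ)) := by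
    simp [Gst]
  rw [this, mul_comm, Complex.norm_exp_ofReal_mul_I]

lemma Gst_two (α t y : ℝ) : ‖Gst α t y‖ ≤ 2 := by
  have : Gst α t y = (1 + Gst α t y) - 1 := by ring
  rw [this]
  refine (norm_sub_le _ _).trans ?_
  rw [Gst_one, norm_one]; norm_num

lemma Gst_meas (α t : ℝ) : Measurable (Gst α t) := by
  unfold Gst; fun_prop

lemma Gst_dom {α : ℝ} (hα : 0 < α) (t y : ℝ) :
    ‖Gst α t y‖ ≤ (2 + |t|) * 2 ^ α⁻¹ * (1 + ‖y‖) ^ (-α⁻¹) := by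
  have hi : 0 < α⁻¹ := inv_pos.2 hα
  have h2 : (2 : ℝ) ^ α⁻¹ * (1 + ‖y‖) ^ (-α⁻¹) = ((1 + ‖y‖) / 2) ^ (-α⁻¹) := by
    rw [Real.div_rpow (by positivity) (by norm_num), Real.rpow_neg (by norm_num : (0:ℝ) ≤ 2),
      div_inv_eq_mul, mul_comm]
  rw [mul_assoc, h2]
  rcases le_or_gt |y| 1 with h | h
  · have h3 : 1 ≤ ((1 + ‖y‖) / 2) ^ (-α⁻¹) := by
      apply Real.one_le_rpow_of_pos_of_le_one_of_nonpos (by positivity) _ (by linarith)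
      rw [Real.norm_eq_abs]; linarith
    calc _ ≤ (2 : ℝ) * 1 := by linarith [Gst_two α t y]
      _ ≤ (2 + |t|) * ((1 + ‖y‖) / 2) ^ (-α⁻¹) := by
        gcongr; linarith [abs_nonneg t]
  · have h3 : |y| ^ (-α⁻¹) ≤ ((1 + ‖y‖) / 2) ^ (-α⁻¹) :=
      Real.rpow_le_rpow_of_nonpos (by positivity) (by rw [Real.norm_eq_abs]; linarith)
        (by linarith)
    calc _ ≤ |t| * |y| ^ (-α⁻¹) := Gst_le _ _ _
      _ ≤ (2 + |t|) * ((1 + ‖y‖) / 2) ^ (-α⁻¹) := by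
        gcongr; linarith

lemma dom_integrable {α : ℝ} (hα : α ∈ Ioo (0 : ℝ) 1) (K : ℝ) :
    Integrable (fun y : ℝ => K * (1 + ‖y‖) ^ (-α⁻¹)) := by
  refine (integrable_one_add_norm ?_).const_mul _
  simp only [Module.finrank_self, Nat.cast_one]
  exact (one_lt_inv₀ hα.1).2 hα.2

lemma Gst_integrable {α : ℝ} (hα : α ∈ Ioo (0 : ℝ) 1) (t : ℝ) : Integrable (Gst α t) :=
  (dom_integrable hα _).mono' (Gst_meas α t).aestronglyMeasurable
    (Eventually.of_forall (Gst_dom hα.1 t))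

lemma Gst_cont0 {α : ℝ} (hα : α ∈ Ioo (0 : ℝ) 1) :
    ContinuousAt (fun t => Complex.exp (1 / 2 * ∫ y, Gst α t y)) 0 := by
  have : ContinuousAt (fun t => ∫ y, Gst α t y) 0 := by
    refine continuousAt_of_dominated (bound := fun y => (2 + 1) * 2 ^ α⁻¹ * (1 + ‖y‖) ^ (-α⁻¹))
      (Eventually.of_forall fun t => (Gst_meas α t).aestronglyMeasurable) ?_
      (dom_integrable hα _) (Eventually.of_forall fun y => ?_)
    · filter_upwards [Metric.ball_mem_nhds (0 : ℝ) one_pos] with t ht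
      refine Eventually.of_forall fun y => (Gst_dom hα.1 t y).trans ?_
      have : |t| ≤ 1 := by simpa using (mem_ball_zero_iff.1 ht).le
      gcongr
    · unfold Gst
      fun_prop
  exact Complex.continuous_exp.continuousAt.comp (continuousAt_const.mul this)

lemma cutoff_good {α : ℝ} (t : ℝ) {χ : ℝ → ℝ} {r R : ℝ} (hr : 0 < r) (hR : 0 < R)
    (hχ : ContDiff ℝ 1 χ) (h01 : ∀ y, 0 ≤ χ y ∧ χ y ≤ 1) (h0 : ∀ y, |y| ≤ r → χ y = 0)
    (hinf : ∀ y, R ≤ |y| → χ y = 0) : ∃ B, GoodG (fun y => χ y * Gst α t y) B R := by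
  have hpow : ∀ y : ℝ, y ≠ 0 → ContDiffAt ℝ 1 (fun y : ℝ => t * |y| ^ (-α⁻¹)) y := by
    intro y hy
    exact contDiffAt_const.mul ((contDiffAt_abs hy).rpow_const_of_ne (abs_ne_zero.2 hy))
  have key : ∀ f : ℝ → ℝ, ContDiff ℝ 1 f →
      ContDiff ℝ 1 (fun y => χ y * (f (t * |y| ^ (-α⁻¹)))) ∧
        ∃ B, ∀ y, |deriv (fun y => χ y * (f (t * |y| ^ (-α⁻¹)))) y| ≤ B := by
    intro f hf
    have h1 : ContDiff ℝ 1 (fun y => χ y * (f (t * |y| ^ (-α⁻¹)))) := by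
      rw [contDiff_iff_contDiffAt]
      intro y
      by_cases hy : y = 0
      · subst hy
        refine (contDiffAt_const (c := (0 : ℝ))).congr_of_eventuallyEq ?_
        filter_upwards [Metric.ball_mem_nhds (0 : ℝ) hr] with z hz
        rw [h0 z (by simpa using (mem_ball_zero_iff.1 hz).le), zero_mul]
      · exact hχ.contDiffAt.mul (hf.contDiffAt.comp y (hpow y hy))
    refine ⟨h1, ?_⟩
    have hcs : HasCompactSupport (fun y => χ y * (f (t * |y| ^ (-α⁻¹)))) := by
      refine HasCompactSupport.intro (isCompact_closedBall (0 : ℝ) R) fun x hx => ?_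
      simp only [Metric.mem_closedBall, dist_zero_right, Real.norm_eq_abs, not_le] at hx
      rw [hinf x hx.le, zero_mul]
    obtain ⟨B, hB⟩ := hcs.deriv.exists_bound_of_continuous (h1.continuous_deriv le_rfl)
    exact ⟨B, hB⟩
  have ere : (fun y => ((χ y * Gst α t y : ℂ)).re) =
      fun y => χ y * (Real.cos (t * |y| ^ (-α⁻¹)) - 1) := by
    ext y
    rw [Complex.re_ofReal_mul, Gst, mul_comm Complex.I, Complex.sub_re, Complex.exp_ofReal_mul_I_re,
      Complex.one_re]
  have eim : (fun y => ((χ y * Gst α t y : ℂ)).im) =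
      fun y => χ y * (Real.sin (t * |y| ^ (-α⁻¹))) := by
    ext y
    rw [Complex.im_ofReal_mul, Gst, mul_comm Complex.I, Complex.sub_im, Complex.exp_ofReal_mul_I_im,
      Complex.one_im, sub_zero]
  obtain ⟨c1, B1, hB1⟩ := key (fun x => Real.cos x - 1) (by fun_prop)
  obtain ⟨c2, B2, hB2⟩ := key (fun x => Real.sin x) (by fun_prop)
  refine ⟨max (max B1 B2) 0, ?_, ?_, ?_, ?_, le_max_right _ _, hR, ?_, ?_⟩
  · rw [ere]; exact c1
  · rw [eim]; exact c2
  · rw [ere]; exact fun x => (hB1 x).trans ((le_max_left _ _).trans (le_max_left _ _))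
  · rw [eim]; exact fun x => (hB2 x).trans ((le_max_right _ _).trans (le_max_left _ _))
  · intro x hx; simp [hinf x hx]
  · intro x
    have e : (1 : ℂ) + χ x * Gst α t x = ((1 - χ x : ℝ) : ℂ) + ((χ x : ℝ) : ℂ) * (1 + Gst α t x) := by
      push_cast; ring
    rw [e]
    refine (norm_add_le _ _).trans ?_
    rw [norm_mul, Gst_one, Complex.norm_real, Complex.norm_real, Real.norm_of_nonneg (h01 x).1,
      Real.norm_of_nonneg (by linarith [(h01 x).2])]
    linarith

lemma exists_approx {α : ℝ} (hα : α ∈ Ioo (0 : ℝ) 1) (t : ℝ) {ε : ℝ} (hε : 0 < ε) :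
    ∃ (G : ℝ → ℂ) (B R : ℝ), GoodG G B R ∧ (∀ y, ‖Gst α t y - G y‖ ≤ ‖Gst α t y‖) ∧
      ∫ y, ‖Gst α t y - G y‖ ≤ ε := by
  obtain ⟨f, Bf, hf, hf01, -, -, hfo, hfi⟩ := exists_bump
  set χ : ℕ → ℝ → ℝ := fun L y => f (((L : ℝ) + 1)⁻¹ * y) * (1 - f (((L : ℝ) + 1) * y)) with hχ
  have h01 : ∀ L y, 0 ≤ χ L y ∧ χ L y ≤ 1 := fun L y => by
    have h1 := hf01 (((L : ℝ) + 1)⁻¹ * y)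
    have h2 := hf01 (((L : ℝ) + 1) * y)
    exact ⟨mul_nonneg h1.1 (by linarith), by simp only [hχ]; nlinarith⟩
  have hgood : ∀ L : ℕ, ∃ B, GoodG (fun y => χ L y * Gst α t y) B ((L : ℝ) + 2) := by
    intro L
    have hL : (0 : ℝ) < (L : ℝ) + 1 := by positivity
    refine cutoff_good t (r := (1 / 2) * ((L : ℝ) + 1)⁻¹) (by positivity) (by positivity) ?_ (h01 L) ?_ ?_
    · have h1 : ContDiff ℝ 1 (fun y : ℝ => f (((L : ℝ) + 1)⁻¹ * y)) := hf.comp (by fun_prop)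
      have h2 : ContDiff ℝ 1 (fun y : ℝ => f (((L : ℝ) + 1) * y)) := hf.comp (by fun_prop)
      exact h1.mul (contDiff_const.sub h2)
    · intro y hy
      simp only [hχ]
      rw [hfi (((L : ℝ) + 1) * y), sub_self, mul_zero]
      rw [mem_Icc, ← abs_le, abs_mul, abs_of_pos hL]
      calc ((L : ℝ) + 1) * |y| ≤ ((L : ℝ) + 1) * ((1 / 2) * ((L : ℝ) + 1)⁻¹) := by gcongr
        _ = 1 / 2 := by field_simp
    · intro y hy
      simp only [hχ]
      rw [hfo (((L : ℝ) + 1)⁻¹ * y), zero_mul]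
      rw [mem_Icc, ← abs_le, abs_mul, abs_of_pos (inv_pos.2 hL), not_le, inv_mul_eq_div, lt_div_iff₀ hL]
      linarith
  have hnorm : ∀ L y, ‖Gst α t y - χ L y * Gst α t y‖ ≤ ‖Gst α t y‖ := by
    intro L y
    have : Gst α t y - χ L y * Gst α t y = ((1 - χ L y : ℝ) : ℂ) * Gst α t y := by push_cast; ring
    rw [this, norm_mul, Complex.norm_real, Real.norm_of_nonneg (by linarith [(h01 L y).2])]
    exact mul_le_of_le_one_left (norm_nonneg _) (by linarith [(h01 L y).1])
  have hlim : Tendsto (fun L : ℕ => ∫ y, ‖Gst α t y - χ L y * Gst α t y‖) atTop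
      (𝓝 (∫ y : ℝ, (0 : ℝ))) := by
    refine tendsto_integral_of_dominated_convergence (fun y => ‖Gst α t y‖) ?_
      (Gst_integrable hα t).norm ?_ ?_
    · intro L
      have h1 := Gst_meas α t
      have h2 : Measurable (χ L) := by
        have := hf.continuous.measurable
        simp only [hχ]; fun_prop
      exact (Measurable.norm (by fun_prop)).aestronglyMeasurable
    · intro L
      exact Eventually.of_forall fun y => by rw [norm_norm]; exact hnorm L y
    · have : ∀ᵐ y : ℝ, y ≠ 0 := by simp [ae_iff]
      filter_upwards [this] with y hy
      refine tendsto_const_nhds.congr' ?_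
      have hy' : 0 < |y| := abs_pos.2 hy
      obtain ⟨N1, hN1⟩ := exists_nat_gt (2 * |y|)
      obtain ⟨N2, hN2⟩ := exists_nat_gt (1 / |y|)
      filter_upwards [eventually_ge_atTop N1, eventually_ge_atTop N2] with L h1 h2
      have hL : (0 : ℝ) < (L : ℝ) + 1 := by positivity
      have e1 : (N1 : ℝ) ≤ L := by exact_mod_cast h1
      have e2 : (N2 : ℝ) ≤ L := by exact_mod_cast h2
      have : χ L y = 1 := by
        simp only [hχ]
        rw [hfi, hfo]
        · norm_num
        · rw [mem_Icc, ← abs_le, abs_mul, abs_of_pos hL, not_le]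
          rw [div_lt_iff₀ hy'] at hN2
          nlinarith
        · rw [mem_Icc, ← abs_le, abs_mul, abs_of_pos (inv_pos.2 hL), inv_mul_eq_div, div_le_iff₀ hL]
          linarith
      simp [this]
  rw [integral_zero] at hlim
  obtain ⟨L, hL⟩ := (hlim.eventually_le_const hε).exists
  obtain ⟨B, hB⟩ := hgood L
  exact ⟨_, B, _, hB, hnorm L, hL⟩

lemma prod_sub_prod_norm_le (n : ℕ) (u v : ℕ → ℂ) (hu : ∀ i, ‖u i‖ ≤ 1) (hv : ∀ i, ‖v i‖ ≤ 1) :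
    ‖∏ i ∈ Finset.range n, u i - ∏ i ∈ Finset.range n, v i‖ ≤ ∑ i ∈ Finset.range n, ‖u i - v i‖ := by
  induction n with
  | zero => simp
  | succ n ih =>
    rw [Finset.prod_range_succ, Finset.prod_range_succ, Finset.sum_range_succ]
    have e : (∏ i ∈ Finset.range n, u i) * u n - (∏ i ∈ Finset.range n, v i) * v n =
      (∏ i ∈ Finset.range n, u i - ∏ i ∈ Finset.range n, v i) * u n +
        (∏ i ∈ Finset.range n, v i) * (u n - v n) := by ring
    rw [e]
    refine (norm_add_le _ _).trans (add_le_add ?_ ?_)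
    · rw [norm_mul]
      exact (mul_le_of_le_one_right (norm_nonneg _) (hu n)).trans ih
    · rw [norm_mul, norm_prod]
      exact mul_le_of_le_one_left (norm_nonneg _)
        (Finset.prod_le_one (fun _ _ => norm_nonneg _) (fun i _ => hv i))

namespace SysHyp
variable {m : ℕ} {γ : Fin m → ℝ} {gmax : ℝ} {ν : Om m → Measure ℝ} {h : Om m → ℝ → ℝ}
    {acone C : ℝ}

lemma far_bound (H : SysHyp γ gmax ν h acone C) {x0 : ℝ} (hx0 : x0 ∈ Ioo (0 : ℝ) 1)
    {F : ℝ → ℝ} (mF : Measurable F) (iF : Integrable F) (hF0 : ∀ y, 0 ≤ F y) {α T : ℝ}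
    (hα : 0 < α) (hT : 0 ≤ T) (hF : ∀ y, F y ≤ T * |y| ^ (-α⁻¹)) {s : ℝ} (hs : 0 < s) (ω : Om m) :
    ∫ x, F (s * (x - x0)) ∂ν ω ≤ acone * (x0 / 2) ^ (-gmax) * (s⁻¹ * ∫ y, F y) +
      T * (s * (x0 / 2)) ^ (-α⁻¹) := by
  have hprob := H.prob ω
  set c := x0 / 2 with hc
  have hc0 : 0 < c := by have := hx0.1; positivity
  set A := acone * c ^ (-gmax) with hA
  have hA0 : 0 < A := mul_pos H.a0 (Real.rpow_pos_of_pos hc0 _)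
  set Fs : ℝ → ℝ := fun x => F (s * (x - x0)) with hFs
  have mFs : Measurable Fs := by simp only [hFs]; fun_prop
  have iFs : Integrable Fs := integrable_scale iF hs x0
  have iA : Integrable Fs (ENNReal.ofReal A • volume) := iFs.smul_measure ENNReal.ofReal_ne_top
  have hle := H.le_vol hc0 ω
  have iR : Integrable Fs ((ν ω).restrict (Ici c)) := iA.mono_measure hle
  have h1 : ∫ x in Ici c, Fs x ∂ν ω ≤ A * (s⁻¹ * ∫ y, F y) := by
    calc ∫ x in Ici c, Fs x ∂ν ω ≤ ∫ x, Fs x ∂(ENNReal.ofReal A • volume) :=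
          integral_mono_measure hle (Eventually.of_forall fun x => hF0 _) iA
      _ = A * (s⁻¹ * ∫ y, F y) := by
          rw [integral_smul_measure, ENNReal.toReal_ofReal hA0.le, smul_eq_mul,
            integral_scale F hs x0, smul_eq_mul]
  have hpt : ∀ x, Fs x ≤ (Ici c).indicator Fs x + T * (s * c) ^ (-α⁻¹) := by
    intro x
    by_cases hx : x ∈ Ici c
    · rw [indicator_of_mem hx]
      have : 0 ≤ T * (s * c) ^ (-α⁻¹) := by positivity
      linarith
    · rw [indicator_of_notMem hx, zero_add]
      refine (hF _).trans ?_
      gcongr ?_ * ?_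
      rw [mem_Ici, not_le] at hx
      refine Real.rpow_le_rpow_of_nonpos (by positivity) ?_ (by have := inv_pos.2 hα; linarith)
      rw [abs_mul, abs_of_pos hs]
      gcongr
      rw [le_abs]; right; linarith
  calc ∫ x, Fs x ∂ν ω ≤ ∫ x, ((Ici c).indicator Fs x + T * (s * c) ^ (-α⁻¹)) ∂ν ω := by
        refine integral_mono_of_nonneg (Eventually.of_forall fun x => hF0 _) ?_
          (Eventually.of_forall hpt)
        exact ((integrable_indicator_iff measurableSet_Ici).2 iR).add (integrable_const _)
    _ = ∫ x in Ici c, Fs x ∂ν ω + T * (s * c) ^ (-α⁻¹) := by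
        rw [integral_add ((integrable_indicator_iff measurableSet_Ici).2 iR) (integrable_const _),
          integral_indicator measurableSet_Ici]
        simp
    _ ≤ _ := by gcongr

theorem stable_limit (H : SysHyp γ gmax ν h acone C) {x0 : ℝ} (hx0 : GoodPt γ x0) (a : Fin m)
    {b : ℝ} (hb : 0 < b) {ω : Om m}
    (hω : Tendsto (fun n : ℕ => (∑ k ∈ Finset.range n, h (shift^[k] ω) x0) / n) atTop (𝓝 (b / 2)))
    {α : ℝ} (hα : α ∈ Ioo (0 : ℝ) 1) (t : ℝ) :
    Tendsto (fun n : ℕ => ∫ x, ∏ j ∈ Finset.range n,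
      (1 + Gst α t (b * n * (randComp (fun i => lsv (γ i)) ω j x - x0))) ∂ν ω)
      atTop (𝓝 (Complex.exp (1 / 2 * ∫ y, Gst α t y))) := by
  have hprob := H.prob
  set c := x0 / 2 with hc
  have hc0 : 0 < c := by have := hx0.mem.1; positivity
  set A := acone * c ^ (-gmax) with hA
  have hA0 : 0 < A := mul_pos H.a0 (Real.rpow_pos_of_pos hc0 _)
  have hi : 1 < α⁻¹ := (one_lt_inv₀ hα.1).2 hα.2
  rw [Metric.tendsto_atTop']
  intro ε hε
  obtain ⟨δ, hδ, hexp⟩ := Metric.continuousAt_iff.1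
    (Complex.continuous_exp.continuousAt (x := 1 / 2 * ∫ y, Gst α t y)) (ε / 4) (by positivity)
  obtain ⟨G, B, R, hG, hGle, hGint⟩ := exists_approx hα t (ε := min δ (b * ε / (4 * A)))
    (lt_min hδ (by positivity))
  have hmain := H.main_limit hx0 a hG hb hω
  have iD : Integrable (fun y => Gst α t y - G y) := (Gst_integrable hα t).sub hG.integrable
  have hexp' : dist (Complex.exp (1 / 2 * ∫ y, G y)) (Complex.exp (1 / 2 * ∫ y, Gst α t y)) < ε / 4 := by
    apply hexp
    rw [dist_comm, dist_eq_norm, ← mul_sub, ← integral_sub (Gst_integrable hα t) hG.integrable, norm_mul]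
    have h1 := (norm_integral_le_integral_norm (fun y => Gst α t y - G y)).trans
      (hGint.trans (min_le_left _ _))
    have h2 : ‖(1 / 2 : ℂ)‖ = 1 / 2 := by norm_num
    rw [h2]; linarith
  have hfar : Tendsto (fun n : ℕ => |t| * (b * c) ^ (-α⁻¹) * (n : ℝ) ^ (-(α⁻¹ - 1))) atTop
      (𝓝 (|t| * (b * c) ^ (-α⁻¹) * 0)) :=
    ((tendsto_rpow_neg_atTop (by linarith)).comp tendsto_natCast_atTop_atTop).const_mul _
  rw [mul_zero] at hfar
  have hev : ∀ᶠ n : ℕ in atTop, dist (∫ x, ∏ j ∈ Finset.range n,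
      (1 + Gst α t (b * n * (randComp (fun i => lsv (γ i)) ω j x - x0))) ∂ν ω)
      (Complex.exp (1 / 2 * ∫ y, Gst α t y)) < ε := by
    filter_upwards [(Metric.tendsto_atTop.1 hmain (ε / 4) (by positivity)) |> fun ⟨N, hN⟩ =>
      eventually_atTop.2 ⟨N, hN⟩, hfar.eventually_lt_const (by positivity : 0 < ε / 4),
      eventually_ge_atTop 1] with n h1 h2 hn
    have hn' : (0 : ℝ) < n := by exact_mod_cast hn
    have hs : 0 < b * n := by positivity
    have mG := Gst_meas α t
    have mG' := hG.cont.measurable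
    set F : ℝ → ℝ := fun y => ‖Gst α t y - G y‖ with hF
    have mF : Measurable F := by simp only [hF]; fun_prop
    have hF2 : ∀ y, F y ≤ 2 := fun y => (hGle y).trans (Gst_two _ _ _)
    have hint : ∀ G' : ℝ → ℂ, Measurable G' → (∀ y, ‖1 + G' y‖ ≤ 1) → Integrable (fun x =>
        ∏ j ∈ Finset.range n, (1 + G' (b * n * (randComp (fun i => lsv (γ i)) ω j x - x0)))) (ν ω) := by
      intro G' mG' hG'
      refine Integrable.of_bound (C := 1) ?_ (Eventually.of_forall fun x => ?_)
      · refine (Finset.measurable_prod _ fun j _ => ?_).aestronglyMeasurable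
        have := randComp_measurable γ ω j
        fun_prop
      · rw [norm_prod]
        exact Finset.prod_le_one (fun _ _ => norm_nonneg _) (fun i _ => hG' _)
    have hFint : ∀ j, Integrable (fun x => F (b * n * (randComp (fun i => lsv (γ i)) ω j x - x0))) (ν ω) := by
      intro j
      have := randComp_measurable γ ω j
      refine Integrable.of_bound (C := 2) (Measurable.aestronglyMeasurable (by fun_prop)) (Eventually.of_forall fun x => ?_)
      rw [Real.norm_of_nonneg (norm_nonneg _)]; exact hF2 _
    have h3 : dist (∫ x, ∏ j ∈ Finset.range n,
        (1 + Gst α t (b * n * (randComp (fun i => lsv (γ i)) ω j x - x0))) ∂ν ω)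
        (∫ x, ∏ j ∈ Finset.range n,
        (1 + G (b * n * (randComp (fun i => lsv (γ i)) ω j x - x0))) ∂ν ω) ≤ ε / 4 + ε / 4 := by
      rw [dist_eq_norm, ← integral_sub (hint _ mG fun y => (Gst_one _ _ _).le) (hint _ mG' hG.one)]
      calc _ ≤ ∫ x, ∑ j ∈ Finset.range n, F (b * n * (randComp (fun i => lsv (γ i)) ω j x - x0)) ∂ν ω := by
            refine (norm_integral_le_integral_norm _).trans ?_
            refine integral_mono_of_nonneg (Eventually.of_forall fun x => norm_nonneg _)
              (integrable_finsetSum _ fun j _ => hFint j) (Eventually.of_forall fun x => ?_)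
            refine (prod_sub_prod_norm_le n _ _ (fun i => (Gst_one _ _ _).le) (fun i => hG.one _)).trans
              (le_of_eq ?_)
            refine Finset.sum_congr rfl fun j _ => ?_
            simp only [hF]; congr 1; ring
        _ = ∑ j ∈ Finset.range n, ∫ x, F (b * n * (x - x0)) ∂ν (shift^[j] ω) := by
            rw [integral_finsetSum _ fun j _ => hFint j]
            refine Finset.sum_congr rfl fun j _ => ?_
            exact H.integral_comp ω j (F := fun x => F (b * n * (x - x0)))
              (Measurable.stronglyMeasurable (by fun_prop))
        _ ≤ ∑ j ∈ Finset.range n, (A * ((b * n)⁻¹ * ∫ y, F y) + |t| * (b * n * c) ^ (-α⁻¹)) := by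
            refine Finset.sum_le_sum fun j _ => ?_
            exact H.far_bound hx0.mem mF iD.norm (fun y => norm_nonneg _) hα.1 (abs_nonneg t)
              (fun y => (hGle y).trans (Gst_le _ _ _)) hs _
        _ = A * (b⁻¹ * ∫ y, F y) + |t| * (b * c) ^ (-α⁻¹) * (n : ℝ) ^ (-(α⁻¹ - 1)) := by
            have e1 : (b * n * c) ^ (-α⁻¹) = (b * c) ^ (-α⁻¹) * (n : ℝ) ^ (-α⁻¹) := by
              rw [← Real.mul_rpow (by positivity) (by positivity)]; congr 1; ring
            have e2 : (n : ℝ) ^ (-(α⁻¹ - 1)) = (n : ℝ) ^ (-α⁻¹) * n := by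
              rw [show -(α⁻¹ - 1) = -α⁻¹ + 1 by ring, Real.rpow_add hn', Real.rpow_one]
            rw [e1, e2, Finset.sum_const, Finset.card_range, nsmul_eq_mul]
            field_simp
        _ ≤ A * (b⁻¹ * (b * ε / (4 * A))) + ε / 4 := by
            have := hGint.trans (min_le_right _ _)
            gcongr
        _ = ε / 4 + ε / 4 := by field_simp
    have h5 := dist_triangle4 (∫ x, ∏ j ∈ Finset.range n,
        (1 + Gst α t (b * n * (randComp (fun i => lsv (γ i)) ω j x - x0))) ∂ν ω)
        (∫ x, ∏ j ∈ Finset.range n,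
        (1 + G (b * n * (randComp (fun i => lsv (γ i)) ω j x - x0))) ∂ν ω)
        (Complex.exp (1 / 2 * ∫ y, G y)) (Complex.exp (1 / 2 * ∫ y, Gst α t y))
    linarith [h1, hexp', h3]
  obtain ⟨N, hN⟩ := eventually_atTop.1 hev
  exact ⟨N, fun n hn => hN n hn.le⟩

end SysHyp

end

section
lemma Gst_rpow {α : ℝ} (hα : 0 < α) (t : ℝ) {x : ℝ} (hx : 0 < x) :
    Gst α t (x ^ (-α)) = Complex.exp (Complex.I * t * x) - 1 := by
  have : |x ^ (-α)| ^ (-α⁻¹) = x := by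
    rw [abs_of_pos (Real.rpow_pos_of_pos hx _), ← Real.rpow_mul hx.le]
    have : -α * -α⁻¹ = 1 := by field_simp
    rw [this, Real.rpow_one]
  rw [Gst, this]; push_cast; rw [mul_assoc]

lemma Gst_half {α : ℝ} (hα : α ∈ Ioo (0 : ℝ) 1) (t : ℝ) :
    1 / 2 * ∫ y, Gst α t y = ∫ y in Ioi (0 : ℝ), Gst α t y := by
  have hI := Gst_integrable hα t
  have h1 : ∫ y, Gst α t y = (∫ y in Iic (0 : ℝ), Gst α t y) + ∫ y in Ioi (0 : ℝ), Gst α t y := by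
    rw [← setIntegral_union (Iic_disjoint_Ioi le_rfl) measurableSet_Ioi hI.integrableOn hI.integrableOn,
      Iic_union_Ioi, setIntegral_univ]
  have h2 : ∫ y in Iic (0 : ℝ), Gst α t y = ∫ y in Ioi (0 : ℝ), Gst α t y := by
    have := integral_comp_neg_Iic (0 : ℝ) (Gst α t)
    rw [neg_zero] at this
    rw [← this]
    simp [Gst]
  rw [h1, h2]; ring

lemma stable_exponent {α : ℝ} (hα : α ∈ Ioo (0 : ℝ) 1) (t : ℝ) :
    1 / 2 * ∫ y, Gst α t y = Complex.I * t * (α / (1 - α)) +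
      ∫ x in Set.Ioi (0 : ℝ),
        (Complex.exp (Complex.I * t * x) - 1 -
          Complex.I * t * x * (Set.indicator (Set.Icc (0 : ℝ) 1) (fun _ => (1 : ℂ)) x)) *
        ((α * x ^ (-α - 1) : ℝ) : ℂ) := by
  have hα0 := hα.1
  have hα1 := hα.2
  have hne : -α ≠ 0 := by linarith
  have habs : |-α| = α := by rw [abs_neg, abs_of_pos hα0]
  have hcongr : ∀ x ∈ Ioi (0 : ℝ), (|-α| * x ^ (-α - 1)) • Gst α t (x ^ (-α)) =
      (Complex.exp (Complex.I * t * x) - 1) * ((α * x ^ (-α - 1) : ℝ) : ℂ) := by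
    intro x hx
    rw [Gst_rpow hα0 t hx, habs, Complex.real_smul, mul_comm]
  have e1 : ∫ y in Ioi (0 : ℝ), Gst α t y = ∫ x in Ioi (0 : ℝ),
      (Complex.exp (Complex.I * t * x) - 1) * ((α * x ^ (-α - 1) : ℝ) : ℂ) := by
    rw [← integral_comp_rpow_Ioi (Gst α t) hne]
    exact setIntegral_congr_fun measurableSet_Ioi hcongr
  have i1 : IntegrableOn (fun x : ℝ =>
      (Complex.exp (Complex.I * t * x) - 1) * ((α * x ^ (-α - 1) : ℝ) : ℂ)) (Ioi 0) := by
    have := (integrableOn_Ioi_comp_rpow_iff (Gst α t) hne).2 (Gst_integrable hα t).integrableOn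
    exact this.congr_fun hcongr measurableSet_Ioi
  have hpow : ∀ x ∈ Ioc (0 : ℝ) 1, Complex.I * t * x * ((α * x ^ (-α - 1) : ℝ) : ℂ) =
      Complex.I * t * α * ((x ^ (-α) : ℝ) : ℂ) := by
    intro x hx
    have : x ^ (-α) = x * x ^ (-α - 1) := by
      rw [Real.rpow_sub hx.1, Real.rpow_one]; field_simp [hx.1.ne']
    rw [this]; push_cast; ring
  have i3 : IntegrableOn (fun x : ℝ => x ^ (-α)) (Ioc 0 1) := by
    have := intervalIntegral.intervalIntegrable_rpow' (a := 0) (b := 1) (r := -α) (by linarith)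
    exact (intervalIntegrable_iff_integrableOn_Ioc_of_le zero_le_one).1 this
  have v3 : ∫ x in Ioc (0 : ℝ) 1, x ^ (-α) = 1 / (1 - α) := by
    rw [← intervalIntegral.integral_of_le zero_le_one, integral_rpow (Or.inl (by linarith))]
    rw [Real.one_rpow, Real.zero_rpow (by linarith), sub_zero]
    congr 1; ring
  have hind : ∀ x ∈ Ioi (0 : ℝ), (Ioc (0 : ℝ) 1).indicator
      (fun x : ℝ => Complex.I * t * α * ((x ^ (-α) : ℝ) : ℂ)) x =
      Complex.I * t * x * (Set.indicator (Set.Icc (0 : ℝ) 1) (fun _ => (1 : ℂ)) x) *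
        ((α * x ^ (-α - 1) : ℝ) : ℂ) := by
    intro x hx
    by_cases h1 : x ≤ 1
    · have m1 : x ∈ Ioc (0 : ℝ) 1 := ⟨hx, h1⟩
      have m2 : x ∈ Icc (0 : ℝ) 1 := ⟨le_of_lt hx, h1⟩
      rw [indicator_of_mem m1, indicator_of_mem m2, mul_one, hpow x m1]
    · rw [indicator_of_notMem (fun h : x ∈ Ioc (0 : ℝ) 1 => h1 h.2),
        indicator_of_notMem (fun h : x ∈ Icc (0 : ℝ) 1 => h1 h.2)]
      simp
  have i2' : Integrable ((Ioc (0 : ℝ) 1).indicator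
      (fun x : ℝ => Complex.I * t * α * ((x ^ (-α) : ℝ) : ℂ))) := by
    rw [integrable_indicator_iff measurableSet_Ioc]
    exact (Integrable.ofReal i3).const_mul _
  have i2 : IntegrableOn (fun x : ℝ => Complex.I * t * x *
      (Set.indicator (Set.Icc (0 : ℝ) 1) (fun _ => (1 : ℂ)) x) *
        ((α * x ^ (-α - 1) : ℝ) : ℂ)) (Ioi 0) :=
    i2'.integrableOn.congr_fun hind measurableSet_Ioi
  have v2 : ∫ x in Ioi (0 : ℝ), Complex.I * t * x *
      (Set.indicator (Set.Icc (0 : ℝ) 1) (fun _ => (1 : ℂ)) x) *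
        ((α * x ^ (-α - 1) : ℝ) : ℂ) = Complex.I * t * (α / (1 - α)) := by
    have hsub : Ioc (0 : ℝ) 1 ⊆ Ioi 0 := fun x hx => hx.1
    rw [← setIntegral_congr_fun measurableSet_Ioi hind, setIntegral_indicator measurableSet_Ioc,
      inter_eq_right.2 hsub, integral_const_mul,
      integral_complex_ofReal, v3]
    push_cast; ring
  rw [Gst_half hα, e1, ← v2, ← integral_add i2]
  · congr 1; ext x; ring
  · refine (i1.sub i2).congr_fun (fun x _ => ?_) measurableSet_Ioi
    simp only [Pi.sub_apply]; ring

lemma levy {μ : Measure ℝ} [IsProbabilityMeasure μ] {Z : ℕ → ℝ → ℝ} (hZ : ∀ n, Measurable (Z n))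
    {Φ : ℝ → ℂ} (hΦ : ContinuousAt Φ 0)
    (hlim : ∀ t : ℝ, Tendsto (fun n => ∫ x, Complex.exp (Complex.I * t * (Z n x : ℝ)) ∂μ) atTop (𝓝 (Φ t))) :
    ∃ μα : Measure ℝ, IsProbabilityMeasure μα ∧
      (∀ t : ℝ, ∫ x, Complex.exp (Complex.I * t * x) ∂μα = Φ t) ∧
      ∀ f : BoundedContinuousFunction ℝ ℝ,
        Tendsto (fun n => ∫ x, f (Z n x) ∂μ) atTop (𝓝 (∫ y, f y ∂μα)) := by
  have hcf : ∀ (ρ : Measure ℝ) (t : ℝ), charFun ρ t = ∫ x, Complex.exp (Complex.I * t * x) ∂ρ := by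
    intro ρ t
    rw [charFun_apply_real]
    congr 1; ext x; congr 1; ring
  let μn : ℕ → ProbabilityMeasure ℝ := fun n =>
    ⟨μ.map (Z n), Measure.isProbabilityMeasure_map (hZ n).aemeasurable⟩
  have hcn : ∀ n (t : ℝ), charFun (μn n : Measure ℝ) t = ∫ x, Complex.exp (Complex.I * t * (Z n x : ℝ)) ∂μ := by
    intro n t
    rw [hcf]
    exact integral_map (hZ n).aemeasurable (Continuous.aestronglyMeasurable (by fun_prop))
  have hl : ∀ t, Tendsto (fun n => charFun (μn n : Measure ℝ) t) atTop (𝓝 (Φ t)) := by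
    intro t; simp only [hcn]; exact hlim t
  have htight : IsTightMeasureSet (Set.range fun n => (μn n : Measure ℝ)) :=
    isTightMeasureSet_of_tendsto_charFun hΦ hl
  have hcomp : IsCompact (closure (Set.range μn)) := by
    apply isCompact_closure_of_isTightMeasureSet
    convert htight using 1
    ext ρ; simp
  obtain ⟨μ0, -, hμ0⟩ := isCompact_iff_ultrafilter_le_nhds.1 hcomp ((hyperfilter ℕ).map μn) (by
    rw [le_principal_iff]
    exact Filter.univ_mem' (f := (hyperfilter ℕ : Filter ℕ))
      (fun n => subset_closure (mem_range_self n)))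
  have hU : Tendsto μn (hyperfilter ℕ : Filter ℕ) (𝓝 μ0) := hμ0
  have hchar : ∀ t, charFun (μ0 : Measure ℝ) t = Φ t := by
    intro t
    have h1 : Tendsto (fun n => charFun (μn n : Measure ℝ) t) (hyperfilter ℕ : Filter ℕ)
        (𝓝 (charFun (μ0 : Measure ℝ) t)) := by
      rw [ProbabilityMeasure.tendsto_iff_forall_integral_rclike_tendsto ℂ] at hU
      simp_rw [charFun_eq_integral_innerProbChar]
      exact hU (BoundedContinuousFunction.innerProbChar t)
    have h2 := (hl t).mono_left (Nat.hyperfilter_le_atTop)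
    exact tendsto_nhds_unique h1 h2
  have hT : Tendsto μn atTop (𝓝 μ0) := by
    apply ProbabilityMeasure.tendsto_of_tendsto_charFun
    intro t; rw [hchar]; exact hl t
  refine ⟨μ0, inferInstance, fun t => by rw [← hcf, hchar], fun f => ?_⟩
  have := ProbabilityMeasure.tendsto_iff_forall_integral_tendsto.1 hT f
  refine this.congr fun n => ?_
  exact integral_map (hZ n).aemeasurable f.continuous.aestronglyMeasurable

lemma stable_unique {α : ℝ} {μ μ' : Measure ℝ} [IsProbabilityMeasure μ] [IsProbabilityMeasure μ']
    (h1 : IsStableChar α μ) (h2 : IsStableChar α μ') : μ' = μ := by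
  apply Measure.ext_of_charFun
  ext t
  rw [charFun_apply_real, charFun_apply_real]
  have e : ∀ x : ℝ, Complex.exp (t * x * Complex.I) = Complex.exp (Complex.I * t * x) := fun x => by
    congr 1; ring
  simp only [e]
  rw [h1 t, h2 t]

lemma birkhoff_prod {b α : ℝ} (hb : 0 < b) (t x0 : ℝ) (n : ℕ) (y : ℕ → ℝ) :
    Complex.exp (Complex.I * t * ((((b * (n : ℝ)) ^ α⁻¹)⁻¹ *
      ∑ j ∈ Finset.range n, phiObs α x0 (y j) : ℝ) : ℂ)) =
      ∏ j ∈ Finset.range n, (1 + Gst α t (b * n * (y j - x0))) := by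
  have h1 : ∀ j, 1 + Gst α t (b * n * (y j - x0)) = Complex.exp (Complex.I * ((t *
      (((b * (n : ℝ)) ^ α⁻¹)⁻¹ * phiObs α x0 (y j)) : ℝ) : ℂ)) := by
    intro j
    rw [Gst, add_sub_cancel, phiObs, abs_mul, Real.mul_rpow (abs_nonneg _) (abs_nonneg _),
      abs_of_nonneg (by positivity : 0 ≤ b * n), Real.rpow_neg (by positivity : 0 ≤ b * n)]
  simp only [h1]
  rw [← Complex.exp_sum]
  congr 1
  push_cast
  rw [Finset.mul_sum, Finset.mul_sum]
  refine Finset.sum_congr rfl fun j _ => by ring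

end

theorem stmt15 (m : ℕ) (hm : 1 ≤ m)
    (γ : Fin m → ℝ) (hγ : ∀ i, γ i ∈ Set.Ioo (0 : ℝ) 1)
    (gmax : ℝ) (hgmax1 : ∀ i, γ i ≤ gmax) (hgmax2 : ∃ i, γ i = gmax)
    (hgmax3 : gmax < 1 / 3)
    -- `P` is the Bernoulli product measure `(p_1, …, p_m)^{⊗ℤ}`
    (p : Fin m → ℝ) (hp : ∀ i, 0 < p i) (hp1 : ∑ i, p i = 1)
    (P : Measure (Om m)) (hPprob : IsProbabilityMeasure P)
    (hP : ∀ (s : Finset ℤ) (f : ℤ → Fin m),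
      P {ω | ∀ i ∈ s, ω i = f i} = ENNReal.ofReal (∏ i ∈ s, p (f i)))
    -- the quenched measures `ν^ω` with densities `h_ω`
    (ν : Om m → Measure ℝ) (hνprob : ∀ ω, IsProbabilityMeasure (ν ω))
    (h : Om m → ℝ → ℝ) (hmeas : ∀ ω, Measurable (h ω))
    (hdens : ∀ ω, ν ω = mLeb.withDensity (fun x => ENNReal.ofReal (h ω x)))
    -- (i): equivariance
    (hequiv : ∀ ω : Om m, (ν ω).map (lsv (γ (ω 0))) = ν (shift ω))
    -- (ii): the densities lie in the cone `L`
    (acone : ℝ) (hacone : 0 < acone)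
    (hcone : ∀ ω, ContinuousOn (h ω) (Set.Ioc 0 1) ∧ (∀ x, 0 ≤ h ω x) ∧
      AntitoneOn (h ω) (Set.Ioc 0 1) ∧
      MonotoneOn (fun x => x ^ (gmax + 1) * h ω x) (Set.Ioc 0 1) ∧
      ∀ x ∈ Set.Ioc (0 : ℝ) 1, h ω x ≤ acone * x ^ (-gmax))
    (C : ℝ) (hC : 0 < C)
    -- (iii): polynomial pullback approximation of `h_ω`
    (hpull : ∀ (ω : Om m) (n : ℕ), 2 ≤ n →
      tvDist (mLeb.map (randComp (fun i => lsv (γ i)) (shiftInv^[n] ω) n)) (ν ω) ≤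
        C * (n : ℝ) ^ (1 - 1 / gmax) * (Real.log n) ^ (1 / gmax))
    -- (iv): polynomial quenched decay of correlations for `C¹` observables
    (hdec : ∀ g : ℝ → ℝ, ContDiff ℝ 1 g → ∀ (ω : Om m) (N : ℕ), 2 ≤ N →
      (SignedMeasure.totalVariation
        (((ν ω).withDensityᵥ (fun x => g x - ∫ y, g y ∂(ν ω))).map
          (randComp (fun i => lsv (γ i)) ω N)) Set.univ).toReal ≤
        C * C1norm g * (N : ℝ) ^ (1 - 1 / gmax) * (Real.log N) ^ (1 / gmax))
    (α : ℝ) (hα : α ∈ Set.Ioo (0 : ℝ) 1)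
    -- the annealed measure `ν(A) = ∫ ν^ω(A) d𝐏(ω)`
    (νa : Measure ℝ)
    (hνa : ∀ A : Set ℝ, MeasurableSet A → νa A = ∫⁻ ω, ν ω A ∂P) :
    ∀ᵐ x0 ∂mLeb, ∃ b : ℝ, 0 < b ∧
      Tendsto (fun ε : ℝ => (νa {x | |x - x0| < ε}).toReal / ε) (𝓝[>] (0 : ℝ)) (𝓝 b) ∧
      ∀ᵐ ω ∂P, ∃ μα : Measure ℝ, IsProbabilityMeasure μα ∧ IsStableChar α μα ∧
        (∀ μ' : Measure ℝ, IsProbabilityMeasure μ' → IsStableChar α μ' → μ' = μα) ∧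
        -- the laws under `ν^ω` of the normalized Birkhoff sums converge weakly to `μα`
        ∀ f : BoundedContinuousFunction ℝ ℝ,
          Tendsto (fun n : ℕ =>
            ∫ x, f (((b * (n : ℝ)) ^ α⁻¹)⁻¹ *
              ∑ j ∈ Finset.range n,
                phiObs α x0 (randComp (fun i => lsv (γ i)) ω j x)) ∂(ν ω))
            atTop (𝓝 (∫ y, f y ∂μα)) := by
  have g0 : 0 < gmax := by
    obtain ⟨i, hi⟩ := hgmax2
    rw [← hi]; exact (hγ i).1
  have hγ' : ∀ i, 0 < γ i := fun i => (hγ i).1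
  have H : SysHyp γ gmax ν h acone C :=
    { hγ := hγ', g0 := g0, g1 := hgmax3, prob := hνprob, meas := hmeas, dens := hdens,
      equiv := hequiv, a0 := hacone, cone := hcone, C0 := hC, dec := hdec }
  have a : Fin m := ⟨0, hm⟩
  filter_upwards [ae_goodPt hγ' a] with x0 hx0
  obtain ⟨mh, hslln⟩ := H.h_slln hx0.mem hpull p hp hp1 P hPprob hP
  obtain ⟨hb, hblim⟩ := H.b_limit hx0.mem P hPprob mh νa hνa
  refine ⟨2 * ∫ ω, h ω x0 ∂P, hb, hblim, ?_⟩
  filter_upwards [hslln] with ω hω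
  set b := 2 * ∫ ω, h ω x0 ∂P with hbdef
  have hω' : Tendsto (fun n : ℕ => (∑ k ∈ Finset.range n, h (shift^[k] ω) x0) / n) atTop
      (𝓝 (b / 2)) := by
    have e : b / 2 = ∫ ω, h ω x0 ∂P := by rw [hbdef]; ring
    rw [e]; exact hω
  have hprob := hνprob ω
  obtain ⟨μα, hμ, hchar, hconv⟩ := levy (μ := ν ω)
    (Z := fun (n : ℕ) x => ((b * (n : ℝ)) ^ α⁻¹)⁻¹ *
      ∑ j ∈ Finset.range n, phiObs α x0 (randComp (fun i => lsv (γ i)) ω j x))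
    (Φ := fun t => Complex.exp (1 / 2 * ∫ y, Gst α t y))
    (fun n => by
      refine measurable_const.mul (Finset.measurable_sum _ fun j _ => ?_)
      have := randComp_measurable γ ω j
      unfold phiObs
      fun_prop)
    (Gst_cont0 hα)
    (fun t => by
      refine (H.stable_limit hx0 a hb hω' hα t).congr fun n => ?_
      refine integral_congr_ae (Eventually.of_forall fun x => ?_)
      exact (birkhoff_prod hb t x0 n (fun j => randComp (fun i => lsv (γ i)) ω j x)).symm)
  have hst : IsStableChar α μα := fun t => by
    rw [hchar t, stable_exponent hα t]
  exact ⟨μα, hμ, hst, fun μ' hμ' h' => stable_unique hst h', hconv⟩
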